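/- Let d = 2. Suppose ρ is a finite signed Borel measure on ℝ² and μ is a finite ℝ²-valued Borel measure on ℝ² such that div μ = ρ in the sense of distributions. Then there exists a non-negative Borel measure η on the space Γ of Lipschitz curves γ : [0,1] → ℝ² (with the sup-norm) such that μ = ∫_Γ μ_γ dη(γ), |μ| = ∫_Γ |μ_γ| dη(γ), and |div μ| = ∫_Γ |div μ_γ| dη(γ); moreover, for η-a.e. γ ∈ Γ there exists a curve γ̃ ∈ Γ which is injective on [0,1) such that μ_γ = μ_γ̃. -/

import Mathlib

open MeasureTheory Filter Classical
open scoped ENNReal NNReal RealInnerProductSpace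

noncomputable section
open scoped Classical

abbrev Ed (d : ℕ) : Type := EuclideanSpace ℝ (Fin d)

/-- A (Lipschitz) curve is a Lipschitz map `ℝ → ℝ^d`; only its restriction to `[0,1]` matters. -/
def IsLip {d : ℕ} (γ : ℝ → Ed d) : Prop := ∃ K : ℝ≥0, LipschitzWith K γ

/-- The space `Γ` of Lipschitz curves. -/
def Curve (d : ℕ) : Type := {γ : ℝ → Ed d // IsLip γ}

/-- Restriction of a curve to `[0,1]` as a continuous map; it induces the sup-norm topology
on the space of curves. -/
def curveRestrict {d : ℕ} (γ : Curve d) : C(Set.Icc (0:ℝ) 1, Ed d) :=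
  ⟨fun t => γ.1 t, by
    obtain ⟨K, hK⟩ := γ.2
    exact hK.continuous.comp continuous_subtype_val⟩

instance {d : ℕ} : TopologicalSpace (Curve d) :=
  TopologicalSpace.induced curveRestrict inferInstance

instance {d : ℕ} : MeasurableSpace (Curve d) := borel (Curve d)

/-- The pairing `⟨μ_γ, Φ⟩ = ∫₀¹ Φ(γ(t))·γ'(t) dt` of the vector measure induced by the curve
`γ` with a test vector field `Φ`. -/
def curvePair {d : ℕ} (γ : ℝ → Ed d) (Φ : Ed d → Ed d) : ℝ :=
  ∫ t in (0:ℝ)..1, ⟪Φ (γ t), deriv γ t⟫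

/-- The pairing `⟨|μ_γ|, f⟩ = ∫₀¹ f(γ(t)) ‖γ'(t)‖ dt` of the total variation of the measure
induced by the curve `γ` with a test function `f`. -/
def curveMass {d : ℕ} (γ : ℝ → Ed d) (f : Ed d → ℝ) : ℝ :=
  ∫ t in (0:ℝ)..1, f (γ t) * ‖deriv γ t‖

section

open Topology Set

section LipschitzCalculus

theorem LipschitzWith.acOnInterval {F : Type*} [NormedAddCommGroup F] {K : ℝ≥0} {γ : ℝ → F}
    (h : LipschitzWith K γ) (a b : ℝ) : AbsolutelyContinuousOnInterval γ a b :=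
  (h.lipschitzOnWith (s := Set.uIcc a b)).absolutelyContinuousOnInterval

variable {F : Type*} [NormedAddCommGroup F] [NormedSpace ℝ F]

theorem LipschitzWith.intervalIntegrable_deriv [FiniteDimensional ℝ F] {K : ℝ≥0} {γ : ℝ → F}
    (h : LipschitzWith K γ) (a b : ℝ) : IntervalIntegrable (deriv γ) volume a b := by
  have := FiniteDimensional.complete ℝ F
  refine (intervalIntegrable_const (c := (K : ℝ))).mono_fun'
    (stronglyMeasurable_deriv γ).aestronglyMeasurable ?_
  exact Eventually.of_forall fun t => norm_deriv_le_of_lipschitz h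

/-- The fundamental theorem of calculus for Lipschitz curves. -/
theorem LipschitzWith.integral_deriv_eq_sub [FiniteDimensional ℝ F] {K : ℝ≥0} {γ : ℝ → F}
    (h : LipschitzWith K γ) (a b : ℝ) : ∫ t in a..b, deriv γ t = γ b - γ a := by
  have := FiniteDimensional.complete ℝ F
  refine (SeparatingDual.eq_iff_forall_dual_eq (R := ℝ)).2 fun l => ?_
  rw [← ContinuousLinearMap.intervalIntegral_comp_comm l (h.intervalIntegrable_deriv a b), map_sub]
  have hl : LipschitzWith (‖l‖₊ * K) (fun t => l (γ t)) := l.lipschitz.comp h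
  rw [← (hl.acOnInterval a b).integral_deriv_eq_sub]
  refine intervalIntegral.integral_congr_ae ?_
  filter_upwards [h.ae_differentiableAt] with t ht _
  exact (l.hasFDerivAt.comp_hasDerivAt t ht.hasDerivAt).deriv.symm

end LipschitzCalculus

/-- The line integral of a vector field along a curve over `[a, b]`. -/
def lineInt (Φ : Ed 2 → Ed 2) (γ : ℝ → Ed 2) (a b : ℝ) : ℝ :=
  ∫ t in a..b, ⟪Φ (γ t), deriv γ t⟫

theorem intervalIntegrable_inner_deriv {K : ℝ≥0} {γ : ℝ → Ed 2} (h : LipschitzWith K γ)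
    {Ψ : ℝ → Ed 2} (hΨ : Continuous Ψ) (a b : ℝ) :
    IntervalIntegrable (fun t => ⟪Ψ t, deriv γ t⟫) volume a b := by
  refine IntervalIntegrable.mono_fun' (g := fun t => ‖Ψ t‖ * K)
    (Continuous.intervalIntegrable (by fun_prop) a b)
    (hΨ.aestronglyMeasurable.inner (stronglyMeasurable_deriv γ).aestronglyMeasurable) ?_
  refine Eventually.of_forall fun t => (norm_inner_le_norm _ _).trans ?_
  exact mul_le_mul_of_nonneg_left (norm_deriv_le_of_lipschitz h) (norm_nonneg _)

theorem integral_inner_deriv_const {K : ℝ≥0} {γ : ℝ → Ed 2} (h : LipschitzWith K γ) (v : Ed 2)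
    (a b : ℝ) : ∫ t in a..b, ⟪v, deriv γ t⟫ = ⟪v, γ b - γ a⟫ := by
  rw [← h.integral_deriv_eq_sub a b]
  exact (innerSL ℝ v).intervalIntegral_comp_comm (h.intervalIntegrable_deriv a b)

theorem abs_lineInt_le {K : ℝ≥0} {γ : ℝ → Ed 2} (h : LipschitzWith K γ) {Φ : Ed 2 → Ed 2} {C : ℝ}
    (hC : ∀ x, ‖Φ x‖ ≤ C) {a b : ℝ} (hab : a ≤ b) : |lineInt Φ γ a b| ≤ C * K * (b - a) := by
  have := intervalIntegral.norm_integral_le_of_norm_le_const (a := a) (b := b)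
    (f := fun t => ⟪Φ (γ t), deriv γ t⟫) (C := C * K) (fun t _ => by
      refine (norm_inner_le_norm _ _).trans ?_
      exact mul_le_mul (hC _) (norm_deriv_le_of_lipschitz h) (norm_nonneg _)
        ((norm_nonneg _).trans (hC 0)))
  rwa [abs_of_nonneg (sub_nonneg.2 hab)] at this

/-- A line integral over a short arc is close to the value with the field frozen. -/
theorem abs_lineInt_sub_le {K : ℝ≥0} {γ : ℝ → Ed 2} (h : LipschitzWith K γ) {Φ : Ed 2 → Ed 2}
    (hΦ : Continuous Φ) {ε δ : ℝ} (hε : ∀ x y, dist x y ≤ δ → ‖Φ x - Φ y‖ ≤ ε) {a b : ℝ}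
    (hab : a ≤ b) (hδ : K * (b - a) ≤ δ) :
    |lineInt Φ γ a b - ⟪Φ (γ a), γ b - γ a⟫| ≤ ε * K * (b - a) := by
  rw [← integral_inner_deriv_const h, lineInt, ← intervalIntegral.integral_sub
    (intervalIntegrable_inner_deriv h (Ψ := fun t => Φ (γ t)) (hΦ.comp h.continuous) a b)
    (intervalIntegrable_inner_deriv h (Ψ := fun _ => Φ (γ a)) continuous_const a b)]
  have := intervalIntegral.norm_integral_le_of_norm_le_const (a := a) (b := b)
    (f := fun t => ⟪Φ (γ t), deriv γ t⟫ - ⟪Φ (γ a), deriv γ t⟫) (C := ε * K) (fun t ht => by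
      rw [← inner_sub_left]
      refine (norm_inner_le_norm _ _).trans ?_
      rw [Set.uIoc_of_le hab] at ht
      have hd : dist (γ t) (γ a) ≤ δ := (h.dist_le_mul t a).trans (by
        rw [Real.dist_eq, abs_of_nonneg (by linarith [ht.1])]
        exact (mul_le_mul_of_nonneg_left (by linarith [ht.2]) K.2).trans hδ)
      exact mul_le_mul (hε _ _ hd) (norm_deriv_le_of_lipschitz h) (norm_nonneg _)
        ((norm_nonneg _).trans (hε _ _ hd)))
  rwa [abs_of_nonneg (sub_nonneg.2 hab)] at this

/-- Riemann sums of a line integral over `[0, 1]`. -/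
def riemannSum (Φ : Ed 2 → Ed 2) (N : ℕ) (γ : ℝ → Ed 2) : ℝ :=
  ∑ i ∈ Finset.range N, ⟪Φ (γ (i / N)), γ ((i + 1 : ℕ) / N) - γ (i / N)⟫

theorem abs_lineInt_sub_riemannSum_le {K : ℝ≥0} {γ : ℝ → Ed 2} (h : LipschitzWith K γ)
    {Φ : Ed 2 → Ed 2} (hΦ : Continuous Φ) {ε δ : ℝ} (hε : ∀ x y, dist x y ≤ δ → ‖Φ x - Φ y‖ ≤ ε)
    {N : ℕ} (hN : 0 < N) (hδ : K ≤ δ * N) :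
    |lineInt Φ γ 0 1 - riemannSum Φ N γ| ≤ ε * K := by
  have hN' : (0:ℝ) < N := by exact_mod_cast hN
  have hs := intervalIntegral.sum_integral_adjacent_intervals (n := N) (μ := volume)
    (a := fun i : ℕ => (i : ℝ) / N) (f := fun t => ⟪Φ (γ t), deriv γ t⟫) (fun k _ =>
      intervalIntegrable_inner_deriv h (hΦ.comp h.continuous) _ _)
  simp only [Nat.cast_zero, zero_div, div_self hN'.ne'] at hs
  rw [lineInt, ← hs, riemannSum, ← Finset.sum_sub_distrib]
  have hstep : ∀ i : ℕ, ((i + 1 : ℕ) : ℝ) / N - i / N = 1 / N := fun i => by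
    push_cast; ring
  calc _ ≤ ∑ i ∈ Finset.range N, ε * K * (1 / N) := by
        refine (Finset.abs_sum_le_sum_abs _ _).trans (Finset.sum_le_sum fun i _ => ?_)
        rw [← hstep i]
        refine abs_lineInt_sub_le h hΦ hε ?_ ?_
        · have := hstep i
          have : (0:ℝ) < 1 / N := by positivity
          linarith
        · rw [hstep, mul_one_div, div_le_iff₀ hN']; exact hδ
    _ = ε * K := by
        rw [Finset.sum_const, Finset.card_range, nsmul_eq_mul]; field_simp

/-- Bounded, uniformly continuous functions. -/
structure UCB {V : Type*} [NormedAddCommGroup V] (f : Ed 2 → V) : Prop where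
  uc : UniformContinuous f
  bdd : ∃ C, ∀ x, ‖f x‖ ≤ C

namespace UCB

variable {V : Type*} [NormedAddCommGroup V] {f g : Ed 2 → V}

theorem continuous (hf : UCB f) : Continuous f := hf.uc.continuous

theorem exists_pos_bound (hf : UCB f) : ∃ C, 0 < C ∧ ∀ x, ‖f x‖ ≤ C := by
  obtain ⟨C, hC⟩ := hf.bdd
  exact ⟨max C 1, by positivity, fun x => (hC x).trans (le_max_left _ _)⟩

theorem exists_modulus (hf : UCB f) {ε : ℝ} (hε : 0 < ε) :
    ∃ δ > 0, ∀ x y, dist x y ≤ δ → ‖f x - f y‖ ≤ ε := by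
  obtain ⟨δ, hδ, h⟩ := Metric.uniformContinuous_iff.1 hf.uc ε hε
  refine ⟨δ / 2, by positivity, fun x y hxy => ?_⟩
  rw [← dist_eq_norm]
  exact (h (by linarith)).le

theorem add (hf : UCB f) (hg : UCB g) : UCB (f + g) := by
  obtain ⟨C, hC⟩ := hf.bdd
  obtain ⟨D, hD⟩ := hg.bdd
  exact ⟨hf.uc.add hg.uc, C + D, fun x => (norm_add_le _ _).trans (add_le_add (hC x) (hD x))⟩

theorem neg (hf : UCB f) : UCB (-f) := by
  obtain ⟨C, hC⟩ := hf.bdd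
  exact ⟨hf.uc.neg, C, fun x => by simpa using hC x⟩

theorem sub (hf : UCB f) (hg : UCB g) : UCB (f - g) := by
  simpa [sub_eq_add_neg] using hf.add hg.neg

theorem smul [NormedSpace ℝ V] (hf : UCB f) (c : ℝ) : UCB (c • f) := by
  obtain ⟨C, hC⟩ := hf.bdd
  refine ⟨hf.uc.const_smul c, |c| * C, fun x => ?_⟩
  rw [Pi.smul_apply, norm_smul, Real.norm_eq_abs]
  exact mul_le_mul_of_nonneg_left (hC x) (abs_nonneg c)

theorem const (v : V) : UCB (fun _ => v) := ⟨uniformContinuous_const, ‖v‖, fun _ => le_rfl⟩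

theorem norm (hf : UCB f) : UCB (fun x => ‖f x‖) := by
  obtain ⟨C, hC⟩ := hf.bdd
  exact ⟨uniformContinuous_norm.comp hf.uc, C, fun x => by simpa using hC x⟩

theorem of_hasCompactSupport (hf : Continuous f) (hs : HasCompactSupport f) : UCB f :=
  ⟨hs.uniformContinuous_of_continuous hf, hf.bounded_above_of_compact_support hs⟩

theorem integrable (hf : UCB f) {μ : Measure (Ed 2)} [IsFiniteMeasure μ] [SecondCountableTopology V] :
    Integrable f μ := by
  obtain ⟨C, hC⟩ := hf.bdd
  exact Integrable.of_bound hf.continuous.aestronglyMeasurable C (Eventually.of_forall hC)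

theorem integrable_inner {Φ : Ed 2 → Ed 2} (hΦ : UCB Φ) {τ : Ed 2 → Ed 2} (hτ : Measurable τ)
    {μ : Measure (Ed 2)} [IsFiniteMeasure μ] (h1 : ∀ᵐ x ∂μ, ‖τ x‖ = 1) :
    Integrable (fun x => ⟪Φ x, τ x⟫) μ := by
  obtain ⟨C, hC⟩ := hΦ.bdd
  refine Integrable.of_bound
    (hΦ.continuous.aestronglyMeasurable.inner hτ.aestronglyMeasurable) C ?_
  filter_upwards [h1] with x hx
  exact (norm_inner_le_norm _ _).trans (by rw [hx, mul_one]; exact hC x)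

end UCB

/-- The cost of a parametrised curve: line integral of `Φ` plus the time integral of `f`. -/
def pathCost (Φ : Ed 2 → Ed 2) (f : Ed 2 → ℝ) (γ : ℝ → Ed 2) (a b : ℝ) : ℝ :=
  ∫ t in a..b, (⟪Φ (γ t), deriv γ t⟫ + f (γ t))

section PathCost

variable {Φ Ψ : Ed 2 → Ed 2} {f g : Ed 2 → ℝ} {γ γ₁ γ₂ : ℝ → Ed 2} {K : ℝ≥0}

theorem intervalIntegrable_pathCost (hΦ : Continuous Φ) (hf : Continuous f)
    (h : LipschitzWith K γ) (a b : ℝ) :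
    IntervalIntegrable (fun t => ⟪Φ (γ t), deriv γ t⟫ + f (γ t)) volume a b :=
  (intervalIntegrable_inner_deriv h (hΦ.comp h.continuous) a b).add
    ((hf.comp h.continuous).intervalIntegrable a b)

theorem pathCost_eq (hΦ : Continuous Φ) (hf : Continuous f) (h : LipschitzWith K γ) (a b : ℝ) :
    pathCost Φ f γ a b = lineInt Φ γ a b + ∫ t in a..b, f (γ t) :=
  intervalIntegral.integral_add (intervalIntegrable_inner_deriv h (hΦ.comp h.continuous) a b)
    ((hf.comp h.continuous).intervalIntegrable a b)

theorem pathCost_add_adjacent (hΦ : Continuous Φ) (hf : Continuous f) (h : LipschitzWith K γ)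
    (a b c : ℝ) : pathCost Φ f γ a b + pathCost Φ f γ b c = pathCost Φ f γ a c :=
  intervalIntegral.integral_add_adjacent_intervals (intervalIntegrable_pathCost hΦ hf h a b)
    (intervalIntegrable_pathCost hΦ hf h b c)

@[simp] theorem pathCost_self (a : ℝ) : pathCost Φ f γ a a = 0 := by simp [pathCost]

theorem pathCost_congr {a b : ℝ} (hab : a ≤ b) (h : EqOn γ₁ γ₂ (Ioo a b)) :
    pathCost Φ f γ₁ a b = pathCost Φ f γ₂ a b := by
  rw [pathCost, pathCost, intervalIntegral.integral_of_le hab, intervalIntegral.integral_of_le hab,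
    integral_Ioc_eq_integral_Ioo, integral_Ioc_eq_integral_Ioo]
  refine setIntegral_congr_fun measurableSet_Ioo fun t ht => ?_
  have : γ₁ =ᶠ[𝓝 t] γ₂ := Filter.eventuallyEq_of_mem (Ioo_mem_nhds ht.1 ht.2) h
  simp only [this.deriv_eq, h ht]

theorem pathCost_comp_add (c a b : ℝ) :
    pathCost Φ f (fun u => γ (u + c)) a b = pathCost Φ f γ (a + c) (b + c) := by
  simp only [pathCost, deriv_comp_add_const]
  exact intervalIntegral.integral_comp_add_right
    (fun t => ⟪Φ (γ t), deriv γ t⟫ + f (γ t)) c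

theorem lineInt_eq_pathCost : lineInt Φ γ = pathCost Φ 0 γ := by
  ext a b; simp [lineInt, pathCost]

theorem lineInt_congr {a b : ℝ} (hab : a ≤ b) (h : EqOn γ₁ γ₂ (Ioo a b)) :
    lineInt Φ γ₁ a b = lineInt Φ γ₂ a b := by
  rw [lineInt_eq_pathCost, lineInt_eq_pathCost, pathCost_congr hab h]

theorem lineInt_comp_affine (a T : ℝ) :
    lineInt Φ (fun s => γ (a + s * T)) 0 1 = lineInt Φ γ a (a + T) := by
  have hd : ∀ s, deriv (fun s => γ (a + s * T)) s = T • deriv γ (a + s * T) := fun s => by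
    have := deriv_comp_mul_left T (fun u => γ (a + u)) s
    rw [deriv_comp_const_add] at this
    simpa only [mul_comm T] using this
  have := intervalIntegral.smul_integral_comp_add_mul (a := 0) (b := 1)
    (fun t => ⟪Φ (γ t), deriv γ t⟫) T a
  simp only [mul_zero, add_zero, mul_one] at this
  rw [lineInt, lineInt, ← this, smul_eq_mul, ← intervalIntegral.integral_const_mul]
  refine intervalIntegral.integral_congr fun s _ => ?_
  simp only [hd, inner_smul_right, mul_comm s T]

theorem integral_comp_affine (a T : ℝ) :
    T * ∫ s in (0:ℝ)..1, f (γ (a + s * T)) = ∫ t in a..(a + T), f (γ t) := by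
  have := intervalIntegral.smul_integral_comp_add_mul (a := 0) (b := 1) (fun t => f (γ t)) T a
  simp only [mul_zero, add_zero, mul_one] at this
  rw [← this, smul_eq_mul]
  simp only [mul_comm T]

theorem abs_pathCost_le {C D : ℝ} (hC : ∀ x, ‖Φ x‖ ≤ C) (hD : ∀ x, ‖f x‖ ≤ D)
    (h : LipschitzWith 1 γ) {a b : ℝ} (hab : a ≤ b) :
    |pathCost Φ f γ a b| ≤ (C + D) * (b - a) := by
  have := intervalIntegral.norm_integral_le_of_norm_le_const (a := a) (b := b)
    (f := fun t => ⟪Φ (γ t), deriv γ t⟫ + f (γ t)) (C := C + D) (fun t _ => by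
      refine (norm_add_le _ _).trans (add_le_add ?_ (hD _))
      refine (norm_inner_le_norm _ _).trans ?_
      have h1 := norm_deriv_le_of_lipschitz (x₀ := t) h
      have h0 := (norm_nonneg _).trans (hC 0)
      calc _ ≤ C * 1 := mul_le_mul (hC _) (by simpa using h1) (norm_nonneg _) h0
        _ = C := mul_one C)
  rwa [abs_of_nonneg (sub_nonneg.2 hab)] at this

/-- Run along `γ₁` until time `s`, then along `γ₂` starting at time `t`. -/
def glue (γ₁ γ₂ : ℝ → Ed 2) (s t : ℝ) (u : ℝ) : Ed 2 := if u ≤ s then γ₁ u else γ₂ (u - s + t)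

theorem glue_of_le {s t u : ℝ} (h : u ≤ s) : glue γ₁ γ₂ s t u = γ₁ u := by simp [glue, h]

theorem glue_of_ge {s t u : ℝ} (hst : γ₁ s = γ₂ t) (h : s ≤ u) :
    glue γ₁ γ₂ s t u = γ₂ (u - s + t) := by
  rcases h.eq_or_lt with rfl | h
  · simp [glue, hst]
  · simp [glue, h]

theorem lipschitz_glue (h₁ : LipschitzWith 1 γ₁) (h₂ : LipschitzWith 1 γ₂) {s t : ℝ}
    (hst : γ₁ s = γ₂ t) : LipschitzWith 1 (glue γ₁ γ₂ s t) := by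
  have key : ∀ u v, u ≤ v → dist (glue γ₁ γ₂ s t u) (glue γ₁ γ₂ s t v) ≤ dist u v := by
    intro u v huv
    rcases le_total v s with hv | hv
    · rw [glue_of_le hv, glue_of_le (huv.trans hv)]
      simpa using h₁.dist_le_mul u v
    rcases le_total s u with hu | hu
    · rw [glue_of_ge hst hv, glue_of_ge hst hu]
      simpa using h₂.dist_le_mul (u - s + t) (v - s + t)
    · rw [glue_of_le hu, glue_of_ge hst hv]
      have e1 := h₁.dist_le_mul u s
      have e2 := h₂.dist_le_mul t (v - s + t)
      have e3 := dist_triangle (γ₁ u) (γ₁ s) (γ₂ (v - s + t))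
      rw [hst] at e3 e1
      simp only [Real.dist_eq, NNReal.coe_one, one_mul] at e1 e2 ⊢
      rw [abs_of_nonpos (by linarith)] at e1 e2 ⊢
      linarith
  refine LipschitzWith.of_dist_le_mul fun u v => ?_
  simp only [NNReal.coe_one, one_mul]
  rcases le_total u v with huv | huv
  · exact key u v huv
  · rw [dist_comm, dist_comm u]; exact key v u huv

theorem pathCost_glue (hΦ : Continuous Φ) (hf : Continuous f) (h₁ : LipschitzWith 1 γ₁)
    (h₂ : LipschitzWith 1 γ₂) {s t a b : ℝ} (hst : γ₁ s = γ₂ t) (has : a ≤ s) (hsb : s ≤ b) :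
    pathCost Φ f (glue γ₁ γ₂ s t) a b =
      pathCost Φ f γ₁ a s + pathCost Φ f γ₂ t (b - s + t) := by
  rw [← pathCost_add_adjacent hΦ hf (lipschitz_glue h₁ h₂ hst) a s b]
  congr 1
  · exact pathCost_congr has fun u hu => glue_of_le hu.2.le
  · rw [pathCost_congr (γ₂ := fun u => γ₂ (u + (t - s))) hsb fun u hu => by
      rw [glue_of_ge hst hu.1.le]; congr 1; ring]
    rw [pathCost_comp_add]
    congr 1 <;> ring

/-- The fundamental theorem of calculus along Lipschitz curves. -/
theorem integral_fderiv_comp_deriv {φ : Ed 2 → ℝ} {L : ℝ≥0} (hφ : LipschitzWith L φ)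
    (hd : Differentiable ℝ φ) (h : LipschitzWith K γ) (a b : ℝ) :
    ∫ t in a..b, fderiv ℝ φ (γ t) (deriv γ t) = φ (γ b) - φ (γ a) := by
  have hl : LipschitzWith (L * K) (fun t => φ (γ t)) := hφ.comp h
  rw [← hl.integral_deriv_eq_sub a b]
  refine intervalIntegral.integral_congr_ae ?_
  filter_upwards [h.ae_differentiableAt] with t ht _
  exact (((hd (γ t)).hasFDerivAt).comp_hasDerivAt t ht.hasDerivAt).deriv.symm

/-- The unit speed line through `x` in direction `u`. -/
theorem lipschitz_line (x : Ed 2) {u : Ed 2} (hu : ‖u‖ = 1) :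
    LipschitzWith 1 (fun t : ℝ => x + t • u) := by
  refine LipschitzWith.of_dist_le_mul fun s t => ?_
  rw [dist_add_left, dist_eq_norm, ← sub_smul, norm_smul, hu, mul_one, NNReal.coe_one, one_mul,
    Real.dist_eq, Real.norm_eq_abs]

end PathCost

/-- The space of pairs `(T, c)` with `c : [0, 1] → ℝ²` a `T`-Lipschitz curve. -/
def PathSpace : Type :=
  {p : ℝ × C(Set.Icc (0:ℝ) 1, Ed 2) // 0 ≤ p.1 ∧ ∀ s t, dist (p.2 s) (p.2 t) ≤ p.1 * dist s t}

namespace PathSpace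

instance : MetricSpace PathSpace := inferInstanceAs (MetricSpace
  {p : ℝ × C(Set.Icc (0:ℝ) 1, Ed 2) // 0 ≤ p.1 ∧ ∀ s t, dist (p.2 s) (p.2 t) ≤ p.1 * dist s t})

instance : MeasurableSpace PathSpace := borel PathSpace

instance : BorelSpace PathSpace := ⟨rfl⟩

/-- The Lipschitz constant, thought of as the duration of the curve. -/
def time (ξ : PathSpace) : ℝ := ξ.1.1

/-- The curve, extended to the real line by constants. -/
def cur (ξ : PathSpace) : ℝ → Ed 2 := Set.IccExtend zero_le_one ξ.1.2

theorem time_nonneg (ξ : PathSpace) : 0 ≤ ξ.time := ξ.2.1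

theorem cur_coe (ξ : PathSpace) (s : Set.Icc (0:ℝ) 1) : ξ.cur s = ξ.1.2 s := by simp [cur]

theorem dist_cur_le (ξ : PathSpace) (s t : ℝ) : dist (ξ.cur s) (ξ.cur t) ≤ ξ.time * dist s t := by
  refine (ξ.2.2 _ _).trans (mul_le_mul_of_nonneg_left ?_ ξ.2.1)
  simpa using (LipschitzWith.projIcc (zero_le_one (α := ℝ))).dist_le_mul s t

theorem lipschitz_cur (ξ : PathSpace) : LipschitzWith ⟨ξ.time, ξ.time_nonneg⟩ ξ.cur :=
  LipschitzWith.of_dist_le_mul fun s t => ξ.dist_cur_le s t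

theorem lipschitz_cur' (ξ : PathSpace) : LipschitzWith ξ.time.toNNReal ξ.cur :=
  LipschitzWith.of_dist_le_mul fun s t => by
    rw [Real.coe_toNNReal _ ξ.time_nonneg]; exact ξ.dist_cur_le s t

theorem dist_cur_le_time (ξ : PathSpace) {s t : ℝ} (hs : s ∈ Set.Icc (0:ℝ) 1)
    (ht : t ∈ Set.Icc (0:ℝ) 1) : dist (ξ.cur s) (ξ.cur t) ≤ ξ.time := by
  refine (ξ.dist_cur_le s t).trans ?_
  have : dist s t ≤ 1 := by rw [Real.dist_eq, abs_le]; constructor <;> linarith [hs.1, hs.2, ht.1, ht.2]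
  nlinarith [ξ.time_nonneg]

theorem continuous_time : Continuous time := continuous_fst.comp continuous_subtype_val

theorem continuous_coeMap : Continuous (fun ξ : PathSpace => ξ.1.2) :=
  continuous_snd.comp continuous_subtype_val

theorem continuous_cur_uncurry : Continuous (fun p : PathSpace × ℝ => p.1.cur p.2) := by
  have h1 : Continuous (fun p : PathSpace × ℝ => p.1.1.2) := continuous_coeMap.comp continuous_fst
  have h2 : Continuous (fun p : PathSpace × ℝ => Set.projIcc (0:ℝ) 1 zero_le_one p.2) :=
    continuous_projIcc.comp continuous_snd
  exact Continuous.eval h1 h2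

theorem continuous_cur_apply (s : ℝ) : Continuous (fun ξ : PathSpace => ξ.cur s) :=
  continuous_cur_uncurry.comp (by fun_prop : Continuous fun ξ : PathSpace => (ξ, s))

theorem isClosedEmbedding_val : IsClosedEmbedding
    (Subtype.val : PathSpace → ℝ × C(Set.Icc (0:ℝ) 1, Ed 2)) := by
  refine IsClosed.isClosedEmbedding_subtypeVal
    (s := {p : ℝ × C(Set.Icc (0:ℝ) 1, Ed 2) |
      0 ≤ p.1 ∧ ∀ s t, dist (p.2 s) (p.2 t) ≤ p.1 * dist s t}) ?_
  have : {p : ℝ × C(Set.Icc (0:ℝ) 1, Ed 2) |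
      0 ≤ p.1 ∧ ∀ s t, dist (p.2 s) (p.2 t) ≤ p.1 * dist s t} =
      {p | 0 ≤ p.1} ∩ ⋂ s, ⋂ t, {p | dist (p.2 s) (p.2 t) ≤ p.1 * dist s t} := by
    ext p; simp only [Set.mem_ofPred_eq, Set.mem_inter_iff, Set.mem_iInter]
  rw [this]
  refine (isClosed_le continuous_const continuous_fst).inter
    (isClosed_iInter fun s => isClosed_iInter fun t => isClosed_le ?_ (by fun_prop))
  exact ((continuous_eval_const s).comp continuous_snd).dist
    ((continuous_eval_const t).comp continuous_snd)

theorem isCompact_bounded (R : ℝ) :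
    IsCompact {ξ : PathSpace | ξ.time ≤ R ∧ ∀ s : Set.Icc (0:ℝ) 1, ‖ξ.cur s‖ ≤ R} := by
  have hA : IsCompact {c : C(Set.Icc (0:ℝ) 1, Ed 2) |
      (∀ s t, dist (c s) (c t) ≤ R * dist s t) ∧ ∀ s, c s ∈ Metric.closedBall (0 : Ed 2) R} := by
    refine ArzelaAscoli.isCompact_of_equicontinuous _ ?_ ?_
    · have : ContinuousMap.toFun '' {c : C(Set.Icc (0:ℝ) 1, Ed 2) |
          (∀ s t, dist (c s) (c t) ≤ R * dist s t) ∧ ∀ s, c s ∈ Metric.closedBall (0 : Ed 2) R} =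
          {g | ∀ s t, dist (g s) (g t) ≤ R * dist s t} ∩
            Set.pi Set.univ fun _ => Metric.closedBall (0 : Ed 2) R := by
        ext g
        constructor
        · rintro ⟨c, hc, rfl⟩
          exact ⟨hc.1, fun s _ => hc.2 s⟩
        · rintro ⟨h1, h2⟩
          refine ⟨⟨g, ?_⟩, ⟨h1, fun s => h2 s trivial⟩, rfl⟩
          refine (LipschitzWith.of_dist_le_mul (K := R.toNNReal) fun s t => ?_).continuous
          exact (h1 s t).trans (mul_le_mul_of_nonneg_right (Real.le_coe_toNNReal R) dist_nonneg)
      rw [this]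
      refine (isCompact_univ_pi fun _ => isCompact_closedBall _ _).inter_left ?_
      simp only [Set.ofPred_forall]
      exact isClosed_iInter fun s => isClosed_iInter fun t => isClosed_le
        ((continuous_apply s).dist (continuous_apply t)) continuous_const
    · refine (LipschitzWith.uniformEquicontinuous _ R.toNNReal fun c => ?_).equicontinuous
      exact LipschitzWith.of_dist_le_mul fun s t => (c.2.1 s t).trans
        (mul_le_mul_of_nonneg_right (Real.le_coe_toNNReal R) dist_nonneg)
  have hK := isClosedEmbedding_val.isCompact_preimage ((isCompact_Icc (a := (0:ℝ)) (b := R)).prod hA)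
  refine (congrArg IsCompact (Set.ext fun ξ => ?_)).mp hK
  simp only [Set.mem_ofPred_eq, mem_closedBall_zero_iff]
  refine Iff.symm ⟨?_, ?_⟩
  · rintro ⟨h1, h2⟩
    refine ⟨⟨ξ.2.1, h1⟩, fun s t => (ξ.2.2 s t).trans
      (mul_le_mul_of_nonneg_right h1 dist_nonneg), fun s => ?_⟩
    rw [← cur_coe]; exact h2 s
  · rintro ⟨h1, -, h3⟩
    exact ⟨h1.2, fun s => by rw [cur_coe]; exact h3 s⟩

instance : ProperSpace PathSpace := by
  refine ⟨fun ξ r => ?_⟩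
  refine (isCompact_bounded (max (ξ.time + r) (‖ξ.1.2‖ + r))).of_isClosed_subset
    Metric.isClosed_closedBall fun ζ hζ => ?_
  have hd : max (dist ζ.1.1 ξ.1.1) (dist ζ.1.2 ξ.1.2) ≤ r := Metric.mem_closedBall.1 hζ
  have h1 := (le_max_left _ _).trans hd
  have h2 := (le_max_right _ _).trans hd
  refine ⟨le_max_of_le_left ?_, fun s => le_max_of_le_right ?_⟩
  · have := (abs_le.1 (Real.dist_eq _ _ ▸ h1)).2
    show ζ.1.1 ≤ ξ.1.1 + r
    linarith
  · rw [cur_coe]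
    refine (ζ.1.2.norm_coe_le_norm s).trans ?_
    rw [dist_eq_norm] at h2
    have := norm_le_norm_add_norm_sub' ζ.1.2 ξ.1.2
    linarith

/-- The segment of a unit speed curve starting at time `a` of duration `T`. -/
def mk (γ : ℝ → Ed 2) (h : LipschitzWith 1 γ) (a : ℝ) {T : ℝ} (hT : 0 ≤ T) : PathSpace :=
  ⟨(T, ⟨fun s => γ (a + s * T), h.continuous.comp (by fun_prop)⟩), hT, fun s t => by
    refine (h.dist_le_mul _ _).trans ?_
    rw [NNReal.coe_one, one_mul, dist_add_left, Real.dist_eq, ← sub_mul, abs_mul, abs_of_nonneg hT,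
      mul_comm]
    rfl⟩

section mk

variable {γ : ℝ → Ed 2} (h : LipschitzWith 1 γ) (a : ℝ) {T : ℝ} (hT : 0 ≤ T)

@[simp] theorem time_mk : (mk γ h a hT).time = T := rfl

theorem cur_mk {s : ℝ} (hs : s ∈ Set.Icc (0:ℝ) 1) : (mk γ h a hT).cur s = γ (a + s * T) :=
  Set.IccExtend_of_mem _ _ hs

@[simp] theorem cur_mk_zero : (mk γ h a hT).cur 0 = γ a := by rw [cur_mk] <;> simp

@[simp] theorem cur_mk_one : (mk γ h a hT).cur 1 = γ (a + T) := by rw [cur_mk] <;> simp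

end mk

theorem exists_eq_mk (ξ : PathSpace) (hT : 0 < ξ.time) :
    ∃ (γ : ℝ → Ed 2) (h : LipschitzWith 1 γ), ξ = mk γ h 0 hT.le ∧
      ∀ t, γ t = ξ.cur (t / ξ.time) := by
  refine ⟨fun t => ξ.cur (t / ξ.time), ?_, ?_, fun _ => rfl⟩
  · refine LipschitzWith.of_dist_le_mul fun s t => (ξ.dist_cur_le _ _).trans (le_of_eq ?_)
    rw [Real.dist_eq, Real.dist_eq, ← sub_div, abs_div, abs_of_pos hT]
    simp; field_simp
  · refine Subtype.ext (Prod.ext rfl (ContinuousMap.ext fun s => ?_))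
    rw [← cur_coe]
    show _ = ξ.cur ((0 + s * ξ.time) / ξ.time)
    rw [zero_add, mul_div_cancel_right₀ _ hT.ne']

/-- The line integral of a vector field along a curve. -/
def circ (Φ : Ed 2 → Ed 2) (ξ : PathSpace) : ℝ := lineInt Φ ξ.cur 0 1

/-- The mean of a function along a curve. -/
def mean (f : Ed 2 → ℝ) (ξ : PathSpace) : ℝ := ∫ s in (0:ℝ)..1, f (ξ.cur s)

theorem continuous_mean {f : Ed 2 → ℝ} (hf : Continuous f) : Continuous (mean f) :=
  intervalIntegral.continuous_parametric_intervalIntegral_of_continuous'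
    (f := fun ξ s => f (cur ξ s)) (hf.comp continuous_cur_uncurry) 0 1

theorem continuous_riemannSum {Φ : Ed 2 → Ed 2} (hΦ : Continuous Φ) (N : ℕ) :
    Continuous fun ξ : PathSpace => riemannSum Φ N ξ.cur := by
  unfold riemannSum
  refine continuous_finsetSum _ fun i _ => ?_
  exact (hΦ.comp (continuous_cur_apply _)).inner
    ((continuous_cur_apply _).sub (continuous_cur_apply _))

theorem continuous_circ {Φ : Ed 2 → Ed 2} (hΦ : UCB Φ) : Continuous (circ Φ) := by
  refine continuous_of_locally_uniform_approx_of_continuousAt fun ξ u hu => ?_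
  obtain ⟨ε, hε, hu⟩ := Metric.mem_uniformity_dist.1 hu
  set R := ξ.time + 1 with hR
  have hR0 : 0 < R := by have := ξ.time_nonneg; positivity
  obtain ⟨δ, hδ, hm⟩ := hΦ.exists_modulus (ε := ε / (2 * R)) (by positivity)
  obtain ⟨N, hN⟩ := exists_nat_gt (R / δ)
  have hN0 : 0 < N := by
    have : (0:ℝ) < N := lt_of_le_of_lt (by positivity) hN
    exact_mod_cast this
  refine ⟨{ζ | ζ.time < R}, (isOpen_lt continuous_time continuous_const).mem_nhds
    (by simp [hR]), fun ζ => riemannSum Φ N ζ.cur,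
    (continuous_riemannSum hΦ.continuous N).continuousAt, fun ζ hζ => hu ?_⟩
  have hζ' : ζ.time < R := hζ
  rw [Real.dist_eq]
  refine (abs_lineInt_sub_riemannSum_le ζ.lipschitz_cur hΦ.continuous hm hN0 ?_).trans_lt ?_
  · show ζ.time ≤ _
    rw [div_lt_iff₀ hδ] at hN
    nlinarith
  · show ε / (2 * R) * ζ.time < ε
    rw [div_mul_eq_mul_div, div_lt_iff₀ (by positivity)]
    nlinarith

theorem abs_circ_le {Φ : Ed 2 → Ed 2} {C : ℝ} (hC : ∀ x, ‖Φ x‖ ≤ C) (ξ : PathSpace) :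
    |circ Φ ξ| ≤ C * ξ.time := by
  have := abs_lineInt_le ξ.lipschitz_cur hC zero_le_one
  rwa [sub_zero, mul_one] at this

theorem abs_mean_le {f : Ed 2 → ℝ} {C : ℝ} (hC : ∀ x, ‖f x‖ ≤ C) (ξ : PathSpace) :
    |mean f ξ| ≤ C := by
  have := intervalIntegral.norm_integral_le_of_norm_le_const (a := 0) (b := 1)
    (f := fun s => f (ξ.cur s)) (C := C) (fun s _ => hC _)
  rwa [sub_zero, abs_one, mul_one] at this

/-- The cost per unit time of a loop with respect to the field `Φ` and the density `f`; the
correction term makes it continuous on the whole space. -/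
def loopCost (Φ : Ed 2 → Ed 2) (f : Ed 2 → ℝ) (ξ : PathSpace) : ℝ :=
  (circ Φ ξ - ⟪Φ (ξ.cur 0), ξ.cur 1 - ξ.cur 0⟫) / ξ.time + mean f ξ

/-- The normalised cost of a path, with prices for the endpoints. -/
def arcCost (Φ : Ed 2 → Ed 2) (f p q : Ed 2 → ℝ) (ξ : PathSpace) : ℝ :=
  (circ Φ ξ + ξ.time * mean f ξ + p (ξ.cur 0) + q (ξ.cur 1)) / (1 + ξ.time)

theorem one_add_time_pos (ξ : PathSpace) : 0 < 1 + ξ.time := by have := ξ.time_nonneg; positivity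

theorem continuous_loopCost {Φ : Ed 2 → Ed 2} {f : Ed 2 → ℝ} (hΦ : UCB Φ) (hf : UCB f) :
    Continuous (loopCost Φ f) := by
  refine Continuous.add ?_ (continuous_mean hf.continuous)
  have hnum : Continuous fun ξ => circ Φ ξ - ⟪Φ (ξ.cur 0), ξ.cur 1 - ξ.cur 0⟫ :=
    (continuous_circ hΦ).sub ((hΦ.continuous.comp (continuous_cur_apply 0)).inner
      ((continuous_cur_apply 1).sub (continuous_cur_apply 0)))
  refine continuous_iff_continuousAt.2 fun ξ => ?_
  rcases ξ.time_nonneg.eq_or_lt with h0 | h0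
  · rw [Metric.continuousAt_iff']
    intro ε hε
    obtain ⟨δ, hδ, hm⟩ := hΦ.exists_modulus (ε := ε / 2) (by positivity)
    have : ∀ᶠ ζ in 𝓝 ξ, time ζ < δ :=
      (isOpen_lt continuous_time continuous_const).mem_nhds (by simpa [← h0] using hδ)
    filter_upwards [this] with ζ hζ
    rw [← h0, div_zero, Real.dist_eq, sub_zero, abs_div, abs_of_nonneg ζ.time_nonneg]
    have := abs_lineInt_sub_le ζ.lipschitz_cur hΦ.continuous hm zero_le_one
      (by rw [sub_zero, mul_one]; exact hζ.le)
    have h3 : |circ Φ ζ - ⟪Φ (ζ.cur 0), ζ.cur 1 - ζ.cur 0⟫| ≤ ε / 2 * ζ.time := by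
      rwa [sub_zero, mul_one] at this
    rcases ζ.time_nonneg.eq_or_lt with h1 | h1
    · rw [← h1, div_zero]; exact hε
    · rw [div_lt_iff₀ h1]; nlinarith
  · exact hnum.continuousAt.div continuous_time.continuousAt h0.ne'

theorem continuous_arcCost {Φ : Ed 2 → Ed 2} {f p q : Ed 2 → ℝ} (hΦ : UCB Φ) (hf : Continuous f)
    (hp : Continuous p) (hq : Continuous q) : Continuous (arcCost Φ f p q) := by
  refine Continuous.div ?_ (continuous_const.add continuous_time) fun ξ => ξ.one_add_time_pos.ne'
  exact (((continuous_circ hΦ).add (continuous_time.mul (continuous_mean hf))).add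
    (hp.comp (continuous_cur_apply 0))).add (hq.comp (continuous_cur_apply 1))

theorem exists_bound_loopCost {Φ : Ed 2 → Ed 2} {f : Ed 2 → ℝ} (hΦ : UCB Φ) (hf : UCB f) :
    ∃ C, ∀ ξ, ‖loopCost Φ f ξ‖ ≤ C := by
  obtain ⟨C, hC0, hC⟩ := hΦ.exists_pos_bound
  obtain ⟨D, hD⟩ := hf.bdd
  refine ⟨2 * C + D, fun ξ => (norm_add_le _ _).trans (add_le_add ?_ (abs_mean_le hD ξ))⟩
  rw [norm_div, Real.norm_eq_abs, Real.norm_eq_abs, abs_of_nonneg ξ.time_nonneg]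
  refine div_le_of_le_mul₀ ξ.time_nonneg (by positivity) ?_
  have h1 := abs_circ_le hC ξ
  have h2 : |⟪Φ (ξ.cur 0), ξ.cur 1 - ξ.cur 0⟫| ≤ C * ξ.time := by
    refine (abs_real_inner_le_norm _ _).trans
      (mul_le_mul (hC _) ?_ (norm_nonneg _) hC0.le)
    rw [← dist_eq_norm]; exact ξ.dist_cur_le_time (by simp) (by simp)
  refine (abs_sub _ _).trans ?_
  linarith

theorem exists_bound_arcCost {Φ : Ed 2 → Ed 2} {f p q : Ed 2 → ℝ} (hΦ : UCB Φ) (hf : UCB f)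
    (hp : UCB p) (hq : UCB q) : ∃ C, ∀ ξ, ‖arcCost Φ f p q ξ‖ ≤ C := by
  obtain ⟨C, hC0, hC⟩ := hΦ.exists_pos_bound
  obtain ⟨D, hD0, hD⟩ := hf.exists_pos_bound
  obtain ⟨P, hP0, hP⟩ := hp.exists_pos_bound
  obtain ⟨Q, hQ0, hQ⟩ := hq.exists_pos_bound
  refine ⟨C + D + P + Q, fun ξ => ?_⟩
  have hpos := ξ.one_add_time_pos
  have ht := ξ.time_nonneg
  rw [arcCost, norm_div, Real.norm_eq_abs, Real.norm_eq_abs, abs_of_pos hpos,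
    div_le_iff₀ hpos]
  have h1 := abs_circ_le hC ξ
  have h2 : |ξ.time * mean f ξ| ≤ ξ.time * D := by
    rw [abs_mul, abs_of_nonneg ht]; gcongr; exact abs_mean_le hD ξ
  have h3 := hP (ξ.cur 0)
  have h4 := hQ (ξ.cur 1)
  rw [Real.norm_eq_abs] at h3 h4
  have := abs_add_le (circ Φ ξ + ξ.time * mean f ξ + p (ξ.cur 0)) (q (ξ.cur 1))
  have := abs_add_le (circ Φ ξ + ξ.time * mean f ξ) (p (ξ.cur 0))
  have := abs_add_le (circ Φ ξ) (ξ.time * mean f ξ)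
  nlinarith [mul_nonneg hP0.le ht, mul_nonneg hQ0.le ht]

theorem circ_mk {γ : ℝ → Ed 2} (h : LipschitzWith 1 γ) (a : ℝ) {T : ℝ} (hT : 0 ≤ T)
    (Φ : Ed 2 → Ed 2) : circ Φ (mk γ h a hT) = lineInt Φ γ a (a + T) := by
  rw [circ, ← lineInt_comp_affine]
  exact lineInt_congr zero_le_one fun s hs => cur_mk h a hT ⟨hs.1.le, hs.2.le⟩

theorem time_mul_mean_mk {γ : ℝ → Ed 2} (h : LipschitzWith 1 γ) (a : ℝ) {T : ℝ} (hT : 0 ≤ T)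
    (f : Ed 2 → ℝ) : T * mean f (mk γ h a hT) = ∫ t in a..(a + T), f (γ t) := by
  rw [← integral_comp_affine]
  congr 1
  refine intervalIntegral.integral_congr fun s hs => ?_
  rw [Set.uIcc_of_le zero_le_one] at hs
  simp only [cur_mk h a hT hs]

theorem time_mul_loopCost_mk {γ : ℝ → Ed 2} (h : LipschitzWith 1 γ) (a : ℝ) {T : ℝ} (hT : 0 < T)
    (hl : γ a = γ (a + T)) {Φ : Ed 2 → Ed 2} (hΦ : Continuous Φ) {f : Ed 2 → ℝ}
    (hf : Continuous f) : T * loopCost Φ f (mk γ h a hT.le) = pathCost Φ f γ a (a + T) := by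
  rw [loopCost, mul_add, time_mul_mean_mk, circ_mk, cur_mk_zero, cur_mk_one, ← hl, sub_self,
    inner_zero_right, sub_zero, time_mk, mul_div_cancel₀ _ hT.ne', pathCost_eq hΦ hf h]

theorem arcCost_mk {γ : ℝ → Ed 2} (h : LipschitzWith 1 γ) (a : ℝ) {T : ℝ} (hT : 0 ≤ T)
    {Φ : Ed 2 → Ed 2} (hΦ : Continuous Φ) {f : Ed 2 → ℝ} (hf : Continuous f) (p q : Ed 2 → ℝ) :
    (1 + T) * arcCost Φ f p q (mk γ h a hT) =
      pathCost Φ f γ a (a + T) + p (γ a) + q (γ (a + T)) := by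
  have : (1 + T) ≠ 0 := by positivity
  rw [arcCost, time_mk, mul_div_cancel₀ _ this, cur_mk_zero, cur_mk_one,
    time_mul_mean_mk, circ_mk, pathCost_eq hΦ hf h]

end PathSpace

section Riesz

open scoped CompactlySupported BoundedContinuousFunction

variable {X : Type*} [MetricSpace X]

/-- A continuous cutoff function equal to `1` on the ball of radius `n`. -/
def cutoffFun (x₀ : X) (n : ℕ) (x : X) : ℝ := max 0 (min 1 (n + 1 - dist x x₀))

theorem continuous_cutoffFun (x₀ : X) (n : ℕ) : Continuous (cutoffFun x₀ n) := by
  unfold cutoffFun; fun_prop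

theorem cutoffFun_nonneg (x₀ : X) (n : ℕ) (x : X) : 0 ≤ cutoffFun x₀ n x := le_max_left _ _

theorem cutoffFun_le_one (x₀ : X) (n : ℕ) (x : X) : cutoffFun x₀ n x ≤ 1 :=
  max_le zero_le_one (min_le_left _ _)

theorem cutoffFun_eq_one {x₀ : X} {n : ℕ} {x : X} (h : dist x x₀ ≤ n) : cutoffFun x₀ n x = 1 := by
  rw [cutoffFun, min_eq_left (by linarith), max_eq_right zero_le_one]

theorem hasCompactSupport_cutoffFun [ProperSpace X] (x₀ : X) (n : ℕ) : HasCompactSupport (cutoffFun x₀ n) := by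
  refine HasCompactSupport.intro (isCompact_closedBall x₀ (n + 1)) fun x hx => ?_
  rw [Metric.mem_closedBall, not_le] at hx
  rw [cutoffFun, max_eq_left ((min_le_right _ _).trans (by linarith))]

theorem tendsto_cutoffFun (x₀ x : X) : Tendsto (fun n => cutoffFun x₀ n x) atTop (𝓝 1) := by
  obtain ⟨N, hN⟩ := exists_nat_ge (dist x x₀)
  refine tendsto_const_nhds.congr' ?_
  filter_upwards [eventually_ge_atTop N] with n hn
  exact (cutoffFun_eq_one (hN.trans (by exact_mod_cast hn))).symm

/-- A positive functional on bounded continuous functions dominates integration against a finite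
measure, with equality on functions vanishing at infinity. -/
theorem exists_measure_of_positive [ProperSpace X] [MeasurableSpace X] [BorelSpace X] (x₀ : X)
    (Λ : (X →ᵇ ℝ) →ₗ[ℝ] ℝ) (hΛ : ∀ k : X →ᵇ ℝ, 0 ≤ k → 0 ≤ Λ k) :
    ∃ lam : Measure X, IsFiniteMeasure lam ∧ (∀ k : X →ᵇ ℝ, 0 ≤ k → ∫ x, k x ∂lam ≤ Λ k) ∧
      ∀ k : X →ᵇ ℝ, Tendsto k (cocompact X) (𝓝 0) → ∫ x, k x ∂lam = Λ k := by
  have hmono : ∀ k l : X →ᵇ ℝ, (∀ x, k x ≤ l x) → Λ k ≤ Λ l := fun k l h => by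
    have := hΛ (l - k) fun x => sub_nonneg.2 (h x)
    rw [map_sub] at this; linarith
  let Λ' : C_c(X, ℝ) →ₚ[ℝ] ℝ :=
    { toFun := fun g => Λ g.toBoundedContinuousFunction
      map_add' := fun g h => by rw [← map_add]; rfl
      map_smul' := fun c g => by rw [RingHom.id_apply, ← map_smul]; rfl
      monotone' := fun g h hgh => hmono _ _ fun x => hgh x }
  let cut : ℕ → (X →ᵇ ℝ) → C_c(X, ℝ) := fun n k =>
    ⟨⟨fun x => cutoffFun x₀ n x * k x, (continuous_cutoffFun x₀ n).mul k.continuous⟩,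
      (hasCompactSupport_cutoffFun x₀ n).mul_right⟩
  have hcut : ∀ n k, ∫ x, cutoffFun x₀ n x * k x ∂(RealRMK.rieszMeasure Λ') =
      Λ (cut n k).toBoundedContinuousFunction := fun n k =>
    RealRMK.integral_rieszMeasure Λ' (cut n k)
  set lam := RealRMK.rieszMeasure Λ' with hlam
  have hfin : IsFiniteMeasure lam := by
    refine ⟨lt_of_le_of_lt (b := ENNReal.ofReal (Λ 1)) ?_ ENNReal.ofReal_lt_top⟩
    have hU : (⋃ n : ℕ, Metric.closedBall x₀ n) = univ := Metric.iUnion_closedBall_nat x₀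
    rw [← hU]
    refine le_of_tendsto' (tendsto_measure_iUnion_atTop fun m n hmn =>
      Metric.closedBall_subset_closedBall (by exact_mod_cast hmn)) fun n => ?_
    refine (RealRMK.rieszMeasure_le_of_eq_one Λ' (f := cut n 1) (fun x => ?_)
      (isCompact_closedBall x₀ n) fun x hx => ?_).trans (ENNReal.ofReal_le_ofReal ?_)
    · show 0 ≤ cutoffFun x₀ n x * 1
      rw [mul_one]; exact cutoffFun_nonneg x₀ n x
    · show cutoffFun x₀ n x * 1 = 1
      rw [mul_one]; exact cutoffFun_eq_one hx
    · refine hmono _ _ fun x => ?_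
      show cutoffFun x₀ n x * 1 ≤ 1
      rw [mul_one]; exact cutoffFun_le_one x₀ n x
  have hlim : ∀ k : X →ᵇ ℝ, Tendsto (fun n => Λ (cut n k).toBoundedContinuousFunction) atTop
      (𝓝 (∫ x, k x ∂lam)) := fun k => by
    simp only [← hcut]
    refine tendsto_integral_of_dominated_convergence (fun _ => ‖k‖) (fun n =>
      ((continuous_cutoffFun x₀ n).mul k.continuous).aestronglyMeasurable) (integrable_const _)
      (fun n => Eventually.of_forall fun x => ?_) (Eventually.of_forall fun x => ?_)
    · rw [norm_mul, Real.norm_eq_abs, abs_of_nonneg (cutoffFun_nonneg _ _ _)]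
      have := k.norm_coe_le_norm x
      nlinarith [cutoffFun_le_one x₀ n x, cutoffFun_nonneg x₀ n x, norm_nonneg (k x)]
    · simpa using (tendsto_cutoffFun x₀ x).mul_const (k x)
  refine ⟨lam, hfin, fun k hk => le_of_tendsto' (hlim k) fun n => hmono _ _ fun x => ?_,
    fun k hk => tendsto_nhds_unique (hlim k) ?_⟩
  · show cutoffFun x₀ n x * k x ≤ k x
    have : 0 ≤ k x := hk x
    nlinarith [cutoffFun_le_one x₀ n x]
  · rw [Metric.tendsto_atTop]
    intro ε hε
    set M := Λ 1 with hM
    have hM0 : 0 ≤ M := hΛ 1 fun x => zero_le_one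
    have hε' : 0 < ε / (M + 1) := by positivity
    have hev := hk (Metric.ball_mem_nhds 0 hε')
    obtain ⟨t, ht, hts⟩ := mem_cocompact.1 hev
    obtain ⟨R, hR⟩ := ht.isBounded.subset_closedBall x₀
    obtain ⟨N, hN⟩ := exists_nat_ge R
    refine ⟨N, fun n hn => ?_⟩
    have hsmall : ∀ x, |cutoffFun x₀ n x * k x - k x| ≤ ε / (M + 1) := fun x => by
      by_cases hx : dist x x₀ ≤ n
      · rw [cutoffFun_eq_one hx]; simp [hε'.le]
      · have hxt : x ∈ tᶜ := fun h => hx ((hR h).trans (hN.trans (by exact_mod_cast hn)))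
        have h1 : |k x| < ε / (M + 1) := by simpa using hts hxt
        have : cutoffFun x₀ n x * k x - k x = -((1 - cutoffFun x₀ n x) * k x) := by ring
        rw [this, abs_neg, abs_mul, abs_of_nonneg (by linarith [cutoffFun_le_one x₀ n x])]
        nlinarith [cutoffFun_le_one x₀ n x, cutoffFun_nonneg x₀ n x, abs_nonneg (k x)]
    have h1 : Λ ((cut n k).toBoundedContinuousFunction - k) ≤ Λ ((ε / (M + 1)) • (1 : X →ᵇ ℝ)) :=
      hmono _ _ fun x => by
        show cutoffFun x₀ n x * k x - k x ≤ ε / (M + 1) * 1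
        rw [mul_one]; exact (abs_le.1 (hsmall x)).2
    have h2 : Λ (-((ε / (M + 1)) • (1 : X →ᵇ ℝ))) ≤ Λ ((cut n k).toBoundedContinuousFunction - k) :=
      hmono _ _ fun x => by
        show -(ε / (M + 1) * 1) ≤ cutoffFun x₀ n x * k x - k x
        rw [mul_one]; exact (abs_le.1 (hsmall x)).1
    rw [map_neg] at h2
    rw [map_smul, map_sub, smul_eq_mul] at h1 h2
    have h3 : ε / (M + 1) * M < ε := by
      rw [div_mul_eq_mul_div, div_lt_iff₀ (by positivity)]; nlinarith
    rw [Real.dist_eq, abs_lt]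
    constructor <;> linarith

end Riesz

/-- A finite vector measure `τ σ` whose divergence is `ρp - ρm`. -/
structure DivFlow where
  σ : Measure (Ed 2)
  ρp : Measure (Ed 2)
  ρm : Measure (Ed 2)
  τ : Ed 2 → Ed 2
  finite_σ : IsFiniteMeasure σ
  finite_ρp : IsFiniteMeasure ρp
  finite_ρm : IsFiniteMeasure ρm
  measurable_τ : Measurable τ
  norm_τ : ∀ᵐ x ∂σ, ‖τ x‖ = 1
  div_eq : ∀ φ : Ed 2 → ℝ, ContDiff ℝ (⊤ : ℕ∞) φ → HasCompactSupport φ →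
    -∫ x, fderiv ℝ φ x (τ x) ∂σ = (∫ x, φ x ∂ρp) - ∫ x, φ x ∂ρm

attribute [instance] DivFlow.finite_σ DivFlow.finite_ρp DivFlow.finite_ρm

/-- The dual variables: a vector field, a density price and prices of the endpoints. -/
structure Price where
  Φ : Ed 2 → Ed 2
  f : Ed 2 → ℝ
  p : Ed 2 → ℝ
  q : Ed 2 → ℝ
  hΦ : UCB Φ
  hf : UCB f
  hp : UCB p
  hq : UCB q

namespace Price

instance : Add Price :=
  ⟨fun θ θ' => ⟨θ.Φ + θ'.Φ, θ.f + θ'.f, θ.p + θ'.p, θ.q + θ'.q, θ.hΦ.add θ'.hΦ, θ.hf.add θ'.hf,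
    θ.hp.add θ'.hp, θ.hq.add θ'.hq⟩⟩

instance : SMul ℝ Price :=
  ⟨fun c θ => ⟨c • θ.Φ, c • θ.f, c • θ.p, c • θ.q, θ.hΦ.smul c, θ.hf.smul c,
    θ.hp.smul c, θ.hq.smul c⟩⟩

/-- The price with constant functions and no vector field. -/
def const (a b c : ℝ) : Price :=
  ⟨fun _ => 0, fun _ => a, fun _ => b, fun _ => c, UCB.const 0, UCB.const a, UCB.const b,
    UCB.const c⟩

/-- The normalised cost of loops. -/
def loop (θ : Price) : PathSpace → ℝ := PathSpace.loopCost θ.Φ θ.f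

/-- The normalised cost of paths. -/
def arc (θ : Price) : PathSpace → ℝ := PathSpace.arcCost θ.Φ θ.f θ.p θ.q

theorem continuous_loop (θ : Price) : Continuous θ.loop := PathSpace.continuous_loopCost θ.hΦ θ.hf

theorem continuous_arc (θ : Price) : Continuous θ.arc :=
  PathSpace.continuous_arcCost θ.hΦ θ.hf.continuous θ.hp.continuous θ.hq.continuous

theorem exists_bound_loop (θ : Price) : ∃ C, ∀ ξ, ‖θ.loop ξ‖ ≤ C :=
  PathSpace.exists_bound_loopCost θ.hΦ θ.hf

theorem exists_bound_arc (θ : Price) : ∃ C, ∀ ξ, ‖θ.arc ξ‖ ≤ C :=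
  PathSpace.exists_bound_arcCost θ.hΦ θ.hf θ.hp θ.hq

theorem integrable_loop (θ : Price) {lam : Measure PathSpace} [IsFiniteMeasure lam] :
    Integrable θ.loop lam := by
  obtain ⟨C, hC⟩ := θ.exists_bound_loop
  exact Integrable.of_bound θ.continuous_loop.aestronglyMeasurable C (Eventually.of_forall hC)

theorem integrable_arc (θ : Price) {lam : Measure PathSpace} [IsFiniteMeasure lam] :
    Integrable θ.arc lam := by
  obtain ⟨C, hC⟩ := θ.exists_bound_arc
  exact Integrable.of_bound θ.continuous_arc.aestronglyMeasurable C (Eventually.of_forall hC)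

/-- The total price of a flow. -/
def total (θ : Price) (D : DivFlow) : ℝ :=
  ∫ x, max (⟪θ.Φ x, D.τ x⟫ + θ.f x) 0 ∂D.σ + ∫ x, max (θ.p x) 0 ∂D.ρp + ∫ x, max (θ.q x) 0 ∂D.ρm

theorem total_nonneg (θ : Price) (D : DivFlow) : 0 ≤ θ.total D :=
  add_nonneg (add_nonneg (integral_nonneg fun _ => le_max_right _ _)
    (integral_nonneg fun _ => le_max_right _ _)) (integral_nonneg fun _ => le_max_right _ _)

theorem integrable_density (θ : Price) (D : DivFlow) :
    Integrable (fun x => ⟪θ.Φ x, D.τ x⟫ + θ.f x) D.σ :=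
  (θ.hΦ.integrable_inner D.measurable_τ D.norm_τ).add θ.hf.integrable

theorem integral_max_add_le {α : Type*} [MeasurableSpace α] {μ : Measure α} {u v : α → ℝ}
    (hu : Integrable u μ) (hv : Integrable v μ) :
    ∫ x, max (u x + v x) 0 ∂μ ≤ ∫ x, max (u x) 0 ∂μ + ∫ x, max (v x) 0 ∂μ := by
  rw [← integral_add hu.pos_part hv.pos_part]
  refine integral_mono (hu.add hv).pos_part (hu.pos_part.add hv.pos_part) fun x => ?_
  exact max_le (add_le_add (le_max_left _ _) (le_max_left _ _))
    (add_nonneg (le_max_right _ _) (le_max_right _ _))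

theorem total_add_le (θ θ' : Price) (D : DivFlow) : (θ + θ').total D ≤ θ.total D + θ'.total D := by
  have h1 := integral_max_add_le (θ.integrable_density D) (θ'.integrable_density D)
  have h2 := integral_max_add_le (θ.hp.integrable (μ := D.ρp)) θ'.hp.integrable
  have h3 := integral_max_add_le (θ.hq.integrable (μ := D.ρm)) θ'.hq.integrable
  have e : ∀ x, ⟪(θ + θ').Φ x, D.τ x⟫ + (θ + θ').f x =
      ⟪θ.Φ x, D.τ x⟫ + θ.f x + (⟪θ'.Φ x, D.τ x⟫ + θ'.f x) := fun x => by
    show ⟪θ.Φ x + θ'.Φ x, D.τ x⟫ + (θ.f x + θ'.f x) = _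
    rw [inner_add_left]; ring
  simp only [total, e]
  have h2' : ∫ x, max ((θ + θ').p x) 0 ∂D.ρp ≤ _ := h2
  have h3' : ∫ x, max ((θ + θ').q x) 0 ∂D.ρm ≤ _ := h3
  linarith

theorem total_smul (θ : Price) (D : DivFlow) {c : ℝ} (hc : 0 ≤ c) :
    (c • θ).total D = c * θ.total D := by
  have e : ∀ x, max (⟪(c • θ).Φ x, D.τ x⟫ + (c • θ).f x) 0 =
      c * max (⟪θ.Φ x, D.τ x⟫ + θ.f x) 0 := fun x => by
    show max (⟪c • θ.Φ x, D.τ x⟫ + c * θ.f x) 0 = _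
    rw [real_inner_smul_left, ← mul_add, mul_max_of_nonneg _ _ hc, mul_zero]
  have e2 : ∀ x, max ((c • θ).p x) 0 = c * max (θ.p x) 0 := fun x => by
    show max (c * θ.p x) 0 = _
    rw [mul_max_of_nonneg _ _ hc, mul_zero]
  have e3 : ∀ x, max ((c • θ).q x) 0 = c * max (θ.q x) 0 := fun x => by
    show max (c * θ.q x) 0 = _
    rw [mul_max_of_nonneg _ _ hc, mul_zero]
  simp only [total, e, e2, e3, integral_const_mul]
  ring

end Price

namespace PathSpace

variable {Φ Ψ : Ed 2 → Ed 2} {f g : Ed 2 → ℝ}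

theorem circ_add (hΦ : Continuous Φ) (hΨ : Continuous Ψ) (ξ : PathSpace) :
    circ (Φ + Ψ) ξ = circ Φ ξ + circ Ψ ξ := by
  have hc := ξ.lipschitz_cur.continuous
  simp only [circ, lineInt, Pi.add_apply, inner_add_left]
  exact intervalIntegral.integral_add
    (intervalIntegrable_inner_deriv ξ.lipschitz_cur (hΦ.comp hc) 0 1)
    (intervalIntegrable_inner_deriv ξ.lipschitz_cur (hΨ.comp hc) 0 1)

theorem circ_smul (c : ℝ) (ξ : PathSpace) : circ (c • Φ) ξ = c * circ Φ ξ := by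
  simp only [circ, lineInt, Pi.smul_apply, real_inner_smul_left, intervalIntegral.integral_const_mul]

theorem mean_add (hf : Continuous f) (hg : Continuous g) (ξ : PathSpace) :
    mean (f + g) ξ = mean f ξ + mean g ξ := by
  have hc := ξ.lipschitz_cur.continuous
  exact intervalIntegral.integral_add ((hf.comp hc).intervalIntegrable 0 1)
    ((hg.comp hc).intervalIntegrable 0 1)

theorem mean_smul (c : ℝ) (ξ : PathSpace) : mean (c • f) ξ = c * mean f ξ := by
  simp only [mean, Pi.smul_apply, smul_eq_mul, intervalIntegral.integral_const_mul]

theorem mean_mono (hf : Continuous f) (hg : Continuous g) {ξ : PathSpace}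
    (h : ∀ s, f (ξ.cur s) ≤ g (ξ.cur s)) : mean f ξ ≤ mean g ξ := by
  have hc := ξ.lipschitz_cur.continuous
  exact intervalIntegral.integral_mono_on zero_le_one ((hf.comp hc).intervalIntegrable 0 1)
    ((hg.comp hc).intervalIntegrable 0 1) fun s _ => h s

@[simp] theorem mean_const (c : ℝ) (ξ : PathSpace) : mean (fun _ => c) ξ = c := by simp [mean]

theorem abs_circ_le_mean (hf : Continuous f) (h : ∀ x, ‖Φ x‖ ≤ f x)
    (ξ : PathSpace) : |circ Φ ξ| ≤ ξ.time * mean f ξ := by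
  have hc := ξ.lipschitz_cur.continuous
  rw [mean, ← intervalIntegral.integral_const_mul, circ, lineInt, ← Real.norm_eq_abs]
  refine intervalIntegral.norm_integral_le_of_norm_le zero_le_one
    (Eventually.of_forall fun s _ => ?_)
    (((hf.comp hc).const_mul _).intervalIntegrable 0 1)
  refine (norm_inner_le_norm _ _).trans ?_
  rw [mul_comm]
  exact mul_le_mul (norm_deriv_le_of_lipschitz ξ.lipschitz_cur) (h _) (norm_nonneg _) ξ.time_nonneg

end PathSpace

namespace Price

theorem loop_add (θ θ' : Price) (ξ : PathSpace) : (θ + θ').loop ξ = θ.loop ξ + θ'.loop ξ := by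
  show PathSpace.loopCost (θ.Φ + θ'.Φ) (θ.f + θ'.f) ξ = _
  simp only [loop, PathSpace.loopCost, PathSpace.circ_add θ.hΦ.continuous θ'.hΦ.continuous,
    PathSpace.mean_add θ.hf.continuous θ'.hf.continuous, Pi.add_apply, inner_add_left]
  ring

theorem arc_add (θ θ' : Price) (ξ : PathSpace) : (θ + θ').arc ξ = θ.arc ξ + θ'.arc ξ := by
  show PathSpace.arcCost (θ.Φ + θ'.Φ) (θ.f + θ'.f) (θ.p + θ'.p) (θ.q + θ'.q) ξ = _
  simp only [arc, PathSpace.arcCost, PathSpace.circ_add θ.hΦ.continuous θ'.hΦ.continuous,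
    PathSpace.mean_add θ.hf.continuous θ'.hf.continuous, Pi.add_apply]
  ring

theorem loop_smul (c : ℝ) (θ : Price) (ξ : PathSpace) : (c • θ).loop ξ = c * θ.loop ξ := by
  show PathSpace.loopCost (c • θ.Φ) (c • θ.f) ξ = _
  simp only [loop, PathSpace.loopCost, PathSpace.circ_smul, PathSpace.mean_smul, Pi.smul_apply,
    real_inner_smul_left]
  ring

theorem arc_smul (c : ℝ) (θ : Price) (ξ : PathSpace) : (c • θ).arc ξ = c * θ.arc ξ := by
  show PathSpace.arcCost (c • θ.Φ) (c • θ.f) (c • θ.p) (c • θ.q) ξ = _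
  simp only [arc, PathSpace.arcCost, PathSpace.circ_smul, PathSpace.mean_smul, Pi.smul_apply,
    smul_eq_mul]
  ring

theorem circ_zero (ξ : PathSpace) : PathSpace.circ (fun _ => 0) ξ = 0 := by
  simp [PathSpace.circ, lineInt]

theorem loop_const (a b c : ℝ) (ξ : PathSpace) : (const a b c).loop ξ = a := by
  simp [loop, const, PathSpace.loopCost, circ_zero]

theorem arc_const (a b c : ℝ) (ξ : PathSpace) :
    (const a b c).arc ξ = (ξ.time * a + b + c) / (1 + ξ.time) := by
  simp [arc, const, PathSpace.arcCost, circ_zero]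

theorem loop_nonneg (θ : Price) (h : ∀ x, ‖θ.Φ x‖ ≤ θ.f x) {ξ : PathSpace}
    (hξ : ξ.cur 0 = ξ.cur 1) : 0 ≤ θ.loop ξ := by
  rw [loop, PathSpace.loopCost, hξ, sub_self, inner_zero_right, sub_zero]
  have h1 := (abs_le.1 (PathSpace.abs_circ_le_mean θ.hf.continuous h ξ)).1
  have h2 : 0 ≤ PathSpace.mean θ.f ξ := by
    rw [← PathSpace.mean_const 0 ξ]
    exact PathSpace.mean_mono continuous_const θ.hf.continuous
      fun s => (norm_nonneg _).trans (h _)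
  rcases ξ.time_nonneg.eq_or_lt with h0 | h0
  · rw [← h0, div_zero, zero_add]; exact h2
  · rw [div_add' _ _ _ h0.ne']
    refine div_nonneg ?_ h0.le
    linarith

theorem arc_nonneg (θ : Price) (h : ∀ x, ‖θ.Φ x‖ ≤ θ.f x) (hp : ∀ x, 0 ≤ θ.p x)
    (hq : ∀ x, 0 ≤ θ.q x) (ξ : PathSpace) : 0 ≤ θ.arc ξ := by
  have h1 := (abs_le.1 (PathSpace.abs_circ_le_mean θ.hf.continuous h ξ)).1
  refine div_nonneg ?_ ξ.one_add_time_pos.le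
  have := hp (ξ.cur 0)
  have := hq (ξ.cur 1)
  linarith

end Price

/-- A positive weight vanishing at infinity. -/
def wt (x : Ed 2) : ℝ := (1 + ‖x‖)⁻¹

theorem wt_pos (x : Ed 2) : 0 < wt x := by unfold wt; positivity

theorem wt_le_one (x : Ed 2) : wt x ≤ 1 := inv_le_one_of_one_le₀ (by simp)

theorem abs_wt_sub_le (x y : Ed 2) : |wt x - wt y| ≤ dist x y := by
  have hx : 0 < 1 + ‖x‖ := by positivity
  have hy : 0 < 1 + ‖y‖ := by positivity
  rw [wt, wt, inv_sub_inv hx.ne' hy.ne', abs_div, abs_of_pos (mul_pos hx hy)]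
  refine div_le_of_le_mul₀ (by positivity) dist_nonneg ?_
  have h1 : |1 + ‖y‖ - (1 + ‖x‖)| ≤ dist x y := by
    rw [add_sub_add_left_eq_sub, dist_comm, dist_eq_norm]
    exact abs_norm_sub_norm_le y x
  have h2 : 1 ≤ (1 + ‖x‖) * (1 + ‖y‖) := by nlinarith [norm_nonneg x, norm_nonneg y]
  nlinarith [dist_nonneg (x := x) (y := y)]

theorem ucb_wt : UCB wt :=
  ⟨(LipschitzWith.of_dist_le_mul (K := 1) fun x y => by
      simpa [Real.dist_eq] using abs_wt_sub_le x y).uniformContinuous,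
    1, fun x => by rw [Real.norm_of_nonneg (wt_pos x).le]; exact wt_le_one x⟩

theorem continuous_wt : Continuous wt := ucb_wt.continuous

namespace PathSpace

/-- A positive gain per unit time for loops. -/
def loopReward (ξ : PathSpace) : ℝ := mean wt ξ / (1 + ξ.time * mean wt ξ)

/-- A positive gain for paths. -/
def arcReward (ξ : PathSpace) : ℝ := wt (ξ.cur 0) / (1 + ξ.time) ^ 2

theorem mean_wt_pos (ξ : PathSpace) : 0 < mean wt ξ :=
  intervalIntegral.intervalIntegral_pos_of_pos
    ((continuous_wt.comp ξ.lipschitz_cur.continuous).intervalIntegrable 0 1) (fun _ => wt_pos _)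
    one_pos

theorem mean_wt_le_one (ξ : PathSpace) : mean wt ξ ≤ 1 := by
  rw [← mean_const 1 ξ]
  exact mean_mono continuous_wt continuous_const fun _ => wt_le_one _

theorem loopReward_den_pos (ξ : PathSpace) : 0 < 1 + ξ.time * mean wt ξ := by
  have := ξ.time_nonneg
  have := ξ.mean_wt_pos
  positivity

theorem loopReward_pos (ξ : PathSpace) : 0 < loopReward ξ := div_pos ξ.mean_wt_pos ξ.loopReward_den_pos

theorem arcReward_pos (ξ : PathSpace) : 0 < arcReward ξ :=
  div_pos (wt_pos _) (pow_pos ξ.one_add_time_pos 2)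

theorem loopReward_le_mean (ξ : PathSpace) : loopReward ξ ≤ mean wt ξ := by
  refine div_le_self ξ.mean_wt_pos.le ?_
  have := ξ.time_nonneg
  have := ξ.mean_wt_pos
  simp only [le_add_iff_nonneg_right]
  positivity

theorem arcReward_le_wt (ξ : PathSpace) : arcReward ξ ≤ wt (ξ.cur 0) := by
  refine div_le_self (wt_pos _).le (one_le_pow₀ ?_)
  linarith [ξ.time_nonneg]

theorem time_mul_loopReward_le_one (ξ : PathSpace) : ξ.time * loopReward ξ ≤ 1 := by
  rw [loopReward, ← mul_div_assoc, div_le_one ξ.loopReward_den_pos]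
  linarith

theorem time_mul_arcReward_le_one (ξ : PathSpace) : ξ.time * arcReward ξ ≤ 1 := by
  have h := ξ.one_add_time_pos
  rw [arcReward, ← mul_div_assoc, div_le_one (pow_pos h 2)]
  have := ξ.time_nonneg
  nlinarith [wt_pos (ξ.cur 0), wt_le_one (ξ.cur 0)]

theorem continuous_loopReward : Continuous loopReward := by
  have h := continuous_mean continuous_wt
  exact h.div (continuous_const.add (continuous_time.mul h)) fun ξ => ξ.loopReward_den_pos.ne'

theorem continuous_arcReward : Continuous arcReward := by
  refine (continuous_wt.comp (continuous_cur_apply 0)).div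
    ((continuous_const.add continuous_time).pow 2) fun ξ => (pow_pos ξ.one_add_time_pos 2).ne'

/-- A criterion for vanishing at infinity on the space of curves. -/
theorem tendsto_cocompact_of {r : PathSpace → ℝ} (h0 : ∀ ξ, 0 ≤ r ξ) (h1 : ∀ ξ, ξ.time * r ξ ≤ 1)
    (h2 : ∀ ξ, ∀ R : ℝ, 0 ≤ R → (∀ s : Set.Icc (0:ℝ) 1, R ≤ ‖ξ.cur s‖) → (1 + R) * r ξ ≤ 1) :
    Tendsto r (cocompact PathSpace) (𝓝 0) := by
  rw [Metric.tendsto_nhds]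
  intro ε hε
  have hmem := (isCompact_bounded (2 / ε)).compl_mem_cocompact
  filter_upwards [hmem] with ξ hξ
  rw [dist_zero_right, Real.norm_of_nonneg (h0 ξ)]
  by_contra! hcon
  have hT : ξ.time ≤ 1 / ε := by
    rw [le_div_iff₀ hε]
    nlinarith [h1 ξ, ξ.time_nonneg]
  refine hξ ⟨hT.trans (by gcongr; norm_num), fun s => ?_⟩
  by_contra! hs
  have hR : 0 < 1 / ε := by positivity
  have := h2 ξ (1 / ε) hR.le fun s' => by
    have hd := ξ.dist_cur_le_time s.2 s'.2
    have h3 : ‖ξ.cur s‖ - ‖ξ.cur s'‖ ≤ dist (ξ.cur s) (ξ.cur s') := by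
      rw [dist_eq_norm]; exact norm_sub_norm_le _ _
    have : 2 / ε = 1 / ε + 1 / ε := by ring
    linarith
  have : (1 + 1 / ε) * ε ≤ 1 := by
    refine le_trans ?_ this
    gcongr
  rw [add_mul, one_div_mul_cancel hε.ne'] at this
  linarith

theorem wt_le_of_le {R : ℝ} {x : Ed 2} (h : R ≤ ‖x‖) : (1 + R) * wt x ≤ 1 := by
  rw [wt, ← div_eq_mul_inv, div_le_one (by positivity)]
  linarith

theorem tendsto_loopReward : Tendsto loopReward (cocompact PathSpace) (𝓝 0) := by
  refine tendsto_cocompact_of (fun ξ => ξ.loopReward_pos.le) time_mul_loopReward_le_one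
    fun ξ R hR h => ?_
  refine (mul_le_mul_of_nonneg_left ξ.loopReward_le_mean (by positivity)).trans ?_
  rw [← mean_smul]
  refine (intervalIntegral.integral_mono_on (g := fun _ => (1:ℝ)) zero_le_one
    (((continuous_wt.comp ξ.lipschitz_cur.continuous).intervalIntegrable 0 1).const_mul _)
    intervalIntegrable_const fun s hs => ?_).trans (by simp)
  exact wt_le_of_le (h ⟨s, hs⟩)

theorem tendsto_arcReward : Tendsto arcReward (cocompact PathSpace) (𝓝 0) := by
  refine tendsto_cocompact_of (fun ξ => ξ.arcReward_pos.le) time_mul_arcReward_le_one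
    fun ξ R hR h => ?_
  exact (mul_le_mul_of_nonneg_left ξ.arcReward_le_wt (by positivity)).trans
    (wt_le_of_le (h ⟨0, by simp⟩))

theorem loopReward_le_one (ξ : PathSpace) : loopReward ξ ≤ 1 :=
  ξ.loopReward_le_mean.trans ξ.mean_wt_le_one

theorem arcReward_le_one (ξ : PathSpace) : arcReward ξ ≤ 1 :=
  ξ.arcReward_le_wt.trans (wt_le_one _)

theorem exists_cur_const (x : Ed 2) : ∃ ξ : PathSpace, ξ.time = 0 ∧ ∀ s, ξ.cur s = x :=
  ⟨⟨(0, ContinuousMap.const _ x), le_rfl, fun s t => by simp⟩, rfl, fun s => by simp [cur, Set.IccExtend]⟩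

end PathSpace

open PathSpace BoundedContinuousFunction

/-- The price dominates the rewards. -/
structure Price.Feasible (θ : Price) : Prop where
  loop : ∀ ξ : PathSpace, ξ.cur 0 = ξ.cur 1 → loopReward ξ ≤ θ.loop ξ
  arc : ∀ ξ, arcReward ξ ≤ θ.arc ξ

/-- The price dominates the payments `k₁` on loops and `k₂` on paths. -/
structure Price.Dominates (θ : Price) (k : (PathSpace →ᵇ ℝ) × (PathSpace →ᵇ ℝ)) : Prop where
  loop : ∀ ξ : PathSpace, ξ.cur 0 = ξ.cur 1 → k.1 ξ ≤ θ.loop ξ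
  arc : ∀ ξ, k.2 ξ ≤ θ.arc ξ

theorem Price.exists_dominates (k : (PathSpace →ᵇ ℝ) × (PathSpace →ᵇ ℝ)) :
    ∃ θ : Price, θ.Dominates k := by
  refine ⟨Price.const (‖k.1‖ + ‖k.2‖) (‖k.1‖ + ‖k.2‖) 0, fun ξ _ => ?_, fun ξ => ?_⟩
  · rw [Price.loop_const]
    have := (le_abs_self _).trans (k.1.norm_coe_le_norm ξ)
    linarith [norm_nonneg k.2]
  · rw [Price.arc_const, le_div_iff₀ ξ.one_add_time_pos]
    have := (le_abs_self _).trans (k.2.norm_coe_le_norm ξ)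
    nlinarith [norm_nonneg k.1, ξ.time_nonneg, mul_nonneg ξ.time_nonneg (norm_nonneg k.1)]

/-- The cheapest price dominating given payments. -/
def price (D : DivFlow) (k : (PathSpace →ᵇ ℝ) × (PathSpace →ᵇ ℝ)) : ℝ :=
  sInf {t | ∃ θ : Price, θ.Dominates k ∧ θ.total D = t}

section

variable {D : DivFlow} {k l : (PathSpace →ᵇ ℝ) × (PathSpace →ᵇ ℝ)}

theorem price_le {θ : Price} (h : θ.Dominates k) : price D k ≤ θ.total D :=
  csInf_le ⟨0, by rintro _ ⟨θ, -, rfl⟩; exact θ.total_nonneg D⟩ ⟨θ, h, rfl⟩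

theorem price_nonneg : 0 ≤ price D k :=
  Real.sInf_nonneg (by rintro _ ⟨θ, -, rfl⟩; exact θ.total_nonneg D)

theorem exists_total_lt {ε : ℝ} (hε : 0 < ε) :
    ∃ θ : Price, θ.Dominates k ∧ θ.total D < price D k + ε := by
  obtain ⟨θ₀, h₀⟩ := Price.exists_dominates k
  obtain ⟨_, ⟨θ, h, rfl⟩, hlt⟩ := Real.lt_sInf_add_pos (s := {t | ∃ θ : Price, θ.Dominates k ∧ θ.total D = t})
    ⟨_, θ₀, h₀, rfl⟩ hε
  exact ⟨θ, h, hlt⟩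

theorem price_add_le : price D (k + l) ≤ price D k + price D l := by
  refine le_of_forall_pos_le_add fun ε hε => ?_
  obtain ⟨θ, h, hlt⟩ := exists_total_lt (D := D) (k := k) (half_pos hε)
  obtain ⟨θ', h', hlt'⟩ := exists_total_lt (D := D) (k := l) (half_pos hε)
  have : (θ + θ').Dominates (k + l) :=
    ⟨fun ξ hξ => by rw [Price.loop_add]; exact add_le_add (h.loop ξ hξ) (h'.loop ξ hξ),
      fun ξ => by rw [Price.arc_add]; exact add_le_add (h.arc ξ) (h'.arc ξ)⟩
  have := (price_le (D := D) this).trans (θ.total_add_le θ' D)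
  linarith

theorem price_smul_le {c : ℝ} (hc : 0 < c) : price D (c • k) ≤ c * price D k := by
  refine le_of_forall_pos_le_add fun ε hε => ?_
  obtain ⟨θ, h, hlt⟩ := exists_total_lt (D := D) (k := k) (div_pos hε hc)
  have : (c • θ).Dominates (c • k) :=
    ⟨fun ξ hξ => by rw [Price.loop_smul]; exact mul_le_mul_of_nonneg_left (h.loop ξ hξ) hc.le,
      fun ξ => by rw [Price.arc_smul]; exact mul_le_mul_of_nonneg_left (h.arc ξ) hc.le⟩
  have := price_le (D := D) this
  rw [θ.total_smul D hc.le] at this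
  have h3 := mul_lt_mul_of_pos_left hlt hc
  rw [mul_add, mul_div_cancel₀ _ hc.ne'] at h3
  linarith

theorem price_smul {c : ℝ} (hc : 0 < c) : price D (c • k) = c * price D k := by
  refine le_antisymm (price_smul_le hc) ?_
  have := price_smul_le (D := D) (k := c • k) (inv_pos.2 hc)
  rw [inv_smul_smul₀ hc.ne'] at this
  rwa [← div_eq_inv_mul, le_div_iff₀' hc] at this

end

theorem total_const_zero (D : DivFlow) : (Price.const 0 0 0).total D = 0 := by
  simp [Price.total, Price.const]

theorem price_nonpos {D : DivFlow} {k : (PathSpace →ᵇ ℝ) × (PathSpace →ᵇ ℝ)}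
    (h1 : ∀ ξ : PathSpace, ξ.cur 0 = ξ.cur 1 → k.1 ξ ≤ 0) (h2 : ∀ ξ, k.2 ξ ≤ 0) : price D k ≤ 0 := by
  rw [← total_const_zero D]
  refine price_le ⟨fun ξ hξ => ?_, fun ξ => ?_⟩
  · rw [Price.loop_const]; exact h1 ξ hξ
  · rw [Price.arc_const]; simpa using h2 ξ

/-- A functional dominated by the price which is tight at a given payment. -/
theorem exists_tight_functional (D : DivFlow) (F : (PathSpace →ᵇ ℝ) × (PathSpace →ᵇ ℝ)) (hF : F ≠ 0) :
    ∃ Λ : ((PathSpace →ᵇ ℝ) × (PathSpace →ᵇ ℝ)) →ₗ[ℝ] ℝ, (∀ k, Λ k ≤ price D k) ∧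
      Λ F = price D F := by
  obtain ⟨Λ, h1, h2⟩ := exists_extension_of_le_sublinear
    (LinearPMap.mkSpanSingleton F (price D F) hF) (price D) (fun c hc k => price_smul hc)
    (fun k l => price_add_le) (by
      rintro ⟨x, hx⟩
      obtain ⟨c, rfl⟩ := Submodule.mem_span_singleton.1 hx
      refine (LinearPMap.mkSpanSingleton'_apply (σ := RingHom.id ℝ) F (price D F) _ c hx).trans_le ?_
      show c • price D F ≤ price D (c • F)
      rcases lt_trichotomy c 0 with hc | rfl | hc
      · exact (mul_nonpos_of_nonpos_of_nonneg hc.le price_nonneg).trans price_nonneg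
      · rw [zero_smul]; exact price_nonneg
      · rw [price_smul hc, smul_eq_mul])
  refine ⟨Λ, h2, ?_⟩
  have := h1 ⟨F, Submodule.mem_span_singleton_self F⟩
  rw [this]
  exact LinearPMap.mkSpanSingleton_apply ℝ ℝ (σ := RingHom.id ℝ) hF (price D F)

/-- Measures on loops and paths solving the maximisation problem dual to the price. -/
theorem exists_dual_measures (D : DivFlow) : ∃ lam₁ lam₂ : Measure PathSpace,
    IsFiniteMeasure lam₁ ∧ IsFiniteMeasure lam₂ ∧ (∀ᵐ ξ ∂lam₁, ξ.cur 0 = ξ.cur 1) ∧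
    (∀ θ : Price, (∀ x, ‖θ.Φ x‖ ≤ θ.f x) → (∀ x, 0 ≤ θ.p x) → (∀ x, 0 ≤ θ.q x) →
      ∫ ξ, θ.loop ξ ∂lam₁ + ∫ ξ, θ.arc ξ ∂lam₂ ≤ θ.total D) ∧
    ∀ ε > 0, ∃ θ : Price, θ.Feasible ∧
      θ.total D < ∫ ξ, loopReward ξ ∂lam₁ + ∫ ξ, arcReward ξ ∂lam₂ + ε := by
  let F₁ : PathSpace →ᵇ ℝ := BoundedContinuousFunction.ofNormedAddCommGroup loopReward
    continuous_loopReward 1 fun ξ => by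
      rw [Real.norm_of_nonneg ξ.loopReward_pos.le]; exact ξ.loopReward_le_one
  let F₂ : PathSpace →ᵇ ℝ := BoundedContinuousFunction.ofNormedAddCommGroup arcReward
    continuous_arcReward 1 fun ξ => by
      rw [Real.norm_of_nonneg ξ.arcReward_pos.le]; exact ξ.arcReward_le_one
  obtain ⟨ξ₀, -, -⟩ := exists_cur_const 0
  have hF : (F₁, F₂) ≠ 0 := fun h => by
    have : F₁ ξ₀ = 0 := by rw [(Prod.mk_eq_zero.1 h).1]; rfl
    exact ξ₀.loopReward_pos.ne' this
  obtain ⟨Λ, hΛ, hΛF⟩ := exists_tight_functional D (F₁, F₂) hF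
  have hpos₁ : ∀ k : PathSpace →ᵇ ℝ, 0 ≤ k → 0 ≤ Λ (k, 0) := fun k hk => by
    have := (hΛ (-(k, 0))).trans (price_nonpos (fun ξ _ => neg_nonpos.2 (hk ξ)) fun ξ => by simp)
    rw [map_neg] at this
    linarith
  have hpos₂ : ∀ k : PathSpace →ᵇ ℝ, 0 ≤ k → 0 ≤ Λ (0, k) := fun k hk => by
    have := (hΛ (-(0, k))).trans (price_nonpos (fun ξ _ => by simp) fun ξ => neg_nonpos.2 (hk ξ))
    rw [map_neg] at this
    linarith
  have hsplit : ∀ k l, Λ (k, 0) + Λ (0, l) = Λ (k, l) := fun k l => by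
    rw [← map_add]; simp
  obtain ⟨lam₁, hfin₁, hle₁, heq₁⟩ := exists_measure_of_positive ξ₀ (Λ ∘ₗ LinearMap.inl ℝ _ _) hpos₁
  obtain ⟨lam₂, hfin₂, hle₂, heq₂⟩ := exists_measure_of_positive ξ₀ (Λ ∘ₗ LinearMap.inr ℝ _ _) hpos₂
  refine ⟨lam₁, lam₂, hfin₁, hfin₂, ?_, fun θ hf hp hq => ?_, fun ε hε => ?_⟩
  · let k : PathSpace →ᵇ ℝ := BoundedContinuousFunction.ofNormedAddCommGroup
      (fun ξ => min (dist (ξ.cur 0) (ξ.cur 1)) 1)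
      (((continuous_cur_apply 0).dist (continuous_cur_apply 1)).min continuous_const) 1 fun ξ => by
        rw [Real.norm_of_nonneg (le_min dist_nonneg zero_le_one)]; exact min_le_right _ _
    have hk : ∀ ξ, k ξ = min (dist (ξ.cur 0) (ξ.cur 1)) 1 := fun _ => rfl
    have hk0 : 0 ≤ k := fun ξ => le_min dist_nonneg zero_le_one
    have h1 : ∫ ξ, k ξ ∂lam₁ ≤ 0 := (hle₁ k hk0).trans <| (hΛ _).trans <|
      price_nonpos (fun ξ hξ => by simp [hk, hξ]) fun ξ => by simp
    have h2 := (integral_eq_zero_iff_of_nonneg (μ := lam₁) (f := k) hk0 (k.integrable _)).1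
      (h1.antisymm (integral_nonneg hk0))
    filter_upwards [h2] with ξ hξ
    have : min (dist (ξ.cur 0) (ξ.cur 1)) 1 = 0 := hξ
    rcases min_choice (dist (ξ.cur 0) (ξ.cur 1)) 1 with h | h
    · exact dist_eq_zero.1 (h ▸ this)
    · rw [h] at this; norm_num at this
  · obtain ⟨C, hC⟩ := θ.exists_bound_loop
    obtain ⟨C', hC'⟩ := θ.exists_bound_arc
    let k : PathSpace →ᵇ ℝ := BoundedContinuousFunction.ofNormedAddCommGroup
      (fun ξ => max (θ.loop ξ) 0) (θ.continuous_loop.max continuous_const) C fun ξ => by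
        rw [Real.norm_of_nonneg (le_max_right _ _)]
        exact max_le ((le_abs_self _).trans (hC ξ)) ((norm_nonneg _).trans (hC ξ))
    let l : PathSpace →ᵇ ℝ := BoundedContinuousFunction.ofNormedAddCommGroup θ.arc
      θ.continuous_arc C' hC'
    have h1 : ∫ ξ, θ.loop ξ ∂lam₁ ≤ ∫ ξ, k ξ ∂lam₁ :=
      integral_mono θ.integrable_loop (k.integrable _) fun ξ => le_max_left _ _
    have h2 := hle₁ k fun ξ => le_max_right _ _
    have h3 := hle₂ l fun ξ => θ.arc_nonneg hf hp hq ξ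
    have h4 := (hΛ (k, l)).trans (price_le (D := D) (θ := θ)
      ⟨fun ξ hξ => max_le le_rfl (θ.loop_nonneg hf hξ), fun ξ => le_rfl⟩)
    rw [← hsplit] at h4
    have h5 : ∫ ξ, θ.arc ξ ∂lam₂ ≤ Λ (0, l) := h3
    have h6 : ∫ ξ, k ξ ∂lam₁ ≤ Λ (k, 0) := h2
    linarith
  · obtain ⟨θ, h, hlt⟩ := exists_total_lt (D := D) (k := (F₁, F₂)) hε
    refine ⟨θ, ⟨h.loop, h.arc⟩, hlt.trans_eq ?_⟩
    have h1 : ∫ ξ, loopReward ξ ∂lam₁ = Λ (F₁, 0) := heq₁ F₁ tendsto_loopReward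
    have h2 : ∫ ξ, arcReward ξ ∂lam₂ = Λ (0, F₂) := heq₂ F₂ tendsto_arcReward
    rw [h1, h2, hsplit, hΛF]

theorem integral_withDensity_ofReal {α : Type*} [MeasurableSpace α] {μ : Measure α} {w : α → ℝ}
    (hw : Measurable w) (h0 : ∀ x, 0 ≤ w x) (g : α → ℝ) :
    ∫ x, g x ∂μ.withDensity (fun x => ENNReal.ofReal (w x)) = ∫ x, w x * g x ∂μ := by
  refine (integral_withDensity_eq_integral_smul (f := fun x => (w x).toNNReal)
    hw.real_toNNReal g).trans ?_
  refine integral_congr_ae (Eventually.of_forall fun x => ?_)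
  show ((w x).toNNReal : ℝ) * g x = w x * g x
  rw [Real.coe_toNNReal _ (h0 x)]

theorem isFiniteMeasure_withDensity_of_le_one {α : Type*} [MeasurableSpace α] {μ : Measure α}
    [IsFiniteMeasure μ] {w : α → ℝ} (h1 : ∀ x, w x ≤ 1) :
    IsFiniteMeasure (μ.withDensity fun x => ENNReal.ofReal (w x)) := by
  refine isFiniteMeasure_withDensity (ne_of_lt ?_)
  refine (lintegral_mono (g := fun _ => (1 : ℝ≥0∞)) fun x => ?_).trans_lt
    (by simp)
  exact ENNReal.ofReal_le_one.2 (h1 x)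

/-- Comparison of measures by testing with nonnegative functions. -/
theorem measure_le_of_forall_integral_le {μ ν : Measure (Ed 2)} [IsFiniteMeasure μ] [IsFiniteMeasure ν]
    (h : ∀ f : Ed 2 → ℝ, UCB f → (∀ x, 0 ≤ f x) → ∫ x, f x ∂μ ≤ ∫ x, f x ∂ν) : μ ≤ ν := by
  have hclosed : ∀ F, IsClosed F → μ F ≤ ν F := fun F hF => by
    have hδ : ∀ n : ℕ, 0 < 1 / ((n : ℝ) + 1) := fun n => Nat.one_div_pos_of_nat
    have hlim := tendsto_one_div_add_atTop_nhds_zero_nat (𝕜 := ℝ)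
    refine le_of_tendsto_of_tendsto' (tendsto_lintegral_thickenedIndicator_of_isClosed μ hF hδ hlim)
      (tendsto_lintegral_thickenedIndicator_of_isClosed ν hF hδ hlim) fun n => ?_
    have hb : ∀ x, ‖(thickenedIndicator (hδ n) F x : ℝ)‖ ≤ 1 := fun x => by
      rw [Real.norm_of_nonneg (NNReal.coe_nonneg _)]
      exact_mod_cast thickenedIndicator_le_one (hδ n) F x
    have hu : UCB fun x => (thickenedIndicator (hδ n) F x : ℝ) :=
      ⟨(uniformContinuous_subtype_val (p := fun r : ℝ => 0 ≤ r)).comp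
        (lipschitzWith_thickenedIndicator (hδ n) F).uniformContinuous, 1, hb⟩
    have := h _ hu fun x => NNReal.coe_nonneg _
    have e : ∀ (ξ : Measure (Ed 2)) [IsFiniteMeasure ξ],
        ∫⁻ x, (thickenedIndicator (hδ n) F x : ℝ≥0∞) ∂ξ =
          ENNReal.ofReal (∫ x, (thickenedIndicator (hδ n) F x : ℝ) ∂ξ) := fun ξ _ => by
      rw [ofReal_integral_eq_lintegral_ofReal hu.integrable
        (Eventually.of_forall fun x => NNReal.coe_nonneg _)]
      simp
    rw [e μ, e ν]
    exact ENNReal.ofReal_le_ofReal this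
  refine Measure.le_iff.2 fun s hs => ?_
  rw [hs.measure_eq_iSup_isClosed_of_ne_top (measure_ne_top μ s)]
  exact iSup₂_le fun F hF => iSup_le fun hFc => (hclosed F hFc).trans (measure_mono hF)

/-- If the integrals of nonnegative functions are arbitrarily small, the functions are
arbitrarily small almost everywhere. -/
theorem ae_forall_exists_lt_of_integral {α : Type*} [MeasurableSpace α] {μ : Measure α}
    {u : ℕ → α → ℝ} (hu : ∀ n, Measurable (u n)) (hi : ∀ n, Integrable (u n) μ)
    (h0 : ∀ n, ∀ᵐ x ∂μ, 0 ≤ u n x)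
    (h : ∀ ε > 0, ∃ n, ∫ x, u n x ∂μ < ε) : ∀ᵐ x ∂μ, ∀ ε > 0, ∃ n, u n x < ε := by
  have hm : Measurable fun x => ⨅ n, ENNReal.ofReal (u n x) :=
    Measurable.iInf fun n => (hu n).ennreal_ofReal
  have hz : ∫⁻ x, ⨅ n, ENNReal.ofReal (u n x) ∂μ = 0 := by
    refine le_antisymm (ENNReal.le_of_forall_pos_le_add fun ε hε _ => ?_) zero_le
    obtain ⟨n, hn⟩ := h ε hε
    rw [zero_add]
    refine (lintegral_mono fun x => iInf_le _ n).trans ?_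
    rw [← ofReal_integral_eq_lintegral_ofReal (hi n) (h0 n)]
    exact (ENNReal.ofReal_le_ofReal hn.le).trans_eq (by simp)
  filter_upwards [(lintegral_eq_zero_iff hm).1 hz] with x hx ε hε
  have : ⨅ n, ENNReal.ofReal (u n x) < ENNReal.ofReal ε := by
    have : ⨅ n, ENNReal.ofReal (u n x) = 0 := hx
    rw [this]; simpa using hε
  obtain ⟨n, hn⟩ := iInf_lt_iff.1 this
  exact ⟨n, (ENNReal.ofReal_lt_ofReal_iff hε).1 hn⟩

/-- Approximation of the direction field by a bounded continuous field. -/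
theorem DivFlow.exists_approx (D : DivFlow) {ε : ℝ} (hε : 0 < ε) :
    ∃ Ψ : Ed 2 → Ed 2, UCB Ψ ∧ (∀ x, ‖Ψ x‖ ≤ 1) ∧ ∫ x, ‖D.τ x - Ψ x‖ ∂D.σ ≤ ε := by
  have hτ : Integrable D.τ D.σ := Integrable.of_bound D.measurable_τ.aestronglyMeasurable 1
    (D.norm_τ.mono fun x hx => hx.le)
  obtain ⟨g, hgs, hg1, hgc, hgi⟩ := hτ.exists_hasCompactSupport_integral_sub_le (half_pos hε)
  have hmax : ∀ x, 0 < max 1 ‖g x‖ := fun x => lt_max_of_lt_left one_pos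
  have hΨc : Continuous fun x => (max 1 ‖g x‖)⁻¹ • g x :=
    ((continuous_const.max hgc.norm).inv₀ fun x => (hmax x).ne').smul hgc
  have hΨ : UCB fun x => (max 1 ‖g x‖)⁻¹ • g x := by
    refine UCB.of_hasCompactSupport hΨc ?_
    exact hgs.smul_left (f := fun x => (max 1 ‖g x‖)⁻¹)
  refine ⟨_, hΨ, fun x => ?_, ?_⟩
  · rw [norm_smul, norm_inv, Real.norm_of_nonneg (hmax x).le, inv_mul_le_iff₀ (hmax x), mul_one]
    exact le_max_right _ _
  · have hle : ∀ᵐ x ∂D.σ, ‖D.τ x - (max 1 ‖g x‖)⁻¹ • g x‖ ≤ 2 * ‖D.τ x - g x‖ := by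
      filter_upwards [D.norm_τ] with x hx
      have h1 : ‖g x - (max 1 ‖g x‖)⁻¹ • g x‖ ≤ ‖D.τ x - g x‖ := by
        have : g x - (max 1 ‖g x‖)⁻¹ • g x = (1 - (max 1 ‖g x‖)⁻¹) • g x := by
          rw [sub_smul, one_smul]
        have h2 : ‖g x‖ ≤ 1 + ‖D.τ x - g x‖ := by
          have := norm_sub_norm_le (g x) (D.τ x)
          rw [norm_sub_rev, hx] at this
          linarith
        rw [this, norm_smul, Real.norm_of_nonneg (by
          rw [sub_nonneg]; exact inv_le_one_of_one_le₀ (le_max_left _ _))]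
        rcases le_total ‖g x‖ 1 with h | h
        · rw [max_eq_left h]; simp
        · rw [max_eq_right h, sub_mul, inv_mul_cancel₀ (by positivity)]; linarith
      calc ‖D.τ x - (max 1 ‖g x‖)⁻¹ • g x‖
          = ‖(D.τ x - g x) + (g x - (max 1 ‖g x‖)⁻¹ • g x)‖ := by rw [sub_add_sub_cancel]
        _ ≤ ‖D.τ x - g x‖ + ‖g x - (max 1 ‖g x‖)⁻¹ • g x‖ := norm_add_le _ _
        _ ≤ 2 * ‖D.τ x - g x‖ := by linarith
    refine (integral_mono_ae (hτ.sub hΨ.integrable).norm ((hτ.sub hgi).norm.const_mul 2) hle).trans ?_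
    rw [integral_const_mul]
    exact (mul_le_mul_of_nonneg_left hg1 two_pos.le).trans_eq (by ring)

namespace PathSpace

/-- The circulation per unit time. -/
def speed (Φ : Ed 2 → Ed 2) (ξ : PathSpace) : ℝ := circ Φ ξ / ξ.time

theorem measurable_speed {Φ : Ed 2 → Ed 2} (hΦ : UCB Φ) : Measurable (speed Φ) :=
  (continuous_circ hΦ).measurable.div continuous_time.measurable

theorem abs_speed_le {Φ : Ed 2 → Ed 2} {C : ℝ} (hC : ∀ x, ‖Φ x‖ ≤ C) (ξ : PathSpace) :
    |speed Φ ξ| ≤ C := by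
  rw [speed, abs_div, abs_of_nonneg ξ.time_nonneg]
  exact div_le_of_le_mul₀ ξ.time_nonneg ((norm_nonneg _).trans (hC 0)) (abs_circ_le hC ξ)

theorem integrable_speed {Φ : Ed 2 → Ed 2} (hΦ : UCB Φ) {lam : Measure PathSpace}
    [IsFiniteMeasure lam] : Integrable (speed Φ) lam := by
  obtain ⟨C, hC⟩ := hΦ.bdd
  exact Integrable.of_bound (measurable_speed hΦ).aestronglyMeasurable C
    (Eventually.of_forall (abs_speed_le hC))

theorem integrable_mean {f : Ed 2 → ℝ} (hf : UCB f) {lam : Measure PathSpace}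
    [IsFiniteMeasure lam] : Integrable (mean f) lam := by
  obtain ⟨C, hC⟩ := hf.bdd
  exact Integrable.of_bound (continuous_mean hf.continuous).aestronglyMeasurable C
    (Eventually.of_forall (abs_mean_le hC))

theorem measurable_pathWeight : Measurable fun ξ : PathSpace => ξ.time / (1 + ξ.time) :=
  continuous_time.measurable.div (continuous_const.add continuous_time).measurable

theorem measurable_endWeight : Measurable fun ξ : PathSpace => 1 / (1 + ξ.time) :=
  measurable_const.div (continuous_const.add continuous_time).measurable

theorem pathWeight_nonneg (ξ : PathSpace) : 0 ≤ ξ.time / (1 + ξ.time) :=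
  div_nonneg ξ.time_nonneg ξ.one_add_time_pos.le

theorem pathWeight_le_one (ξ : PathSpace) : ξ.time / (1 + ξ.time) ≤ 1 :=
  (div_le_one ξ.one_add_time_pos).2 (by linarith)

theorem endWeight_nonneg (ξ : PathSpace) : 0 ≤ 1 / (1 + ξ.time) :=
  div_nonneg zero_le_one ξ.one_add_time_pos.le

theorem endWeight_le_one (ξ : PathSpace) : 1 / (1 + ξ.time) ≤ 1 :=
  (div_le_one ξ.one_add_time_pos).2 (by linarith [ξ.time_nonneg])

end PathSpace

/-- Measures on loops and paths which are compatible with a flow. -/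
structure Packing (D : DivFlow) where
  lam₁ : Measure PathSpace
  lam₂ : Measure PathSpace
  finite₁ : IsFiniteMeasure lam₁
  finite₂ : IsFiniteMeasure lam₂
  isLoop : ∀ᵐ ξ ∂lam₁, ξ.cur 0 = ξ.cur 1
  le_total : ∀ θ : Price, (∀ x, ‖θ.Φ x‖ ≤ θ.f x) → (∀ x, 0 ≤ θ.p x) → (∀ x, 0 ≤ θ.q x) →
      ∫ ξ, θ.loop ξ ∂lam₁ + ∫ ξ, θ.arc ξ ∂lam₂ ≤ θ.total D

attribute [instance] Packing.finite₁ Packing.finite₂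

namespace Packing

variable {D : DivFlow} (P : Packing D)

/-- Time-weighted paths. -/
def lamT : Measure PathSpace :=
  P.lam₂.withDensity fun ξ => ENNReal.ofReal (ξ.time / (1 + ξ.time))

/-- End-weighted paths. -/
def lamE : Measure PathSpace :=
  P.lam₂.withDensity fun ξ => ENNReal.ofReal (1 / (1 + ξ.time))

instance : IsFiniteMeasure P.lamT := isFiniteMeasure_withDensity_of_le_one pathWeight_le_one

instance : IsFiniteMeasure P.lamE := isFiniteMeasure_withDensity_of_le_one endWeight_le_one

/-- All curves, weighted by their duration. -/
def kap : Measure PathSpace := P.lam₁ + P.lamT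

instance : IsFiniteMeasure P.kap := inferInstanceAs (IsFiniteMeasure (P.lam₁ + P.lamT))

/-- The distribution of the starting points. -/
def start : Measure (Ed 2) := P.lamE.map fun ξ => ξ.cur 0

/-- The distribution of the end points. -/
def sink : Measure (Ed 2) := P.lamE.map fun ξ => ξ.cur 1

/-- The occupation measure. -/
def occ : Measure (Ed 2) :=
  (P.kap.prod (volume.restrict (Ioc (0:ℝ) 1))).map fun z => z.1.cur z.2

instance : IsFiniteMeasure P.start := inferInstanceAs (IsFiniteMeasure (Measure.map _ _))

instance : IsFiniteMeasure P.sink := inferInstanceAs (IsFiniteMeasure (Measure.map _ _))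

instance : IsFiniteMeasure P.occ := inferInstanceAs (IsFiniteMeasure (Measure.map _ _))

theorem integral_start {p : Ed 2 → ℝ} (hp : Continuous p) :
    ∫ x, p x ∂P.start = ∫ ξ, 1 / (1 + ξ.time) * p (ξ.cur 0) ∂P.lam₂ := by
  rw [start, integral_map (continuous_cur_apply 0).aemeasurable hp.aestronglyMeasurable, lamE,
    integral_withDensity_ofReal measurable_endWeight endWeight_nonneg]

theorem integral_sink {q : Ed 2 → ℝ} (hq : Continuous q) :
    ∫ x, q x ∂P.sink = ∫ ξ, 1 / (1 + ξ.time) * q (ξ.cur 1) ∂P.lam₂ := by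
  rw [sink, integral_map (continuous_cur_apply 1).aemeasurable hq.aestronglyMeasurable, lamE,
    integral_withDensity_ofReal measurable_endWeight endWeight_nonneg]

theorem integral_occ {f : Ed 2 → ℝ} (hf : UCB f) : ∫ x, f x ∂P.occ = ∫ ξ, mean f ξ ∂P.kap := by
  obtain ⟨C, hC⟩ := hf.bdd
  rw [occ, integral_map continuous_cur_uncurry.aemeasurable hf.continuous.aestronglyMeasurable,
    integral_prod]
  · refine integral_congr_ae (Eventually.of_forall fun ξ => ?_)
    exact (intervalIntegral.integral_of_le zero_le_one).symm
  · exact Integrable.of_bound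
      (hf.continuous.comp continuous_cur_uncurry).aestronglyMeasurable C
      (Eventually.of_forall fun _ => hC _)

theorem integral_kap {g : PathSpace → ℝ} (hg : ∀ lam : Measure PathSpace, IsFiniteMeasure lam →
    Integrable g lam) : ∫ ξ, g ξ ∂P.kap =
      ∫ ξ, g ξ ∂P.lam₁ + ∫ ξ, ξ.time / (1 + ξ.time) * g ξ ∂P.lam₂ := by
  rw [kap, integral_add_measure (hg _ inferInstance) (hg _ inferInstance), lamT,
    integral_withDensity_ofReal measurable_pathWeight pathWeight_nonneg]

theorem integrable_weight_mul {w g : PathSpace → ℝ} (hw : Measurable w) (h0 : ∀ ξ, 0 ≤ w ξ)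
    (h1 : ∀ ξ, w ξ ≤ 1) (hg : Integrable g P.lam₂) : Integrable (fun ξ => w ξ * g ξ) P.lam₂ :=
  hg.bdd_mul hw.aestronglyMeasurable (c := 1) (Eventually.of_forall fun ξ => by
    rw [Real.norm_of_nonneg (h0 ξ)]; exact h1 ξ)

theorem integral_cost (θ : Price) : ∫ ξ, θ.loop ξ ∂P.lam₁ + ∫ ξ, θ.arc ξ ∂P.lam₂ =
    ∫ ξ, (speed θ.Φ ξ + mean θ.f ξ) ∂P.kap + ∫ x, θ.p x ∂P.start + ∫ x, θ.q x ∂P.sink := by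
  rw [P.integral_kap (g := fun ξ => speed θ.Φ ξ + mean θ.f ξ) fun lam _ => (integrable_speed θ.hΦ).add (integrable_mean θ.hf),
    P.integral_start θ.hp.continuous, P.integral_sink θ.hq.continuous, add_assoc, add_assoc]
  congr 1
  · refine integral_congr_ae ?_
    filter_upwards [P.isLoop] with ξ hξ
    rw [Price.loop, loopCost, hξ, sub_self, inner_zero_right, sub_zero, speed]
  · have hb : ∀ {p : Ed 2 → ℝ} (_ : UCB p) (s : ℝ), Integrable (fun ξ => p (ξ.cur s)) P.lam₂ := by
      intro p hp s
      obtain ⟨C, hC⟩ := hp.bdd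
      exact Integrable.of_bound (hp.continuous.comp (continuous_cur_apply s)).aestronglyMeasurable C
        (Eventually.of_forall fun ξ => hC _)
    rw [← integral_add (P.integrable_weight_mul measurable_endWeight endWeight_nonneg
        endWeight_le_one (hb θ.hp 0)) (P.integrable_weight_mul measurable_endWeight
        endWeight_nonneg endWeight_le_one (hb θ.hq 1))]
    refine Eq.trans ?_ (integral_add (P.integrable_weight_mul
        (g := fun ξ => speed θ.Φ ξ + mean θ.f ξ) measurable_pathWeight pathWeight_nonneg
        pathWeight_le_one ((integrable_speed θ.hΦ).add (integrable_mean θ.hf)))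
        ((P.integrable_weight_mul measurable_endWeight endWeight_nonneg
        endWeight_le_one (hb θ.hp 0)).add (P.integrable_weight_mul measurable_endWeight
        endWeight_nonneg endWeight_le_one (hb θ.hq 1))))
    refine integral_congr_ae (Eventually.of_forall fun ξ => ?_)
    have h := ξ.one_add_time_pos
    have hc : ξ.time * speed θ.Φ ξ = circ θ.Φ ξ := by
      rcases ξ.time_nonneg.eq_or_lt with h0 | h0
      · obtain ⟨C, hC⟩ := θ.hΦ.bdd
        have := abs_circ_le hC ξ
        rw [← h0, mul_zero] at this
        rw [← h0, zero_mul, abs_nonpos_iff.1 this]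
      · rw [speed, mul_div_cancel₀ _ h0.ne']
    simp only [Price.arc, arcCost, ← hc]
    field_simp
    ring

theorem cost_le (θ : Price) (hf : ∀ x, ‖θ.Φ x‖ ≤ θ.f x) (hp : ∀ x, 0 ≤ θ.p x) (hq : ∀ x, 0 ≤ θ.q x) :
    ∫ ξ, (speed θ.Φ ξ + mean θ.f ξ) ∂P.kap + ∫ x, θ.p x ∂P.start + ∫ x, θ.q x ∂P.sink ≤
      ∫ x, (⟪θ.Φ x, D.τ x⟫ + θ.f x) ∂D.σ + ∫ x, θ.p x ∂D.ρp + ∫ x, θ.q x ∂D.ρm := by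
  rw [← P.integral_cost]
  refine (P.le_total θ hf hp hq).trans_eq ?_
  rw [Price.total]
  have h1 : ∫ x, max (⟪θ.Φ x, D.τ x⟫ + θ.f x) 0 ∂D.σ = ∫ x, (⟪θ.Φ x, D.τ x⟫ + θ.f x) ∂D.σ := by
    refine integral_congr_ae ?_
    filter_upwards [D.norm_τ] with x hx
    refine max_eq_left ?_
    have := (abs_le.1 (abs_real_inner_le_norm (θ.Φ x) (D.τ x))).1
    rw [hx, mul_one] at this
    linarith [hf x]
  rw [h1]
  simp only [max_eq_left (hp _), max_eq_left (hq _)]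

theorem speed_zero (ξ : PathSpace) : speed (fun _ => 0) ξ = 0 := by simp [speed, circ, lineInt]

theorem occ_le : P.occ ≤ D.σ := measure_le_of_forall_integral_le fun f hf h0 => by
  have := P.cost_le ⟨fun _ => 0, f, fun _ => 0, fun _ => 0, UCB.const 0, hf, UCB.const 0, UCB.const 0⟩
    (by simpa using h0) (by simp) (by simp)
  simpa [speed_zero, P.integral_occ hf] using this

theorem start_le : P.start ≤ D.ρp := measure_le_of_forall_integral_le fun f hf h0 => by
  have := P.cost_le ⟨fun _ => 0, fun _ => 0, f, fun _ => 0, UCB.const 0, UCB.const 0, hf, UCB.const 0⟩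
    (by simp) h0 (by simp)
  simpa [speed_zero] using this

theorem sink_le : P.sink ≤ D.ρm := measure_le_of_forall_integral_le fun f hf h0 => by
  have := P.cost_le ⟨fun _ => 0, fun _ => 0, fun _ => 0, f, UCB.const 0, UCB.const 0, UCB.const 0, hf⟩
    (by simp) (by simp) h0
  simpa [speed_zero] using this

theorem speed_neg (Φ : Ed 2 → Ed 2) (ξ : PathSpace) : speed (-Φ) ξ = -speed Φ ξ := by
  simp [speed, circ, lineInt, neg_div]

theorem integral_one_sub_speed_le {Ψ : Ed 2 → Ed 2} (hΨ : UCB Ψ) (h1 : ∀ x, ‖Ψ x‖ ≤ 1) :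
    ∫ ξ, (1 - speed Ψ ξ) ∂P.kap ≤ ∫ x, ‖D.τ x - Ψ x‖ ∂D.σ := by
  have := P.cost_le ⟨-Ψ, fun _ => 1, fun _ => 0, fun _ => 0, hΨ.neg, UCB.const 1, UCB.const 0,
    UCB.const 0⟩ (by simpa using h1) (by simp) (by simp)
  simp only [speed_neg, mean_const, integral_zero, add_zero] at this
  refine le_trans (le_of_eq (integral_congr_ae (Eventually.of_forall fun ξ => ?_)))
    (this.trans ?_)
  · show 1 - speed Ψ ξ = -speed Ψ ξ + 1
    ring
  · have hτ : Integrable D.τ D.σ := Integrable.of_bound D.measurable_τ.aestronglyMeasurable 1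
      (D.norm_τ.mono fun x hx => hx.le)
    refine integral_mono_ae
      ((hΨ.neg.integrable_inner D.measurable_τ D.norm_τ).add (integrable_const _))
      (hτ.sub hΨ.integrable).norm ?_
    filter_upwards [D.norm_τ] with x hx
    have h2 := real_inner_le_norm (D.τ x - Ψ x) (D.τ x)
    rw [inner_sub_left, real_inner_self_eq_norm_sq, hx] at h2
    simp only [Pi.neg_apply, inner_neg_left]
    linarith

end Packing

namespace Packing

variable {D : DivFlow} (P : Packing D)

theorem ae_exists_speed : ∀ᵐ ξ ∂P.kap, ∀ ε > 0, ∃ Ψ : Ed 2 → Ed 2, UCB Ψ ∧ (∀ x, ‖Ψ x‖ ≤ 1) ∧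
    1 - speed Ψ ξ < ε := by
  choose Ψ h1 h2 h3 using fun n : ℕ => D.exists_approx (Nat.one_div_pos_of_nat (α := ℝ) (n := n))
  have hi : ∀ n, Integrable (fun ξ => 1 - speed (Ψ n) ξ) P.kap := fun n =>
    (integrable_const _).sub (integrable_speed (h1 n))
  have := ae_forall_exists_lt_of_integral (μ := P.kap) (u := fun n ξ => 1 - speed (Ψ n) ξ)
    (fun n => measurable_const.sub (measurable_speed (h1 n))) hi
    (fun n => Eventually.of_forall fun ξ => by
      have := (abs_le.1 (abs_speed_le (h2 n) ξ)).2
      simpa using this)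
    (fun ε hε => by
      obtain ⟨n, hn⟩ := exists_nat_one_div_lt hε
      exact ⟨n, (P.integral_one_sub_speed_le (h1 n) (h2 n)).trans_lt ((h3 n).trans_lt hn)⟩)
  filter_upwards [this] with ξ hξ ε hε
  obtain ⟨n, hn⟩ := hξ ε hε
  exact ⟨Ψ n, h1 n, h2 n, hn⟩

theorem ae_time_pos : ∀ᵐ ξ ∂P.kap, 0 < ξ.time := by
  filter_upwards [P.ae_exists_speed] with ξ hξ
  obtain ⟨Ψ, -, -, h⟩ := hξ 1 one_pos
  refine ξ.time_nonneg.lt_of_ne fun h0 => ?_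
  rw [speed, ← h0, div_zero] at h
  norm_num at h

theorem ae_norm_deriv : ∀ᵐ ξ ∂P.kap,
    ∀ᵐ s ∂volume.restrict (Ioc (0:ℝ) 1), ‖deriv ξ.cur s‖ = ξ.time := by
  filter_upwards [P.ae_exists_speed, P.ae_time_pos] with ξ hξ hT
  have hle : ∀ s, ‖deriv ξ.cur s‖ ≤ ξ.time := fun s => norm_deriv_le_of_lipschitz ξ.lipschitz_cur
  have h_int : IntervalIntegrable (fun s => ‖deriv ξ.cur s‖) volume 0 1 :=
    (ξ.lipschitz_cur.intervalIntegrable_deriv 0 1).norm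
  have hlen : ξ.time ≤ ∫ s in (0:ℝ)..1, ‖deriv ξ.cur s‖ := by
    refine le_of_forall_pos_le_add fun ε hε => ?_
    obtain ⟨Ψ, h1, h2, h3⟩ := hξ (ε / ξ.time) (div_pos hε hT)
    have h4 : circ Ψ ξ ≤ ∫ s in (0:ℝ)..1, ‖deriv ξ.cur s‖ := by
      refine intervalIntegral.integral_mono_on zero_le_one
        (intervalIntegrable_inner_deriv ξ.lipschitz_cur
          (h1.continuous.comp ξ.lipschitz_cur.continuous) 0 1) h_int fun s _ => ?_
      refine (real_inner_le_norm _ _).trans ?_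
      exact mul_le_of_le_one_left (norm_nonneg _) (h2 _)
    rw [speed, sub_lt_iff_lt_add, ← add_div, lt_div_iff₀ hT] at h3
    linarith
  have hz : ∫ s in (0:ℝ)..1, (ξ.time - ‖deriv ξ.cur s‖) = 0 := by
    refine le_antisymm ?_ (intervalIntegral.integral_nonneg zero_le_one fun s _ => sub_nonneg.2 (hle s))
    rw [intervalIntegral.integral_sub intervalIntegrable_const h_int]
    simpa using hlen
  rw [intervalIntegral.integral_of_le zero_le_one] at hz
  have := (integral_eq_zero_iff_of_nonneg (fun s => sub_nonneg.2 (hle s))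
    ((intervalIntegrable_iff_integrableOn_Ioc_of_le zero_le_one).1
      (intervalIntegrable_const.sub h_int))).1 hz
  filter_upwards [this] with s hs
  have : ξ.time - ‖deriv ξ.cur s‖ = 0 := hs
  linarith

theorem norm_sub_le_of_inner {v w : Ed 2} (hv : ‖v‖ ≤ 1) (hw : ‖w‖ ≤ 1) {ε : ℝ} (hε : 0 < ε) :
    ‖v - w‖ ≤ ε + (1 - ⟪w, v⟫) / ε := by
  have h1 : ‖v - w‖ ^ 2 ≤ 2 * (1 - ⟪w, v⟫) := by
    rw [norm_sub_sq_real, real_inner_comm]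
    nlinarith [norm_nonneg v, norm_nonneg w]
  have h2 : 0 ≤ 1 - ⟪w, v⟫ := by nlinarith [sq_nonneg ‖v - w‖]
  rw [← sub_nonneg]
  have : ε + (1 - ⟪w, v⟫) / ε - ‖v - w‖ = ((ε ^ 2 + (1 - ⟪w, v⟫)) - ‖v - w‖ * ε) / ε := by
    field_simp
  rw [this]
  refine div_nonneg ?_ hε.le
  nlinarith [sq_nonneg (‖v - w‖ - ε), sq_nonneg ‖v - w‖]

theorem _root_.UCB.inner {Φ Ψ : Ed 2 → Ed 2} (hΦ : UCB Φ) (hΨ : UCB Ψ) : UCB fun x => ⟪Φ x, Ψ x⟫ := by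
  obtain ⟨C, hC0, hC⟩ := hΦ.exists_pos_bound
  obtain ⟨C', hC0', hC'⟩ := hΨ.exists_pos_bound
  refine ⟨Metric.uniformContinuous_iff.2 fun ε hε => ?_, C * C', fun x => ?_⟩
  · obtain ⟨δ, hδ, h⟩ := hΦ.exists_modulus (ε := ε / (4 * C')) (by positivity)
    obtain ⟨δ', hδ', h'⟩ := hΨ.exists_modulus (ε := ε / (4 * C)) (by positivity)
    refine ⟨min δ δ', lt_min hδ hδ', fun x y hxy => ?_⟩
    have e : ⟪Φ x, Ψ x⟫ - ⟪Φ y, Ψ y⟫ = ⟪Φ x - Φ y, Ψ x⟫ + ⟪Φ y, Ψ x - Ψ y⟫ := by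
      rw [inner_sub_left, inner_sub_right]; ring
    rw [Real.dist_eq, e]
    have h1 : |⟪Φ x - Φ y, Ψ x⟫| ≤ ε / (4 * C') * C' := (abs_real_inner_le_norm _ _).trans
      (mul_le_mul (h _ _ (hxy.le.trans (min_le_left _ _))) (hC' _) (norm_nonneg _) (by positivity))
    have h2 : |⟪Φ y, Ψ x - Ψ y⟫| ≤ C * (ε / (4 * C)) := (abs_real_inner_le_norm _ _).trans
      (mul_le_mul (hC _) (h' _ _ (hxy.le.trans (min_le_right _ _))) (norm_nonneg _) hC0.le)
    have e1 : ε / (4 * C') * C' = ε / 4 := by field_simp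
    have e2 : C * (ε / (4 * C)) = ε / 4 := by field_simp
    linarith [abs_add_le ⟪Φ x - Φ y, Ψ x⟫ ⟪Φ y, Ψ x - Ψ y⟫]
  · exact (abs_real_inner_le_norm _ _).trans
      (mul_le_mul (hC x) (hC' x) (norm_nonneg _) hC0.le)

theorem _root_.PathSpace.abs_speed_sub_mean_le {Φ Ψ : Ed 2 → Ed 2} (hΦ : UCB Φ) (hΨ : UCB Ψ) {C ε : ℝ}
    (hC : ∀ x, ‖Φ x‖ ≤ C) (h1 : ∀ x, ‖Ψ x‖ ≤ 1) (hε : 0 < ε) {ξ : PathSpace} (hT : 0 < ξ.time) :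
    |speed Φ ξ - mean (fun x => ⟪Φ x, Ψ x⟫) ξ| ≤ C * (ε + (1 - speed Ψ ξ) / ε) := by
  have hC0 : 0 ≤ C := (norm_nonneg _).trans (hC 0)
  have hcc := ξ.lipschitz_cur.continuous
  have hI : ∀ {Φ : Ed 2 → Ed 2}, UCB Φ → IntervalIntegrable
      (fun s => ⟪Φ (ξ.cur s), ξ.time⁻¹ • deriv ξ.cur s⟫) volume 0 1 := by
    intro Φ hΦ
    simp only [real_inner_smul_right]
    exact (intervalIntegrable_inner_deriv ξ.lipschitz_cur (hΦ.continuous.comp hcc) 0 1).const_mul _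
  have hS : ∀ Φ : Ed 2 → Ed 2, speed Φ ξ = ∫ s in (0:ℝ)..1, ⟪Φ (ξ.cur s), ξ.time⁻¹ • deriv ξ.cur s⟫ := by
    intro Φ
    simp only [real_inner_smul_right, intervalIntegral.integral_const_mul]
    rw [speed, circ, lineInt, div_eq_inv_mul]
  have hM : IntervalIntegrable (fun s => ⟪Φ (ξ.cur s), Ψ (ξ.cur s)⟫) volume 0 1 :=
    ((hΦ.inner hΨ).continuous.comp hcc).intervalIntegrable 0 1
  have hR : IntervalIntegrable (fun s => C * (ε + (1 - ⟪Ψ (ξ.cur s), ξ.time⁻¹ • deriv ξ.cur s⟫) / ε))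
      volume 0 1 :=
    (intervalIntegrable_const.add ((intervalIntegrable_const.sub (hI hΨ)).div_const ε)).const_mul C
  rw [hS Φ, mean, ← intervalIntegral.integral_sub (hI hΦ) hM, ← Real.norm_eq_abs]
  refine (intervalIntegral.norm_integral_le_of_norm_le zero_le_one
    (Eventually.of_forall fun s _ => ?_) hR).trans_eq ?_
  · rw [← inner_sub_right]
    refine (norm_inner_le_norm _ _).trans ?_
    refine mul_le_mul (hC _) (norm_sub_le_of_inner ?_ (h1 _) hε) (norm_nonneg _) hC0
    rw [norm_smul, norm_inv, Real.norm_of_nonneg hT.le, inv_mul_le_iff₀ hT, mul_one]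
    exact norm_deriv_le_of_lipschitz ξ.lipschitz_cur
  · rw [intervalIntegral.integral_const_mul, intervalIntegral.integral_add intervalIntegrable_const
      ((intervalIntegrable_const.sub (hI hΨ)).div_const ε), intervalIntegral.integral_div,
      intervalIntegral.integral_sub intervalIntegrable_const (hI hΨ), ← hS]
    simp

theorem integral_speed {Φ : Ed 2 → Ed 2} (hΦ : UCB Φ) :
    ∫ ξ, speed Φ ξ ∂P.kap = ∫ x, ⟪Φ x, D.τ x⟫ ∂P.occ := by
  obtain ⟨C, hC0, hC⟩ := hΦ.exists_pos_bound
  have hτσ : Integrable D.τ D.σ := Integrable.of_bound D.measurable_τ.aestronglyMeasurable 1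
    (D.norm_τ.mono fun x hx => hx.le)
  have hτ1 : ∀ᵐ x ∂P.occ, ‖D.τ x‖ = 1 := D.norm_τ.filter_mono (ae_mono P.occ_le)
  set M := P.kap.real univ with hM
  have key : ∀ δ : ℝ, 0 < δ → |∫ ξ, speed Φ ξ ∂P.kap - ∫ x, ⟪Φ x, D.τ x⟫ ∂P.occ| ≤
      C * (δ * M + δ) + C * (δ ^ 2) := by
    intro δ hδ
    obtain ⟨Ψ, hΨ, h1, h2⟩ := D.exists_approx (pow_pos hδ 2)
    have hsp := (P.integral_one_sub_speed_le hΨ h1).trans h2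
    have a1 : |∫ ξ, speed Φ ξ ∂P.kap - ∫ x, ⟪Φ x, Ψ x⟫ ∂P.occ| ≤ C * (δ * M + δ) := by
      rw [P.integral_occ (hΦ.inner hΨ), ← integral_sub (integrable_speed hΦ)
        (integrable_mean (hΦ.inner hΨ)), ← Real.norm_eq_abs]
      have hi : Integrable (fun ξ => C * (δ + (1 - speed Ψ ξ) / δ)) P.kap :=
        ((integrable_const δ).add
          (((integrable_const (1:ℝ)).sub (integrable_speed hΨ)).div_const δ)).const_mul C
      refine (norm_integral_le_of_norm_le hi (P.ae_time_pos.mono fun ξ hT =>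
        abs_speed_sub_mean_le hΦ hΨ hC h1 hδ hT)).trans ?_
      rw [integral_const_mul]
      refine mul_le_mul_of_nonneg_left ?_ hC0.le
      have hi1 : Integrable (fun ξ => (1 - speed Ψ ξ) / δ) P.kap :=
        ((integrable_const (1:ℝ)).sub (integrable_speed hΨ)).div_const δ
      rw [integral_add (integrable_const δ) hi1, integral_const,
        integral_div, smul_eq_mul, mul_comm]
      refine add_le_add le_rfl ?_
      rw [div_le_iff₀ hδ]
      exact hsp.trans_eq (by ring)
    have a2 : |∫ x, ⟪Φ x, Ψ x⟫ ∂P.occ - ∫ x, ⟪Φ x, D.τ x⟫ ∂P.occ| ≤ C * δ ^ 2 := by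
      rw [← integral_sub (hΦ.inner hΨ).integrable (hΦ.integrable_inner D.measurable_τ hτ1),
        ← Real.norm_eq_abs]
      have hi : Integrable (fun x => C * ‖D.τ x - Ψ x‖) P.occ :=
        (((hτσ.mono_measure P.occ_le).sub hΨ.integrable).norm).const_mul C
      refine (norm_integral_le_of_norm_le hi (Eventually.of_forall fun x => ?_)).trans ?_
      · rw [← inner_sub_right, norm_sub_rev (D.τ x)]
        exact (norm_inner_le_norm _ _).trans (mul_le_mul_of_nonneg_right (hC x) (norm_nonneg _))
      · rw [integral_const_mul]
        refine mul_le_mul_of_nonneg_left (le_trans ?_ h2) hC0.le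
        exact integral_mono_measure P.occ_le (Eventually.of_forall fun x => norm_nonneg _)
          (hτσ.sub hΨ.integrable).norm
    exact (abs_sub_le _ _ _).trans (add_le_add a1 a2)
  have hlim : Tendsto (fun δ : ℝ => C * (δ * M + δ) + C * (δ ^ 2)) (𝓝[>] 0) (𝓝 0) := by
    have : Continuous fun δ : ℝ => C * (δ * M + δ) + C * (δ ^ 2) := by fun_prop
    have h := this.tendsto 0
    simp only [zero_mul, add_zero, mul_zero, ne_eq, OfNat.ofNat_ne_zero, not_false_eq_true,
      zero_pow] at h
    exact h.mono_left nhdsWithin_le_nhds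
  have := ge_of_tendsto hlim (eventually_mem_nhdsWithin.mono key)
  exact sub_eq_zero.1 (abs_nonpos_iff.1 this)

end Packing

/-- The gradient of a test function as a vector field. -/
def gradField (φ : Ed 2 → ℝ) (x : Ed 2) : Ed 2 := (InnerProductSpace.toDual ℝ (Ed 2)).symm (fderiv ℝ φ x)

theorem inner_gradField (φ : Ed 2 → ℝ) (x v : Ed 2) : ⟪gradField φ x, v⟫ = fderiv ℝ φ x v :=
  InnerProductSpace.toDual_symm_apply

theorem ucb_gradField {φ : Ed 2 → ℝ} (hφ : ContDiff ℝ 1 φ) (hs : HasCompactSupport φ) :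
    UCB (gradField φ) := by
  refine UCB.of_hasCompactSupport
    ((InnerProductSpace.toDual ℝ (Ed 2)).symm.continuous.comp (hφ.continuous_fderiv one_ne_zero)) ?_
  exact (hs.fderiv (𝕜 := ℝ)).comp_left (map_zero (InnerProductSpace.toDual ℝ (Ed 2)).symm)

theorem lineInt_gradField {φ : Ed 2 → ℝ} (hφ : ContDiff ℝ 1 φ) (hs : HasCompactSupport φ)
    {K : ℝ≥0} {γ : ℝ → Ed 2} (h : LipschitzWith K γ) (a b : ℝ) :
    lineInt (gradField φ) γ a b = φ (γ b) - φ (γ a) := by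
  obtain ⟨C, hC⟩ := hφ.lipschitzWith_of_hasCompactSupport hs one_ne_zero
  simp only [lineInt, inner_gradField]
  exact integral_fderiv_comp_deriv hC (hφ.differentiable one_ne_zero) h a b

namespace Packing

variable {D : DivFlow} (P : Packing D)

theorem integral_fderiv_occ {φ : Ed 2 → ℝ} (hφ : ContDiff ℝ 1 φ) (hs : HasCompactSupport φ) :
    -∫ x, fderiv ℝ φ x (D.τ x) ∂P.occ = ∫ x, φ x ∂P.start - ∫ x, φ x ∂P.sink := by
  have hu := ucb_gradField hφ hs
  have hφu : UCB φ := UCB.of_hasCompactSupport hφ.continuous hs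
  obtain ⟨C, hC⟩ := hφu.bdd
  have hi : ∀ s : ℝ, Integrable (fun ξ => 1 / (1 + ξ.time) * φ (ξ.cur s)) P.lam₂ := fun s =>
    P.integrable_weight_mul measurable_endWeight endWeight_nonneg endWeight_le_one
      (Integrable.of_bound (hφ.continuous.comp (continuous_cur_apply s)).aestronglyMeasurable C
        (Eventually.of_forall fun ξ => hC _))
  have h := P.integral_speed hu
  rw [P.integral_kap (g := fun ξ => speed (gradField φ) ξ) fun lam _ => integrable_speed hu] at h
  simp only [inner_gradField] at h
  have hc : ∀ ξ : PathSpace, circ (gradField φ) ξ = φ (ξ.cur 1) - φ (ξ.cur 0) := fun ξ =>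
    lineInt_gradField hφ hs ξ.lipschitz_cur 0 1
  have h1 : ∫ ξ, speed (gradField φ) ξ ∂P.lam₁ = 0 := by
    refine integral_eq_zero_of_ae ?_
    filter_upwards [P.isLoop] with ξ hξ
    simp [speed, hc, hξ]
  rw [← h, h1, zero_add, P.integral_start hφ.continuous, P.integral_sink hφ.continuous,
    ← integral_sub (hi 0) (hi 1), ← integral_neg]
  refine integral_congr_ae (Eventually.of_forall fun ξ => ?_)
  simp only [speed, hc]
  have := ξ.one_add_time_pos
  rcases ξ.time_nonneg.eq_or_lt with h0 | h0
  · have := ξ.dist_cur_le_time (s := 0) (t := 1) (by simp) (by simp)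
    rw [← h0, dist_le_zero] at this
    simp [this]
  · field_simp
    ring

/-- What is left of the flow after removing the curves of a packing. -/
def remainder : DivFlow where
  σ := D.σ - P.occ
  ρp := D.ρp - P.start
  ρm := D.ρm - P.sink
  τ := D.τ
  finite_σ := inferInstance
  finite_ρp := inferInstance
  finite_ρm := inferInstance
  measurable_τ := D.measurable_τ
  norm_τ := D.norm_τ.filter_mono (ae_mono Measure.sub_le)
  div_eq := fun φ hφ hs => by
    have h1 : ContDiff ℝ 1 φ := hφ.of_le (by exact_mod_cast le_top)
    have hφu : UCB φ := UCB.of_hasCompactSupport hφ.continuous hs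
    have hu := ucb_gradField h1 hs
    have a := D.div_eq φ hφ hs
    have b := P.integral_fderiv_occ h1 hs
    have hI : ∀ ν : Measure (Ed 2), ν ≤ D.σ → Integrable (fun x => fderiv ℝ φ x (D.τ x)) ν := by
      intro ν hν
      have := (hu.integrable_inner D.measurable_τ D.norm_τ).mono_measure hν
      simpa only [inner_gradField] using this
    have e1 : ∫ x, fderiv ℝ φ x (D.τ x) ∂D.σ = ∫ x, fderiv ℝ φ x (D.τ x) ∂(D.σ - P.occ) +
        ∫ x, fderiv ℝ φ x (D.τ x) ∂P.occ := by
      rw [← integral_add_measure (hI _ Measure.sub_le) (hI _ P.occ_le),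
        Measure.sub_add_cancel_of_le P.occ_le]
    have e2 : ∫ x, φ x ∂D.ρp = ∫ x, φ x ∂(D.ρp - P.start) + ∫ x, φ x ∂P.start := by
      rw [← integral_add_measure hφu.integrable hφu.integrable,
        Measure.sub_add_cancel_of_le P.start_le]
    have e3 : ∫ x, φ x ∂D.ρm = ∫ x, φ x ∂(D.ρm - P.sink) + ∫ x, φ x ∂P.sink := by
      rw [← integral_add_measure hφu.integrable hφu.integrable,
        Measure.sub_add_cancel_of_le P.sink_le]
    linarith

theorem total_remainder_le {θ : Price} : θ.total P.remainder +
    (∫ ξ, θ.loop ξ ∂P.lam₁ + ∫ ξ, θ.arc ξ ∂P.lam₂) ≤ θ.total D := by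
  have hτ1 : ∀ᵐ x ∂P.occ, ‖D.τ x‖ = 1 := D.norm_τ.filter_mono (ae_mono P.occ_le)
  have hmax : ∀ {ν : Measure (Ed 2)} {u : Ed 2 → ℝ} (_ : Integrable u ν),
      ∫ x, u x ∂ν ≤ ∫ x, max (u x) 0 ∂ν := fun hu =>
    integral_mono hu hu.pos_part fun x => le_max_left _ _
  have hsplit : ∀ {μ ν : Measure (Ed 2)} [IsFiniteMeasure μ] [IsFiniteMeasure ν] {u : Ed 2 → ℝ}
      (_ : ν ≤ μ) (_ : Integrable u μ),
      ∫ x, max (u x) 0 ∂(μ - ν) + ∫ x, u x ∂ν ≤ ∫ x, max (u x) 0 ∂μ := by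
    intro μ ν _ _ u hle hu
    refine (add_le_add le_rfl (hmax (hu.mono_measure hle))).trans_eq ?_
    rw [← integral_add_measure (hu.pos_part.mono_measure Measure.sub_le)
      (hu.pos_part.mono_measure hle), Measure.sub_add_cancel_of_le hle]
  have hs : ∫ ξ, (speed θ.Φ ξ + mean θ.f ξ) ∂P.kap = ∫ x, (⟪θ.Φ x, D.τ x⟫ + θ.f x) ∂P.occ := by
    rw [integral_add (integrable_speed θ.hΦ) (integrable_mean θ.hf), P.integral_speed θ.hΦ,
      ← P.integral_occ θ.hf, integral_add (θ.hΦ.integrable_inner D.measurable_τ hτ1)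
      θ.hf.integrable]
  rw [P.integral_cost, hs]
  have h1 := hsplit P.occ_le (θ.integrable_density D)
  have h2 := hsplit P.start_le (θ.hp.integrable (μ := D.ρp))
  have h3 := hsplit P.sink_le (θ.hq.integrable (μ := D.ρm))
  simp only [Price.total, remainder]
  linarith

end Packing

/-- The divergence equation holds for smooth Lipschitz integrable test functions. -/
theorem DivFlow.div_eq_of_lipschitz (D : DivFlow) {φ : Ed 2 → ℝ} {L : ℝ≥0}
    (hφ : ContDiff ℝ (⊤ : ℕ∞) φ) (hL : LipschitzWith L φ) (hp : Integrable φ D.ρp)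
    (hm : Integrable φ D.ρm) :
    -∫ x, fderiv ℝ φ x (D.τ x) ∂D.σ = (∫ x, φ x ∂D.ρp) - ∫ x, φ x ∂D.ρm := by
  let b : ContDiffBump (0 : Ed 2) := ⟨1, 2, one_pos, one_lt_two⟩
  let r : ℕ → ℝ := fun n => ((n : ℝ) + 1)⁻¹
  have hr0 : ∀ n, 0 < r n := fun n => by positivity
  have hr1 : ∀ n, r n ≤ 1 := fun n => inv_le_one_of_one_le₀ (by linarith [n.cast_nonneg (α := ℝ)])
  let χ : ℕ → Ed 2 → ℝ := fun n x => b (r n • x)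
  have hχs : ∀ n, ContDiff ℝ (⊤ : ℕ∞) (χ n) := fun n =>
    b.contDiff.comp (contDiff_const_smul (r n))
  have hχc : ∀ n, HasCompactSupport (χ n) := fun n =>
    b.hasCompactSupport.comp_smul (hr0 n).ne'
  have hχ1 : ∀ n x, |χ n x| ≤ 1 := fun n x => by
    rw [abs_of_nonneg b.nonneg]; exact b.le_one
  have hsmall : ∀ x : Ed 2, ∀ᶠ n in atTop, ‖r n • x‖ < 1 := fun x => by
    have h1 : Tendsto r atTop (𝓝 0) := tendsto_inv_atTop_zero.comp
      (tendsto_atTop_add_const_right _ _ tendsto_natCast_atTop_atTop)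
    have h2 : Tendsto (fun n => ‖r n • x‖) atTop (𝓝 0) := by
      simpa using (h1.smul_const x).norm
    exact h2.eventually (gt_mem_nhds one_pos)
  have hχt : ∀ x, Tendsto (fun n => χ n x) atTop (𝓝 1) := fun x => by
    refine tendsto_const_nhds.congr' ?_
    filter_upwards [hsmall x] with n hn
    exact (b.one_of_mem_closedBall (by simpa using hn.le)).symm
  have hbd : Differentiable ℝ (b : Ed 2 → ℝ) := (b.contDiff (n := 1)).differentiable (by simp)
  have hχd : ∀ n x, fderiv ℝ (χ n) x = r n • fderiv ℝ b (r n • x) := fun n x =>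
    fderiv_comp_smul (r n)
  have hdb0 : ∀ y : Ed 2, ‖y‖ < 1 → fderiv ℝ b y = 0 := fun y hy => by
    have : (b : Ed 2 → ℝ) =ᶠ[𝓝 y] fun _ => 1 := by
      filter_upwards [Metric.isOpen_ball.mem_nhds (show y ∈ Metric.ball (0 : Ed 2) 1 by simpa)]
        with z hz
      exact b.one_of_mem_closedBall (Metric.ball_subset_closedBall hz)
    rw [this.fderiv_eq]; simp
  have hdb2 : ∀ y : Ed 2, 2 < ‖y‖ → fderiv ℝ b y = 0 := fun y hy => by
    have : (b : Ed 2 → ℝ) =ᶠ[𝓝 y] fun _ => 0 := by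
      filter_upwards [(isOpen_lt continuous_const continuous_norm).mem_nhds hy] with z hz
      refine b.zero_of_le_dist ?_
      simpa using (le_of_lt hz : (2:ℝ) ≤ ‖z‖)
    rw [this.fderiv_eq]; simp
  obtain ⟨C, hC0, hC⟩ : ∃ C, 0 ≤ C ∧ ∀ y, ‖fderiv ℝ b y‖ ≤ C := by
    obtain ⟨C, hC⟩ := (b.hasCompactSupport.fderiv (𝕜 := ℝ)).exists_bound_of_continuous
      ((b.contDiff (n := 1)).continuous_fderiv (by simp))
    exact ⟨C, (norm_nonneg _).trans (hC 0), hC⟩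
  have hφd : Differentiable ℝ φ := hφ.differentiable (by simp)
  have hφ0 : ∀ x, |φ x| ≤ |φ 0| + L * ‖x‖ := fun x => by
    have h1 := hL.dist_le_mul x 0
    rw [Real.dist_eq, dist_zero_right] at h1
    have := abs_sub_abs_le_abs_sub (φ x) (φ 0); linarith
  have hprod : ∀ n x v, fderiv ℝ (fun x => χ n x * φ x) x v =
      χ n x * fderiv ℝ φ x v + φ x * (r n * fderiv ℝ b (r n • x) v) := fun n x v => by
    rw [fderiv_fun_mul ((hχs n).differentiable (by simp) x) (hφd x), hχd]
    simp
  have hlim : ∀ (μ : Measure (Ed 2)), Integrable φ μ →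
      Tendsto (fun n => ∫ x, χ n x * φ x ∂μ) atTop (𝓝 (∫ x, φ x ∂μ)) := fun μ hi => by
    refine tendsto_integral_of_dominated_convergence (fun x => ‖φ x‖)
      (fun n => ((hχs n).continuous.mul hφ.continuous).aestronglyMeasurable) hi.norm
      (fun n => Eventually.of_forall fun x => ?_) (Eventually.of_forall fun x => ?_)
    · rw [norm_mul]
      exact mul_le_of_le_one_left (norm_nonneg _) (hχ1 n x)
    · simpa using (hχt x).mul_const (φ x)
  have hleft : Tendsto (fun n => ∫ x, fderiv ℝ (fun x => χ n x * φ x) x (D.τ x) ∂D.σ) atTop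
      (𝓝 (∫ x, fderiv ℝ φ x (D.τ x) ∂D.σ)) := by
    refine tendsto_integral_of_dominated_convergence (fun _ => L + (|φ 0| + L * 2) * C)
      (fun n => ?_) (integrable_const _) (fun n => ?_) (Eventually.of_forall fun x => ?_)
    · have h1 : Continuous (fderiv ℝ (fun x => χ n x * φ x)) :=
        (((hχs n).mul hφ).of_le (m := 1) (by exact_mod_cast le_top)).continuous_fderiv (by simp)
      have h2 : Measurable (fun x => fderiv ℝ (fun x => χ n x * φ x) x (D.τ x)) :=
        (isBoundedBilinearMap_apply.continuous.measurable).comp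
          (h1.measurable.prodMk D.measurable_τ)
      exact h2.aestronglyMeasurable
    · filter_upwards [D.norm_τ] with x hx
      rw [hprod]
      refine (norm_add_le _ _).trans (add_le_add ?_ ?_)
      · rw [norm_mul]
        have h1 := (fderiv ℝ φ x).le_opNorm (D.τ x)
        rw [hx, mul_one] at h1
        have h2 := norm_fderiv_le_of_lipschitz ℝ hL (x₀ := x)
        calc _ ≤ 1 * (L : ℝ) := mul_le_mul (hχ1 n x) (h1.trans h2) (norm_nonneg _) zero_le_one
          _ = L := one_mul _
      · by_cases h2 : 2 < ‖r n • x‖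
        · rw [hdb2 _ h2]; simp; positivity
        have h1 := (fderiv ℝ b (r n • x)).le_opNorm (D.τ x)
        rw [hx, mul_one] at h1
        rw [norm_mul, norm_mul, Real.norm_of_nonneg (hr0 n).le, ← mul_assoc]
        refine mul_le_mul ?_ (h1.trans (hC _)) (norm_nonneg _) (by positivity)
        have h3 : r n * ‖x‖ ≤ 2 := by
          rw [norm_smul, Real.norm_of_nonneg (hr0 n).le] at h2; linarith
        calc ‖φ x‖ * r n ≤ (|φ 0| + L * ‖x‖) * r n :=
              mul_le_mul_of_nonneg_right (hφ0 x) (hr0 n).le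
          _ = |φ 0| * r n + L * (r n * ‖x‖) := by ring
          _ ≤ |φ 0| * 1 + L * 2 := by
              gcongr
              exact hr1 n
          _ = _ := by ring
    · refine tendsto_const_nhds.congr' ?_
      filter_upwards [hsmall x] with n hn
      have h1 : χ n x = 1 := b.one_of_mem_closedBall (by simpa using hn.le)
      rw [hprod, hdb0 _ hn, h1]
      simp
  refine tendsto_nhds_unique hleft.neg ?_
  refine ((hlim D.ρp hp).sub (hlim D.ρm hm)).congr fun n => ?_
  exact (D.div_eq _ ((hχs n).mul hφ) ((hχc n).mul_right)).symm

/-- Smooth approximations of a function whose increments along lines are controlled by an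
integrand. -/
theorem exists_smooth_approx {φ : Ed 2 → ℝ} {L : ℝ≥0} (hL : LipschitzWith L φ)
    {Ψ : Ed 2 → Ed 2} {g : Ed 2 → ℝ} (hΨ : UCB Ψ) (hg : UCB g)
    (h : ∀ (x u : Ed 2) (l : ℝ), ‖u‖ = 1 → 0 ≤ l →
      φ (x + l • u) - φ x ≤ pathCost Ψ g (fun t => x + t • u) 0 l) {ε : ℝ} (hε : 0 < ε) :
    ∃ ψ : Ed 2 → ℝ, ContDiff ℝ (⊤ : ℕ∞) ψ ∧ LipschitzWith L ψ ∧ (∀ x, |ψ x - φ x| ≤ ε) ∧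
      ∀ x u, ‖u‖ = 1 → fderiv ℝ ψ x u ≤ ⟪Ψ x, u⟫ + g x + ε := by
  obtain ⟨δ₁, hδ₁, h₁⟩ := hΨ.exists_modulus (half_pos hε)
  obtain ⟨δ₂, hδ₂, h₂⟩ := hg.exists_modulus (half_pos hε)
  let r : ℝ := min (min δ₁ δ₂) (ε / (L + 1)) / 2
  have hL1 : 0 < (L : ℝ) + 1 := by positivity
  have hr : 0 < r := half_pos (lt_min (lt_min hδ₁ hδ₂) (by positivity))
  let b : ContDiffBump (0 : Ed 2) := ⟨r / 2, r, half_pos hr, half_lt_self hr⟩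
  let ψ : Ed 2 → ℝ := convolution (b.normed volume) φ (ContinuousLinearMap.lsmul ℝ ℝ) volume
  have hψd : ContDiff ℝ (⊤ : ℕ∞) ψ := b.hasCompactSupport_normed.contDiff_convolution_left _
    b.contDiff_normed hL.continuous.locallyIntegrable
  have hki : ∀ ζ : Ed 2 → ℝ, Continuous ζ → Integrable (fun z => b.normed volume z * ζ z) :=
    fun ζ hζ => (b.continuous_normed.mul hζ).integrable_of_hasCompactSupport
      b.hasCompactSupport_normed.mul_right
  have hsub : ∀ x v C, (∀ z, ‖z‖ < r → φ (x + v - z) - φ (x - z) ≤ C) → ψ (x + v) - ψ x ≤ C := by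
    intro x v C hC
    have e : ψ (x + v) - ψ x =
        ∫ z, b.normed volume z * φ (x + v - z) - b.normed volume z * φ (x - z) := by
      refine Eq.trans ?_ (integral_sub (hki _ (hL.continuous.comp (by fun_prop)))
        (hki _ (hL.continuous.comp (by fun_prop)))).symm
      simp [ψ, convolution]
    have e2 : C = ∫ z, b.normed volume z * C := by
      rw [integral_mul_const, b.integral_normed, one_mul]
    rw [e, e2]
    refine integral_mono ((hki _ (hL.continuous.comp (by fun_prop))).sub
      (hki _ (hL.continuous.comp (by fun_prop)))) (hki _ continuous_const) fun z => ?_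
    by_cases hz : ‖z‖ < r
    · simp only [← mul_sub]
      exact mul_le_mul_of_nonneg_left (hC z hz) (b.nonneg_normed z)
    · have : b.normed volume z = 0 := by
        rw [← Function.notMem_support, b.support_normed_eq]
        simpa [b] using hz
      simp [this]
  have h2r : 2 * r = min (min δ₁ δ₂) (ε / (L + 1)) := by simp only [r]; ring
  refine ⟨ψ, hψd, LipschitzWith.of_le_add_mul L fun x y => ?_, fun x => ?_, fun x u hu => ?_⟩
  · have := hsub y (x - y) (L * dist x y) fun z _ => by
      have := hL.dist_le_mul (y + (x - y) - z) (y - z)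
      rw [dist_sub_right, add_sub_cancel] at this
      rw [add_sub_cancel]
      exact (le_abs_self _).trans this
    rw [add_sub_cancel] at this
    linarith
  · refine b.dist_normed_convolution_le hL.continuous.aestronglyMeasurable fun y hy => ?_
    refine (hL.dist_le_mul y x).trans ?_
    have h3 : dist y x < r := hy
    have h4 : r ≤ ε / (L + 1) := by linarith [min_le_right (min δ₁ δ₂) (ε / (L + 1))]
    have h5 := (le_div_iff₀ hL1).1 (h3.le.trans h4)
    nlinarith [dist_nonneg (x := y) (y := x)]
  · have hd : HasDerivAt (fun t : ℝ => ψ (x + t • u)) (fderiv ℝ ψ x u) 0 := by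
      have h3 : HasDerivAt (fun t : ℝ => x + t • u) u 0 := by
        simpa using ((hasDerivAt_id (0:ℝ)).smul_const u).const_add x
      have h4 : HasFDerivAt ψ (fderiv ℝ ψ x) (x + (0:ℝ) • u) := by
        simpa using (hψd.differentiable (by simp) x).hasFDerivAt
      exact h4.comp_hasDerivAt 0 h3
    refine le_of_tendsto hd.tendsto_slope_zero_right ?_
    filter_upwards [Ioo_mem_nhdsGT hr] with t ht
    have h6 := hsub x (t • u) (t * (⟪Ψ x, u⟫ + g x + ε)) fun z hz => by
      have h7 := h (x - z) u t hu ht.1.le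
      have e : x - z + t • u = x + t • u - z := by abel
      rw [e] at h7
      refine h7.trans ?_
      have hdl : ∀ s : ℝ, deriv (fun t : ℝ => x - z + t • u) s = u := fun s => by
        have := ((hasDerivAt_id s).smul_const u).const_add (x - z)
        simpa using this.deriv
      have h8 : pathCost Ψ g (fun t => x - z + t • u) 0 t ≤
          ∫ _ in (0:ℝ)..t, (⟪Ψ x, u⟫ + g x + ε) := by
        refine intervalIntegral.integral_mono_on ht.1.le
          (intervalIntegrable_pathCost hΨ.continuous hg.continuous (lipschitz_line _ hu) 0 t)
          intervalIntegrable_const fun s hs => ?_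
        rw [hdl]
        have hds : dist (x - z + s • u) x ≤ 2 * r := by
          rw [dist_eq_norm]
          calc ‖x - z + s • u - x‖ = ‖s • u - z‖ := by congr 1; abel
            _ ≤ ‖s • u‖ + ‖z‖ := norm_sub_le _ _
            _ ≤ r + r := by
              rw [norm_smul, hu, mul_one, Real.norm_of_nonneg hs.1]
              exact add_le_add (hs.2.trans ht.2.le) hz.le
            _ = 2 * r := by ring
        rw [h2r] at hds
        have h9 := h₁ _ _ (hds.trans ((min_le_left _ _).trans (min_le_left _ _)))
        have h10 := h₂ _ _ (hds.trans ((min_le_left _ _).trans (min_le_right _ _)))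
        have h11 : ⟪Ψ (x - z + s • u), u⟫ - ⟪Ψ x, u⟫ ≤ ε / 2 := by
          rw [← inner_sub_left]
          refine (real_inner_le_norm _ _).trans ?_
          rwa [hu, mul_one]
        have h12 := (le_abs_self _).trans h10
        linarith
      rw [intervalIntegral.integral_const, sub_zero, smul_eq_mul] at h8
      exact h8
    simp only [zero_add, zero_smul, add_zero, smul_eq_mul]
    rw [inv_mul_le_iff₀ ht.1]
    exact h6

/-- A function whose increments along lines are controlled by an integrand. -/
theorem lipschitz_of_line_le {φ : Ed 2 → ℝ} {Ψ : Ed 2 → Ed 2} {g : Ed 2 → ℝ} {C D : ℝ≥0}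
    (hC : ∀ x, ‖Ψ x‖ ≤ C) (hD : ∀ x, ‖g x‖ ≤ D)
    (h : ∀ (x u : Ed 2) (l : ℝ), ‖u‖ = 1 → 0 ≤ l →
      φ (x + l • u) - φ x ≤ pathCost Ψ g (fun t => x + t • u) 0 l) :
    LipschitzWith (C + D) φ := by
  refine LipschitzWith.of_le_add_mul _ fun y x => ?_
  rcases eq_or_ne y x with rfl | hxy
  · simp
  have hn : ‖y - x‖ ≠ 0 := norm_ne_zero_iff.2 (sub_ne_zero.2 hxy)
  have hu : ‖‖y - x‖⁻¹ • (y - x)‖ = 1 := by rw [norm_smul, norm_inv, norm_norm, inv_mul_cancel₀ hn]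
  have h1 := h x _ ‖y - x‖ hu (norm_nonneg _)
  rw [smul_smul, mul_inv_cancel₀ hn, one_smul, add_sub_cancel] at h1
  have h2 := abs_pathCost_le hC hD (lipschitz_line x hu) (norm_nonneg (y - x))
  rw [dist_eq_norm, NNReal.coe_add]
  have := le_abs_self (pathCost Ψ g (fun t => x + t • ‖y - x‖⁻¹ • (y - x)) 0 ‖y - x‖)
  linarith

/-- A potential of the integrand `⟪Ψ, ·⟫ + g` bounds the total integral from below. -/
theorem DivFlow.potential_le (D : DivFlow) {φ : Ed 2 → ℝ} {Ψ : Ed 2 → Ed 2} {g : Ed 2 → ℝ}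
    (hΨ : UCB Ψ) (hg : UCB g)
    (h : ∀ (x u : Ed 2) (l : ℝ), ‖u‖ = 1 → 0 ≤ l →
      φ (x + l • u) - φ x ≤ pathCost Ψ g (fun t => x + t • u) 0 l)
    (hp : Integrable φ D.ρp) (hm : Integrable φ D.ρm) :
    (∫ x, φ x ∂D.ρm) - ∫ x, φ x ∂D.ρp ≤ ∫ x, (⟪Ψ x, D.τ x⟫ + g x) ∂D.σ := by
  obtain ⟨C, hC0, hC⟩ := hΨ.exists_pos_bound
  obtain ⟨C', hC0', hC'⟩ := hg.exists_pos_bound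
  have hL : LipschitzWith (⟨C, hC0.le⟩ + ⟨C', hC0'.le⟩) φ := lipschitz_of_line_le hC hC' h
  have hi : Integrable (fun x => ⟪Ψ x, D.τ x⟫ + g x) D.σ :=
    (hΨ.integrable_inner D.measurable_τ D.norm_τ).add hg.integrable
  have key : ∀ ε : ℝ, 0 < ε → (∫ x, φ x ∂D.ρm) - ∫ x, φ x ∂D.ρp ≤
      ∫ x, (⟪Ψ x, D.τ x⟫ + g x) ∂D.σ +
        ε * (D.σ.real univ + D.ρp.real univ + D.ρm.real univ) := by
    intro ε hε
    obtain ⟨ψ, hψ, hψL, hψφ, hψd⟩ := exists_smooth_approx hL hΨ hg h hε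
    have h_int : ∀ (μ : Measure (Ed 2)) [IsFiniteMeasure μ], Integrable φ μ →
        Integrable ψ μ ∧ |∫ x, ψ x ∂μ - ∫ x, φ x ∂μ| ≤ ε * μ.real univ := fun μ _ hφ => by
      have h1 : Integrable (fun x => ψ x - φ x) μ := Integrable.of_bound
        (hψ.continuous.sub hL.continuous).aestronglyMeasurable ε (Eventually.of_forall hψφ)
      have h2 : Integrable ψ μ := (h1.add hφ).congr (Eventually.of_forall fun x => by simp)
      refine ⟨h2, ?_⟩
      rw [← integral_sub h2 hφ]
      exact norm_integral_le_of_norm_le_const (f := fun x => ψ x - φ x) (C := ε)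
        (Eventually.of_forall hψφ)
    obtain ⟨i1, e1⟩ := h_int D.ρp hp
    obtain ⟨i2, e2⟩ := h_int D.ρm hm
    have h1 := D.div_eq_of_lipschitz hψ hψL i1 i2
    have h2 : ∫ x, fderiv ℝ ψ x (D.τ x) ∂D.σ ≤ ∫ x, (⟪Ψ x, D.τ x⟫ + g x + ε) ∂D.σ := by
      refine integral_mono_ae ?_ (hi.add (integrable_const ε)) ?_
      · refine Integrable.of_bound (C := C + C') ?_ ?_
        · have h2 : Measurable (fun x => fderiv ℝ ψ x (D.τ x)) :=
            (isBoundedBilinearMap_apply.continuous.measurable).comp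
              ((hψ.continuous_fderiv (by simp)).measurable.prodMk D.measurable_τ)
          exact h2.aestronglyMeasurable
        · filter_upwards [D.norm_τ] with x hx
          have h3 := (fderiv ℝ ψ x).le_opNorm (D.τ x)
          rw [hx, mul_one] at h3
          exact h3.trans (norm_fderiv_le_of_lipschitz ℝ hψL)
      · filter_upwards [D.norm_τ] with x hx
        exact hψd x _ hx
    have h3 : ∫ x, (⟪Ψ x, D.τ x⟫ + g x + ε) ∂D.σ =
        ∫ x, (⟪Ψ x, D.τ x⟫ + g x) ∂D.σ + ε * D.σ.real univ := by
      refine (integral_add hi (integrable_const ε)).trans ?_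
      simp [mul_comm]
    rw [abs_le] at e1 e2
    linarith [e1.1, e1.2, e2.1, e2.2]
  refine le_of_forall_pos_le_add fun δ hδ => ?_
  set M := D.σ.real univ + D.ρp.real univ + D.ρm.real univ
  have hM : 0 ≤ M := by positivity
  refine (key (δ / (M + 1)) (by positivity)).trans ?_
  gcongr
  rw [div_mul_eq_mul_div, div_le_iff₀ (by positivity)]
  nlinarith

theorem exists_line (x y : Ed 2) : ∃ γ : ℝ → Ed 2, LipschitzWith 1 γ ∧ γ 0 = x ∧ γ ‖y - x‖ = y := by
  rcases eq_or_ne y x with rfl | hxy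
  · exact ⟨fun _ => y, LipschitzWith.const' y, rfl, rfl⟩
  have hn : ‖y - x‖ ≠ 0 := norm_ne_zero_iff.2 (sub_ne_zero.2 hxy)
  have hu : ‖‖y - x‖⁻¹ • (y - x)‖ = 1 := by rw [norm_smul, norm_inv, norm_norm, inv_mul_cancel₀ hn]
  refine ⟨fun t => x + t • ‖y - x‖⁻¹ • (y - x), lipschitz_line x hu, by simp, ?_⟩
  simp only [smul_smul, mul_inv_cancel₀ hn, one_smul, add_sub_cancel]

/-- The value function of the problem of reaching a point from the set `S`. -/
theorem exists_potential {Ψ : Ed 2 → Ed 2} {g b m : Ed 2 → ℝ} (hΨ : Continuous Ψ)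
    (hg : Continuous g) {S : Set (Ed 2)} (hS : S.Nonempty)
    (hm : ∀ (γ : ℝ → Ed 2) (T : ℝ), LipschitzWith 1 γ → 0 ≤ T → γ 0 ∈ S →
      m (γ T) ≤ b (γ 0) + pathCost Ψ g γ 0 T) :
    ∃ φ : Ed 2 → ℝ, (∀ (x u : Ed 2) (l : ℝ), ‖u‖ = 1 → 0 ≤ l →
      φ (x + l • u) - φ x ≤ pathCost Ψ g (fun t => x + t • u) 0 l) ∧
      (∀ y, m y ≤ φ y) ∧ ∀ y ∈ S, φ y ≤ b y := by
  let V : Ed 2 → Set ℝ := fun y => {c | ∃ (γ : ℝ → Ed 2) (T : ℝ), LipschitzWith 1 γ ∧ 0 ≤ T ∧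
    γ 0 ∈ S ∧ γ T = y ∧ c = b (γ 0) + pathCost Ψ g γ 0 T}
  have hne : ∀ y, (V y).Nonempty := fun y => by
    obtain ⟨s, hs⟩ := hS
    obtain ⟨γ, h1, h2, h3⟩ := exists_line s y
    exact ⟨_, γ, _, h1, norm_nonneg _, by rwa [h2], h3, rfl⟩
  have hlb : ∀ y, m y ∈ lowerBounds (V y) := by
    rintro y c ⟨γ, T, h1, h2, h3, rfl, rfl⟩
    exact hm γ T h1 h2 h3
  refine ⟨fun y => sInf (V y), fun x u l hu hl => ?_, fun y => le_csInf (hne y) (hlb y),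
    fun y hy => csInf_le ⟨_, hlb y⟩ ⟨fun _ => y, 0, LipschitzWith.const' y, le_rfl, hy, rfl, by simp⟩⟩
  rw [sub_le_iff_le_add, ← sub_le_iff_le_add']
  refine le_csInf (hne x) ?_
  rintro c ⟨γ, T, h1, h2, h3, h4, rfl⟩
  rw [sub_le_iff_le_add']
  have hst : γ T = (fun t : ℝ => x + t • u) 0 := by simp [h4]
  have hgl := lipschitz_glue h1 (lipschitz_line x hu) hst
  have e := pathCost_glue hΨ hg h1 (lipschitz_line x hu) hst h2 (show T ≤ T + l by linarith)
  rw [add_sub_cancel_left, add_zero] at e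
  refine csInf_le ⟨_, hlb _⟩ ⟨_, T + l, hgl, by linarith, ?_, ?_, ?_⟩
  · rwa [glue_of_le h2]
  · rw [glue_of_ge hst (by linarith)]; simp
  · rw [glue_of_le h2, e]; ring

theorem DivFlow.real_univ_eq (D : DivFlow) : D.ρp.real univ = D.ρm.real univ := by
  have h := D.div_eq_of_lipschitz (φ := fun _ => 1) (L := 0) contDiff_const (LipschitzWith.const 1)
    (integrable_const _) (integrable_const _)
  simp at h
  linarith

theorem le_integral_max {α : Type*} [MeasurableSpace α] {μ : Measure α} {u : α → ℝ}
    (hu : Integrable u μ) : ∫ x, u x ∂μ ≤ ∫ x, max (u x) 0 ∂μ :=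
  integral_mono hu hu.pos_part fun _ => le_max_left _ _

/-- A flow with a nonzero divergence has a uniformly positive price. -/
theorem DivFlow.exists_le_total_of_endpoints (D : DivFlow) (h : D.ρp ≠ 0) :
    ∃ c, 0 < c ∧ ∀ θ : Price, θ.Feasible → c ≤ θ.total D := by
  have hW : 0 < ∫ x, wt x ∂D.ρp := by
    rw [integral_pos_iff_support_of_nonneg (fun x => (wt_pos x).le) ucb_wt.integrable]
    have : Function.support wt = univ := by ext x; simp [(wt_pos x).ne']
    rw [this]
    exact Measure.measure_univ_pos.2 h
  set W := ∫ x, wt x ∂D.ρp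
  set A := D.σ.real univ
  have hA : 0 ≤ A := measureReal_nonneg
  let s : ℝ := W / (W + A + 1)
  have hs0 : 0 < s := by positivity
  have hs1 : s * (W + A + 1) = W := div_mul_cancel₀ _ (by positivity)
  refine ⟨(2 * s - s ^ 2) * W - s ^ 2 * A, by nlinarith [mul_pos hs0 hs0], fun θ hθ => ?_⟩
  have hs : s ≤ 1 := by rw [div_le_one (by positivity)]; linarith
  have hf : UCB (θ.f + fun _ => s ^ 2) := θ.hf.add (UCB.const _)
  have hb : UCB (θ.p - (2 * s - s ^ 2) • wt) := θ.hp.sub (ucb_wt.smul _)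
  obtain ⟨φ, h1, h2, h3⟩ := exists_potential (Ψ := θ.Φ) (g := θ.f + fun _ => s ^ 2)
    (b := θ.p - (2 * s - s ^ 2) • wt) (m := -θ.q) (S := univ) θ.hΦ.continuous hf.continuous
    univ_nonempty (by
      intro γ T hγ hT _
      have h4 := mul_le_mul_of_nonneg_left (hθ.arc (PathSpace.mk γ hγ 0 hT)) (by linarith : (0:ℝ) ≤ 1 + T)
      rw [Price.arc, arcCost_mk hγ 0 hT θ.hΦ.continuous θ.hf.continuous, arcReward, cur_mk_zero,
        time_mk, zero_add] at h4
      have h5 : pathCost θ.Φ (θ.f + fun _ => s ^ 2) γ 0 T = pathCost θ.Φ θ.f γ 0 T + s ^ 2 * T := by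
        rw [pathCost_eq θ.hΦ.continuous hf.continuous hγ,
          pathCost_eq θ.hΦ.continuous θ.hf.continuous hγ, add_assoc]
        congr 1
        have := intervalIntegral.integral_add (μ := volume) (a := 0) (b := T)
          (f := fun t => θ.f (γ t)) (g := fun _ => s ^ 2)
          ((θ.hf.continuous.comp hγ.continuous).intervalIntegrable _ _) intervalIntegrable_const
        rw [intervalIntegral.integral_const, sub_zero, smul_eq_mul, mul_comm T] at this
        exact this
      have h6 : (1 + T) * (wt (γ 0) / (1 + T) ^ 2) = wt (γ 0) / (1 + T) := by
        field_simp
      have h7 : wt (γ 0) * (2 * s - s ^ 2) - s ^ 2 * T ≤ wt (γ 0) / (1 + T) := by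
        rw [le_div_iff₀ (by linarith)]
        have w0 := wt_pos (γ 0)
        have w1 := wt_le_one (γ 0)
        nlinarith [mul_nonneg w0.le (sq_nonneg (s * (1 + T) - 1)), mul_nonneg (mul_nonneg (sq_nonneg s) hT) (sub_nonneg.2 w1), mul_nonneg (mul_nonneg (sq_nonneg s) (mul_nonneg hT hT)) (sub_nonneg.2 w1)]
      rw [h5]
      show -θ.q (γ T) ≤ θ.p (γ 0) - (2 * s - s ^ 2) * wt (γ 0) + _
      rw [h6] at h4
      nlinarith)
  obtain ⟨C₁, -, hC₁⟩ := θ.hq.exists_pos_bound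
  obtain ⟨C₂, -, hC₂⟩ := hb.exists_pos_bound
  have hφc : Continuous φ := by
    obtain ⟨C, hC0, hC⟩ := θ.hΦ.exists_pos_bound
    obtain ⟨C', hC0', hC'⟩ := hf.exists_pos_bound
    have := lipschitz_of_line_le (φ := φ) (C := ⟨C, hC0.le⟩) (D := ⟨C', hC0'.le⟩) hC hC' h1
    exact this.continuous
  have hφi : ∀ (μ : Measure (Ed 2)) [IsFiniteMeasure μ], Integrable φ μ := fun μ _ =>
    Integrable.of_bound hφc.aestronglyMeasurable (max C₁ C₂) (Eventually.of_forall fun x => by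
      rw [Real.norm_eq_abs, abs_le]
      have e1 := h2 x
      have e2 := h3 x (mem_univ _)
      have e3 := (abs_le.1 (hC₁ x)).2
      have e4 := (abs_le.1 (hC₂ x)).2
      have e5 : -θ.q x ≤ φ x := e1
      exact ⟨by linarith [le_max_left C₁ C₂], by linarith [le_max_right C₁ C₂]⟩)
  have h8 := D.potential_le θ.hΦ hf h1 (hφi _) (hφi _)
  have h9 : ∫ x, (⟪θ.Φ x, D.τ x⟫ + (θ.f + fun _ => s ^ 2 : Ed 2 → ℝ) x) ∂D.σ =
      ∫ x, (⟪θ.Φ x, D.τ x⟫ + θ.f x) ∂D.σ + s ^ 2 * A := by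
    have := integral_add (θ.integrable_density D) (integrable_const (s ^ 2))
    simp only [← add_assoc, Pi.add_apply] at this ⊢
    rw [this]; simp [A, mul_comm]
  have h10 : ∫ x, φ x ∂D.ρp ≤ ∫ x, θ.p x ∂D.ρp - (2 * s - s ^ 2) * W := by
    rw [← integral_const_mul, ← integral_sub θ.hp.integrable (ucb_wt.integrable.const_mul _)]
    exact integral_mono (hφi _) (θ.hp.integrable.sub (ucb_wt.integrable.const_mul _))
      fun x => h3 x (mem_univ _)
  have h11 : -∫ x, θ.q x ∂D.ρm ≤ ∫ x, φ x ∂D.ρm := by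
    rw [← integral_neg]
    exact integral_mono θ.hq.integrable.neg (hφi _) h2
  have h12 := le_integral_max (θ.integrable_density D)
  have h13 := le_integral_max (θ.hp.integrable (μ := D.ρp))
  have h14 := le_integral_max (θ.hq.integrable (μ := D.ρm))
  rw [Price.total]
  linarith

/-- A continuous function on the plane without zeros has a continuous logarithm. -/
theorem exists_continuous_log {g : ℝ × ℝ → ℂ} (hg : Continuous g) (h0 : ∀ x, g x ≠ 0) :
    ∃ f : ℝ × ℝ → ℂ, Continuous f ∧ ∀ x, Complex.exp (f x) = g x := by
  obtain ⟨f, ⟨-, hf⟩, -⟩ := Complex.isCoveringMapOn_exp.existsUnique_continuousMap_lifts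
    ⟨g, hg⟩ (Complex.exp_log (h0 0)) h0
  exact ⟨f, f.continuous, fun x => congrFun hf x⟩

theorem eq_of_exp_eq_one {D : ℝ → ℂ} (hD : ContinuousOn D (Icc 0 1))
    (h : ∀ t ∈ Icc (0:ℝ) 1, Complex.exp (D t) = 1) : D 0 = D 1 := by
  have hcount : {z : ℂ | Complex.exp z = 1}.Countable := by
    refine (countable_range fun n : ℤ => (n : ℂ) * (2 * Real.pi * Complex.I)).mono fun z hz => ?_
    obtain ⟨n, hn⟩ := Complex.exp_eq_one_iff.1 hz
    exact ⟨n, hn.symm⟩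
  exact hcount.isTotallyDisconnected _ (image_subset_iff.2 h)
    (isPreconnected_Icc.image _ hD) (mem_image_of_mem _ ⟨le_rfl, zero_le_one⟩)
    (mem_image_of_mem _ ⟨zero_le_one, le_rfl⟩)

/-- The variation of the logarithm along a curve in the closed right half plane. -/
theorem im_sub_of_re_nonneg {L : ℝ → ℂ} (hL : ContinuousOn L (Icc 0 1))
    (h : ∀ t ∈ Icc (0:ℝ) 1, 0 ≤ (Complex.exp (L t)).re) :
    L 1 - L 0 = Complex.log (Complex.exp (L 1)) - Complex.log (Complex.exp (L 0)) := by
  have hsl : ∀ t ∈ Icc (0:ℝ) 1, Complex.exp (L t) ∈ Complex.slitPlane := fun t ht => by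
    rw [Complex.mem_slitPlane_iff]
    by_contra! hc
    have : (Complex.exp (L t)).re = 0 := le_antisymm hc.1 (h t ht)
    exact Complex.exp_ne_zero (L t) (Complex.ext this hc.2)
  have := eq_of_exp_eq_one (D := fun t => L t - Complex.log (Complex.exp (L t)))
    (hL.sub ((Complex.continuous_exp.comp_continuousOn hL).clog hsl)) fun t _ => by
      rw [Complex.exp_sub, Complex.exp_log (Complex.exp_ne_zero _), div_self (Complex.exp_ne_zero _)]
  linear_combination -this

/-- The winding number of a simple loop, based at a point of maximal modulus, is at most one. -/
theorem winding_le_one_of_max {Q : ℝ → ℂ} (hQ : Continuous Q) {n : ℤ}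
    (hn : Q 1 = Q 0 + 2 * Real.pi * n * Complex.I) (hmax : ∀ t ∈ Icc (0:ℝ) 1, (Q t).re ≤ (Q 0).re)
    (hinj : ∀ s t, 0 ≤ s → s ≤ t → t ≤ 1 → Complex.exp (Q s) = Complex.exp (Q t) →
      s = t ∨ (s = 0 ∧ t = 1)) : n ≤ 1 := by
  by_contra! hlt
  let c : ℝ → ℝ := fun t => max 0 (min 1 t)
  have hc : Continuous c := by fun_prop
  have hc0 : ∀ t, 0 ≤ c t := fun t => le_max_left _ _
  have hc1 : ∀ t, c t ≤ 1 := fun t => max_le zero_le_one (min_le_left _ _)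
  have hcI : ∀ t ∈ Icc (0:ℝ) 1, c t = t := fun t ht => by
    simp only [c]; rw [min_eq_right ht.2, max_eq_right ht.1]
  have hpi := Real.pi_pos
  let W : ℝ × ℝ → ℂ := fun x => Q (c x.2) - Q (c x.1 * c x.2) - 2 * Real.pi * Complex.I
  have hW : Continuous W := by fun_prop
  have hW0 : ∀ x, W x ≠ 0 := fun x hx => by
    have e : Q (c x.2) = Q (c x.1 * c x.2) + 2 * Real.pi * Complex.I := by
      simp only [W] at hx
      linear_combination hx
    have e2 : Complex.exp (Q (c x.1 * c x.2)) = Complex.exp (Q (c x.2)) := by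
      rw [e, Complex.exp_add, Complex.exp_two_pi_mul_I, mul_one]
    rcases hinj _ _ (mul_nonneg (hc0 _) (hc0 _)) (mul_le_of_le_one_left (hc0 _) (hc1 _)) (hc1 _) e2
      with h | ⟨h, h'⟩
    · rw [h] at e
      simp [hpi.ne'] at e
    · rw [h, h', hn] at e
      have e3 : (2 * Real.pi * Complex.I) * ((n : ℂ) - 1) = 0 := by linear_combination e
      rcases mul_eq_zero.1 e3 with h | h
      · simp [hpi.ne'] at h
      · have : (n : ℂ) = (1 : ℤ) := by push_cast; linear_combination h
        have := Int.cast_injective this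
        omega
  obtain ⟨L, hL, hLW⟩ := exists_continuous_log hW hW0
  have m0 : (0:ℝ) ∈ Icc (0:ℝ) 1 := ⟨le_rfl, zero_le_one⟩
  have m1 : (1:ℝ) ∈ Icc (0:ℝ) 1 := ⟨zero_le_one, le_rfl⟩
  have W00 : W (0, 0) = -(2 * Real.pi * Complex.I) := by simp [W, hcI 0 m0]
  have W11 : W (1, 1) = -(2 * Real.pi * Complex.I) := by simp [W, hcI 1 m1]
  have W01 : W (0, 1) = 2 * Real.pi * (n - 1) * Complex.I := by
    simp only [W, hcI 0 m0, hcI 1 m1, zero_mul, hn]; ring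
  have hn1 : (0:ℝ) < 2 * Real.pi * (n - 1) := by
    have : (1:ℝ) < n := by exact_mod_cast hlt
    have : (0:ℝ) < n - 1 := by linarith
    positivity
  have logpos : ∀ r : ℝ, 0 < r → (Complex.log (r * Complex.I)).im = Real.pi / 2 := fun r hr => by
    rw [Complex.log_im, Complex.arg_real_mul _ hr, Complex.arg_I]
  have logneg : ∀ r : ℝ, 0 < r → (Complex.log (-(r * Complex.I))).im = -(Real.pi / 2) := fun r hr => by
    rw [← mul_neg, Complex.log_im, Complex.arg_real_mul _ hr, Complex.arg_neg_I]
  have hcn : ((2 * Real.pi * (n - 1) : ℝ) : ℂ) = 2 * Real.pi * (n - 1) := by push_cast; ring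
  have hc2 : ((2 * Real.pi : ℝ) : ℂ) = 2 * Real.pi := by push_cast; ring
  have eA : (L (0, 1) - L (0, 0)).im = -Real.pi := by
    have hexp : ∀ t, Complex.exp (L (0, t) + Real.pi * Complex.I) = -W (0, t) := fun t => by
      rw [Complex.exp_add, hLW, Complex.exp_pi_mul_I]; ring
    have := im_sub_of_re_nonneg (L := fun t => L (0, t) + Real.pi * Complex.I)
      (by fun_prop) (fun t ht => by
        rw [hexp]
        have := hmax t ht
        simp [W, hcI t ht, hcI 0 m0]; linarith)
    simp only [hexp, W01, W00, neg_neg] at this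
    rw [← hcn, ← hc2] at this
    have := congrArg Complex.im this
    simp only [add_sub_add_right_eq_sub] at this
    rw [this, Complex.sub_im, logneg _ hn1, logpos _ (by positivity)]
    ring
  have eB : (L (1, 1) - L (0, 1)).im = -Real.pi := by
    have := im_sub_of_re_nonneg (L := fun t => L (t, 1))
      (by fun_prop) (fun t ht => by
        rw [hLW]
        have := hmax t ht
        have e : (Q 1).re = (Q 0).re := by rw [hn]; simp
        simp [W, hcI t ht, hcI 1 m1]; linarith)
    simp only [hLW, W01, W11] at this
    rw [← hcn, ← hc2] at this
    have := congrArg Complex.im this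
    rw [this, Complex.sub_im, logneg _ (by positivity), logpos _ hn1]
    ring
  have eC : L (0, 0) = L (1, 1) := by
    have h1 := eq_of_exp_eq_one (D := fun t => L (1, t) - L (1, 0)) (by fun_prop) fun t ht => by
      rw [Complex.exp_sub, hLW, hLW]
      have : W (1, t) = W (1, 0) := by simp [W, hcI 1 m1]
      rw [this, div_self (hW0 _)]
    have h2 := eq_of_exp_eq_one (D := fun t => L (t, 0) - L (0, 0)) (by fun_prop) fun t ht => by
      rw [Complex.exp_sub, hLW, hLW]
      have : W (t, 0) = W (0, 0) := by simp [W, hcI 0 m0]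
      rw [this, div_self (hW0 _)]
    linear_combination h1 + h2
  rw [eC] at eA
  rw [← neg_sub, Complex.neg_im, eB] at eA
  linarith

theorem winding_le_one {P : ℝ → ℂ} (hP : ContinuousOn P (Icc 0 1)) {n : ℤ}
    (hn : P 1 = P 0 + 2 * Real.pi * n * Complex.I)
    (hinj : ∀ s t, 0 ≤ s → s ≤ t → t ≤ 1 → Complex.exp (P s) = Complex.exp (P t) →
      s = t ∨ (s = 0 ∧ t = 1)) : n ≤ 1 := by
  obtain ⟨a, ha, hmax⟩ := isCompact_Icc.exists_isMaxOn (nonempty_Icc.2 zero_le_one)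
    (Complex.continuous_re.comp_continuousOn hP)
  have hmax : ∀ t ∈ Icc (0:ℝ) 1, (P t).re ≤ (P a).re := fun t ht => hmax ht
  let c : ℝ → ℝ := fun t => max 0 (min 1 t)
  have hc : Continuous c := by fun_prop
  have hcI : ∀ t, c t ∈ Icc (0:ℝ) 1 := fun t =>
    ⟨le_max_left _ _, max_le zero_le_one (min_le_left _ _)⟩
  have hPc : Continuous (P ∘ c) := hP.comp_continuous hc hcI
  let Q : ℝ → ℂ := fun t => (P ∘ c) (a + t) + ((P ∘ c) (a + t - 1) - P 0)
  have hQ1 : ∀ t, 0 ≤ t → a + t ≤ 1 → Q t = P (a + t) := fun t h0 h1 => by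
    have e1 : c (a + t) = a + t := by
      simp only [c]; rw [min_eq_right h1, max_eq_right (by linarith [ha.1])]
    have e2 : c (a + t - 1) = 0 := by
      simp only [c]; rw [min_eq_right (by linarith), max_eq_left (by linarith)]
    simp [Q, e1, e2]
  have hQ2 : ∀ t, t ≤ 1 → 1 ≤ a + t → Q t = P (a + t - 1) + 2 * Real.pi * n * Complex.I :=
    fun t h0 h1 => by
    have e1 : c (a + t) = 1 := by
      simp only [c]; rw [min_eq_left h1, max_eq_right zero_le_one]
    have e2 : c (a + t - 1) = a + t - 1 := by
      simp only [c]; rw [min_eq_right (by linarith [ha.2]), max_eq_right (by linarith)]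
    simp only [Q, Function.comp, e1, e2, hn]; ring
  have hexp : ∀ z, Complex.exp (z + 2 * Real.pi * n * Complex.I) = Complex.exp z := fun z =>
    Complex.exp_eq_exp_iff_exists_int.2 ⟨n, by ring⟩
  have hQ0 : Q 0 = P a := by rw [hQ1 0 le_rfl (by linarith [ha.2]), add_zero]
  refine winding_le_one_of_max (Q := Q) ((hPc.comp (by fun_prop)).add ((hPc.comp (by fun_prop)).sub continuous_const)) (n := n) ?_ ?_ ?_
  · rw [hQ0, hQ2 1 le_rfl (by linarith [ha.1])]; simp
  · intro t ht
    rw [hQ0]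
    rcases le_total (a + t) 1 with h | h
    · rw [hQ1 t ht.1 h]; exact hmax _ ⟨by linarith [ha.1, ht.1], h⟩
    · rw [hQ2 t ht.2 h]
      have := hmax (a + t - 1) ⟨by linarith, by linarith [ha.2, ht.2]⟩
      simpa using this
  · intro s t hs hst ht he
    rcases le_total (a + t) 1 with h | h
    · rw [hQ1 t (hs.trans hst) h, hQ1 s hs (by linarith)] at he
      rcases hinj _ _ (by linarith [ha.1]) (by linarith) h he with h | ⟨h, h'⟩
      · exact Or.inl (by linarith)
      · exact Or.inr ⟨by linarith [ha.1], by linarith [ha.1]⟩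
    · rw [hQ2 t ht h, hexp] at he
      rcases le_total (a + s) 1 with h' | h'
      · rw [hQ1 s hs h'] at he
        rcases hinj _ _ (by linarith) (by linarith) h' he.symm with h | ⟨h, h'⟩
        · exact Or.inr ⟨by linarith, by linarith⟩
        · exact Or.inl (by linarith)
      · rw [hQ2 s (hst.trans ht) h', hexp] at he
        rcases hinj _ _ (by linarith) (by linarith) (by linarith [ha.2]) he with h | ⟨h, h'⟩
        · exact Or.inl (by linarith)
        · exact Or.inr ⟨by linarith [ha.2], by linarith [ha.2]⟩

/-- The winding number of a simple loop around any point is `-1`, `0` or `1`. -/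
theorem abs_winding_le_one {P : ℝ → ℂ} (hP : ContinuousOn P (Icc 0 1)) {n : ℤ}
    (hn : P 1 = P 0 + 2 * Real.pi * n * Complex.I)
    (hinj : ∀ s t, 0 ≤ s → s ≤ t → t ≤ 1 → Complex.exp (P s) = Complex.exp (P t) →
      s = t ∨ (s = 0 ∧ t = 1)) : |n| ≤ 1 := by
  refine abs_le.2 ⟨?_, winding_le_one hP hn hinj⟩
  have := winding_le_one (P := fun t => (starRingEnd ℂ) (P t)) (n := -n)
    (Complex.continuous_conj.comp_continuousOn hP) (by rw [hn]; simp; exact Or.inl (map_ofNat _ 2)) fun s t hs hst ht he =>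
      hinj s t hs hst ht (by
        rw [Complex.exp_conj, Complex.exp_conj] at he
        exact (starRingEnd ℂ).injective he)
  linarith

/-- Twice the bound `π` controls the winding integral of a simple Lipschitz loop. -/
theorem norm_winding_integral_le {γ : ℝ → ℂ} {K : ℝ≥0} (hγ : LipschitzWith K γ)
    (h01 : γ 0 = γ 1) (hinj : InjOn γ (Ico 0 1)) {z : ℂ} (hz : ∀ t ∈ Icc (0:ℝ) 1, γ t ≠ z) :
    ‖∫ t in (0:ℝ)..1, deriv γ t / (γ t - z)‖ ≤ 2 * Real.pi := by
  have hu : uIcc (0:ℝ) 1 = Icc 0 1 := uIcc_of_le zero_le_one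
  have hne : ∀ t ∈ Icc (0:ℝ) 1, γ t - z ≠ 0 := fun t ht => sub_ne_zero.2 (hz t ht)
  set h : ℝ → ℂ := fun t => deriv γ t / (γ t - z) with hh
  have hinvc : ContinuousOn (fun t => (γ t - z)⁻¹) (Icc 0 1) :=
    (hγ.continuous.sub continuous_const).continuousOn.inv₀ hne
  have h_int : IntervalIntegrable h volume 0 1 := by
    simp only [hh, div_eq_mul_inv]
    exact (hγ.intervalIntegrable_deriv 0 1).mul_continuousOn (hu ▸ hinvc)
  obtain ⟨M, hM⟩ := isCompact_Icc.exists_bound_of_continuousOn hinvc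
  have hb : ∀ t ∈ Icc (0:ℝ) 1, ‖h t‖ ≤ K * M := fun t ht => by
    simp only [hh, div_eq_mul_inv, norm_mul]
    exact mul_le_mul (norm_deriv_le_of_lipschitz hγ) (hM t ht) (norm_nonneg _) K.2
  have hM0 : 0 ≤ K * M := (norm_nonneg _).trans (hb 0 ⟨le_rfl, zero_le_one⟩)
  let P : ℝ → ℂ := fun t => Complex.log (γ 0 - z) + ∫ s in (0:ℝ)..t, h s
  have hsub : ∀ s ∈ Icc (0:ℝ) 1, ∀ t ∈ Icc (0:ℝ) 1, IntervalIntegrable h volume s t :=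
    fun s hs t ht => h_int.mono_set (by
      rw [hu]; exact ordConnected_Icc.uIcc_subset hs ht)
  have m0 : (0:ℝ) ∈ Icc (0:ℝ) 1 := ⟨le_rfl, zero_le_one⟩
  have m1 : (1:ℝ) ∈ Icc (0:ℝ) 1 := ⟨zero_le_one, le_rfl⟩
  have hPL : LipschitzOnWith ⟨K * M, hM0⟩ P (Icc 0 1) := by
    refine LipschitzOnWith.of_dist_le_mul fun s hs t ht => ?_
    rw [dist_eq_norm, dist_comm, Real.dist_eq]
    simp only [P, add_sub_add_left_eq_sub]
    rw [intervalIntegral.integral_interval_sub_left (hsub 0 m0 s hs) (hsub 0 m0 t ht),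
      intervalIntegral.integral_symm, norm_neg]
    rw [intervalIntegral.integral_symm, norm_neg]
    refine (intervalIntegral.norm_integral_le_of_norm_le_const fun x hx => hb x ?_).trans ?_
    · exact ordConnected_Icc.uIcc_subset ht hs (uIoc_subset_uIcc hx)
    · rw [abs_sub_comm]; rfl
  have hPc : ContinuousOn P (Icc 0 1) := hPL.continuousOn
  obtain ⟨R, hR⟩ := isCompact_Icc.exists_bound_of_continuousOn hPc
  have hexpL : LipschitzOnWith ⟨Real.exp R, (Real.exp_pos R).le⟩ Complex.exp
      (Metric.closedBall 0 R) := by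
    refine (convex_closedBall (0:ℂ) R).lipschitzOnWith_of_nnnorm_deriv_le
      (fun x _ => Complex.differentiable_exp.differentiableAt) fun x hx => ?_
    change ‖deriv Complex.exp x‖ ≤ Real.exp R
    rw [Complex.deriv_exp, Complex.norm_exp]
    exact Real.exp_le_exp.2 (((le_abs_self _).trans (Complex.abs_re_le_norm x)).trans
      (mem_closedBall_zero_iff.1 hx))
  have hEL := hexpL.comp (hPL.neg) (fun t ht => by simpa using hR t ht)
  have hac : AbsolutelyContinuousOnInterval
      ((fun t => γ t - z) • (fun t => Complex.exp (-P t))) 0 1 := by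
    refine AbsolutelyContinuousOnInterval.smul
      (LipschitzOnWith.absolutelyContinuousOnInterval (K := K) ?_)
      (LipschitzOnWith.absolutelyContinuousOnInterval (hu ▸ hEL))
    refine LipschitzOnWith.of_dist_le_mul fun s _ t _ => ?_
    rw [dist_sub_right]; exact hγ.dist_le_mul s t
  obtain ⟨c, hc⟩ := hac.const_of_ae_hasDerivAt_zero (by
    filter_upwards [h_int.ae_hasDerivAt_integral, hγ.ae_differentiableAt] with t ht hd htm
    have h1 : HasDerivAt P (h t) t := by
      have := (ht htm 0 (by simp)).const_add (Complex.log (γ 0 - z))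
      exact this
    have h2 := (hd.hasDerivAt.sub_const z).mul h1.neg.cexp
    rw [hu] at htm
    refine (show HasDerivAt ((fun t => γ t - z) • fun t => Complex.exp (-P t)) _ t from
      h2).congr_deriv ?_
    have e : h t * (γ t - z) = deriv γ t := div_mul_cancel₀ _ (hne t htm)
    rw [← e]
    ring)
  replace hc : ∀ t ∈ Icc (0:ℝ) 1, (γ t - z) * Complex.exp (-P t) = c := hu ▸ hc
  have hc1 : c = 1 := by
    rw [← hc 0 m0]
    simp only [P, intervalIntegral.integral_same, add_zero]
    rw [Complex.exp_neg, Complex.exp_log (hne 0 m0), mul_inv_cancel₀ (hne 0 m0)]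
  have hexp : ∀ t ∈ Icc (0:ℝ) 1, Complex.exp (P t) = γ t - z := fun t ht => by
    have := hc t ht
    rw [hc1] at this
    rw [Complex.exp_neg] at this
    exact (eq_of_mul_inv_eq_one this).symm
  obtain ⟨n, hn⟩ := Complex.exp_eq_exp_iff_exists_int.1
    (show Complex.exp (P 1) = Complex.exp (P 0) by rw [hexp 1 m1, hexp 0 m0, h01])
  have hn' : P 1 = P 0 + 2 * Real.pi * n * Complex.I := by rw [hn]; ring
  have hle := abs_winding_le_one hPc hn' fun s t hs hst ht he => by
    rw [hexp s ⟨hs, hst.trans ht⟩, hexp t ⟨hs.trans hst, ht⟩, sub_left_inj] at he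
    rcases eq_or_lt_of_le ht with rfl | ht1
    · rcases eq_or_lt_of_le hst with rfl | hs1
      · exact Or.inl rfl
      · exact Or.inr ⟨hinj ⟨hs, hs1⟩ ⟨le_rfl, one_pos⟩ (he.trans h01.symm), rfl⟩
    · exact Or.inl (hinj ⟨hs, hst.trans_lt ht1⟩ ⟨hs.trans hst, ht1⟩ he)
  have : ∫ t in (0:ℝ)..1, h t = 2 * Real.pi * n * Complex.I := by
    have : P 1 - P 0 = ∫ t in (0:ℝ)..1, h t := by simp [P]
    rw [← this, hn']; ring
  rw [this]
  have hnn : |(n:ℝ)| ≤ 1 := by exact_mod_cast hle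
  simp only [norm_mul, Complex.norm_I, mul_one, Complex.norm_real, Complex.norm_ofNat,
    Complex.norm_intCast, Real.norm_eq_abs, abs_of_pos Real.pi_pos]
  nlinarith [Real.pi_pos]

theorem integrable_polar {F : ℝ × ℝ → ℂ} (hF : Continuous F) {R : ℝ}
    (h0 : ∀ p : ℝ × ℝ, R < p.1 → F p = 0) :
    Integrable F ((volume.restrict (Ioi 0)).prod (volume.restrict (Ioo (-Real.pi) Real.pi))) := by
  rw [Measure.prod_restrict]
  have hK : IntegrableOn F (Icc 0 R ×ˢ Icc (-Real.pi) Real.pi) (volume.prod volume) :=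
    hF.continuousOn.integrableOn_compact (isCompact_Icc.prod isCompact_Icc)
  refine hK.of_forall_sdiff_eq_zero (measurableSet_Ioi.prod measurableSet_Ioo) fun p hp => h0 p ?_
  by_contra! h
  exact hp.2 ⟨⟨hp.1.1.le, h⟩, hp.1.2.1.le, hp.1.2.2.le⟩

/-- Twice the antiholomorphic derivative. -/
def dbar (g : ℂ → ℂ) (z : ℂ) : ℂ := fderiv ℝ g z 1 + Complex.I * fderiv ℝ g z Complex.I

theorem continuous_dbar {g : ℂ → ℂ} (hg : ContDiff ℝ 1 g) : Continuous (dbar g) := by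
  have := hg.continuous_fderiv one_ne_zero
  unfold dbar
  fun_prop

theorem hasCompactSupport_dbar {g : ℂ → ℂ} (hs : HasCompactSupport g) :
    HasCompactSupport (dbar g) := by
  refine hs.fderiv (𝕜 := ℝ) |>.mono fun z hz => ?_
  rw [Function.mem_support] at hz ⊢
  rintro h
  simp [dbar, h] at hz

/-- The **Cauchy–Pompeiu formula**. -/
theorem integral_dbar_div {g : ℂ → ℂ} (hg : ContDiff ℝ 1 g) (hs : HasCompactSupport g) (w : ℂ) :
    ∫ z, dbar g (w + z) / z = -(2 * Real.pi * g w) := by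
  let e : ℝ → ℂ := fun θ => Real.cos θ + Real.sin θ * Complex.I
  have hec : Continuous e := by simp only [e]; fun_prop
  have hen : ∀ θ, ‖e θ‖ = 1 := fun θ => by
    simp only [e]
    rw [Complex.ofReal_cos, Complex.ofReal_sin, ← Complex.exp_mul_I, Complex.norm_exp_ofReal_mul_I]
  have hd : ∀ θ, HasDerivAt e (Complex.I * e θ) θ := fun θ => by
    have h1 := ((Real.hasDerivAt_cos θ).ofReal_comp).add
      (((Real.hasDerivAt_sin θ).ofReal_comp).mul_const Complex.I)
    refine h1.congr_deriv ?_
    simp only [e]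
    push_cast
    linear_combination (-Complex.sin θ) * Complex.I_sq
  have hfc := hg.continuous_fderiv one_ne_zero
  have hgd : Differentiable ℝ g := hg.differentiable one_ne_zero
  let F : ℝ × ℝ → ℂ := fun p => fderiv ℝ g (w + p.1 * e p.2) (e p.2)
  let G : ℝ × ℝ → ℂ := fun p => fderiv ℝ g (w + p.1 * e p.2) (Complex.I * e p.2)
  have hF : Continuous F := by simp only [F]; fun_prop
  have hG : Continuous G := by simp only [G]; fun_prop
  obtain ⟨R, hR⟩ := (hs.isCompact.isBounded).subset_closedBall 0
  have hR' : ∀ z, R < ‖z‖ → z ∉ tsupport g := fun z hz hz' => by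
    have := mem_closedBall_zero_iff.1 (hR hz'); linarith
  have hfar : ∀ r θ, R + ‖w‖ < r → R < ‖w + (r:ℝ) * e θ‖ := fun r θ hr => by
    have h1 : ‖(r:ℂ) * e θ‖ = |r| := by
      rw [norm_mul, hen, mul_one, Complex.norm_real, Real.norm_eq_abs]
    have h2 := norm_sub_le (w + (r:ℝ) * e θ) w
    rw [add_sub_cancel_left, h1] at h2
    linarith [le_abs_self r]
  have hD0 : ∀ r θ, R + ‖w‖ < r → fderiv ℝ g (w + (r:ℝ) * e θ) = 0 := fun r θ hr => by
    by_contra h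
    exact hR' _ (hfar r θ hr) (support_fderiv_subset ℝ h)
  have hF0 : ∀ p : ℝ × ℝ, R + ‖w‖ < p.1 → F p = 0 := fun p hp => by simp [F, hD0 _ _ hp]
  have hG0 : ∀ p : ℝ × ℝ, R + ‖w‖ < p.1 → G p = 0 := fun p hp => by simp [G, hD0 _ _ hp]
  have hFi := integrable_polar hF hF0
  have hGi := integrable_polar hG hG0
  have hr : ∀ θ, ∫ r in Ioi (0:ℝ), F (r, θ) = -g w := fun θ => by
    have hder : ∀ r ∈ Ici (0:ℝ), HasDerivAt (fun r : ℝ => g (w + r * e θ)) (F (r, θ)) r :=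
      fun r _ => by
        have h1 : HasDerivAt (fun r : ℝ => w + r * e θ) (e θ) r := by
          have := ((hasDerivAt_id r).ofReal_comp.mul_const (e θ)).const_add w
          simpa using this
        exact (hgd _).hasFDerivAt.comp_hasDerivAt r h1
    have := integral_Ioi_of_hasDerivAt_of_tendsto' (m := 0) hder ?_ ?_
    · simpa using this
    · refine ((hF.comp (by fun_prop : Continuous fun r : ℝ => (r, θ))).continuousOn.integrableOn_compact
        (isCompact_Icc (a := 0) (b := R + ‖w‖))).of_forall_sdiff_eq_zero measurableSet_Ioi
        fun r hr => hF0 (r, θ) ?_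
      by_contra! h
      exact hr.2 ⟨hr.1.le, h⟩
    · refine tendsto_const_nhds.congr' ?_
      filter_upwards [eventually_gt_atTop (R + ‖w‖)] with r hr
      exact (image_eq_zero_of_notMem_tsupport (hR' _ (hfar r θ hr))).symm
  have hθ : ∀ r ∈ Ioi (0:ℝ), ∫ θ in Ioo (-Real.pi) Real.pi, G (r, θ) = 0 := fun r hr => by
    rw [mem_Ioi] at hr
    have hder : ∀ θ ∈ uIcc (-Real.pi) Real.pi,
        HasDerivAt (fun θ : ℝ => g (w + r * e θ)) (r * G (r, θ)) θ := fun θ _ => by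
      have h1 : HasDerivAt (fun θ : ℝ => w + r * e θ) (r * (Complex.I * e θ)) θ :=
        ((hd θ).const_mul (r:ℂ)).const_add w
      refine ((hgd _).hasFDerivAt.comp_hasDerivAt θ h1).congr_deriv ?_
      simp only [G]
      rw [← Complex.real_smul, ← Complex.real_smul, ContinuousLinearMap.map_smul]
      simp
    have := intervalIntegral.integral_eq_sub_of_hasDerivAt hder
      ((by fun_prop : Continuous fun θ : ℝ => (r:ℂ) * G (r, θ)).intervalIntegrable _ _)
    rw [show e Real.pi = e (-Real.pi) by simp [e], sub_self,
      intervalIntegral.integral_const_mul] at this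
    rw [← integral_Ioc_eq_integral_Ioo, ← intervalIntegral.integral_of_le (by linarith [Real.pi_pos])]
    exact (mul_eq_zero.1 this).resolve_left (by exact_mod_cast hr.ne')
  have hlin : ∀ z θ, dbar g z / e θ = fderiv ℝ g z (e θ) + Complex.I * fderiv ℝ g z (Complex.I * e θ) :=
    fun z θ => by
    have e0 : e θ ≠ 0 := fun h => by have := hen θ; rw [h] at this; simp at this
    have e1 : e θ = Real.cos θ • (1:ℂ) + Real.sin θ • Complex.I := by simp [e]
    have e2 : Complex.I * e θ = Real.cos θ • Complex.I - Real.sin θ • (1:ℂ) := by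
      simp [e, mul_add]; linear_combination (Complex.sin θ) * Complex.I_sq
    rw [div_eq_iff e0, e2, e1, map_add, map_sub]
    simp only [map_smul]
    simp only [Complex.real_smul, dbar]
    have hcs : (Real.cos θ : ℂ) ^ 2 + (Real.sin θ : ℂ) ^ 2 = 1 := by
      exact_mod_cast Real.cos_sq_add_sin_sq θ
    generalize fderiv ℝ g z 1 = A
    generalize fderiv ℝ g z Complex.I = B
    generalize (Real.cos θ : ℂ) = c at *
    generalize (Real.sin θ : ℂ) = s at *
    linear_combination (-(A + Complex.I * B)) * hcs + (-s * c * B + s * s * A) * Complex.I_sq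
  rw [← Complex.integral_comp_polarCoord_symm]
  have hmeas : (volume.restrict polarCoord.target : Measure (ℝ × ℝ)) =
      (volume.restrict (Ioi 0)).prod (volume.restrict (Ioo (-Real.pi) Real.pi)) := by
    rw [Measure.prod_restrict]; rfl
  have hcongr : ∫ p in polarCoord.target,
      p.1 • (dbar g (w + Complex.polarCoord.symm p) / Complex.polarCoord.symm p) =
      ∫ p in polarCoord.target, (F p + Complex.I * G p) := by
    refine setIntegral_congr_fun polarCoord.open_target.measurableSet fun p hp => ?_
    have hp0 : (0:ℝ) < p.1 := hp.1
    have hpc : (p.1 : ℂ) ≠ 0 := by exact_mod_cast hp0.ne'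
    simp only [Complex.polarCoord_symm_apply, Complex.real_smul]
    change (p.1:ℂ) * (dbar g (w + p.1 * e p.2) / (p.1 * e p.2)) = _
    simp only [F, G, ← hlin]
    rw [mul_div_assoc', mul_div_mul_left _ _ hpc]
  rw [hcongr, hmeas, integral_add hFi (hGi.const_mul _), integral_const_mul, integral_prod_symm _ hFi,
    integral_prod _ hGi, setIntegral_congr_fun measurableSet_Ioi hθ]
  simp only [hr, integral_const, smul_zero, mul_zero, add_zero]
  simp [Real.pi_pos.le]
  exact Or.inl (by ring)

theorem volume_range_eq_zero {γ : ℝ → ℂ} {K : ℝ≥0} (hγ : LipschitzWith K γ) :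
    volume (range γ) = 0 := by
  refine measure_zero_of_dimH_lt (d := 2) ?_ ?_
  · have h : ((2:ℝ≥0) : ℝ) = (Module.finrank ℝ ℂ : ℝ) := by simp [Complex.finrank_real_complex]
    rw [h]
    exact Measure.absolutelyContinuous_isAddHaarMeasure _ _
  · refine hγ.dimH_range_le.trans_lt ?_
    rw [Real.dimH_univ]
    norm_num

theorem integrableOn_ball_norm_inv :
    IntegrableOn (fun z : ℂ => ‖z‖⁻¹) (Metric.ball 0 1) := by
  refine integrableOn_ball_of_norm_le_rpow (α := 1) (C := 1) ?_ ?_ ?_ ?_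
  · simp [Complex.finrank_real_complex]
  · simp [Complex.finrank_real_complex]
  · exact ae_of_all _ fun z => by simp [Real.rpow_neg_one]
  · exact (measurable_norm.inv).aestronglyMeasurable

/-- Uniform bound for the Cauchy transform. -/
theorem exists_bound_div {H : ℂ → ℂ} (hH : Continuous H) (hs : HasCompactSupport H) :
    ∃ C, ∀ w, Integrable (fun z => H z / (z - w)) ∧ ∫ z, ‖H z / (z - w)‖ ≤ C := by
  have hHi : Integrable H := hH.integrable_of_hasCompactSupport hs
  obtain ⟨M, hM⟩ := hs.exists_bound_of_continuous hH
  let k : ℂ → ℝ := (Metric.ball (0:ℂ) 1).indicator fun z => ‖z‖⁻¹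
  have hk : Integrable k := integrableOn_ball_norm_inv.integrable_indicator measurableSet_ball
  refine ⟨M * (∫ z, k z) + ∫ z, ‖H z‖, fun w => ?_⟩
  have hle : ∀ z, ‖H (z + w) / z‖ ≤ M * k z + ‖H (z + w)‖ := fun z => by
    rw [norm_div, div_eq_mul_inv]
    by_cases hz : z ∈ Metric.ball (0:ℂ) 1
    · simp only [k, indicator_of_mem hz]
      have := mul_le_mul_of_nonneg_right (hM (z + w)) (inv_nonneg.2 (norm_nonneg z))
      linarith [norm_nonneg (H (z + w))]
    · simp only [k, indicator_of_notMem hz, mul_zero, zero_add]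
      rw [mem_ball_zero_iff, not_lt] at hz
      exact mul_le_of_le_one_right (norm_nonneg _) (inv_le_one_of_one_le₀ hz)
  have hb : Integrable fun z => M * k z + ‖H (z + w)‖ :=
    (hk.const_mul M).add (hHi.comp_add_right w).norm
  have hi : Integrable fun z => H (z + w) / z := by
    refine hb.mono' ?_ (ae_of_all _ hle)
    exact ((hH.comp (continuous_add_const w)).measurable.div measurable_id).aestronglyMeasurable
  have e : ∀ z, H z / (z - w) = (fun z => H (z + w) / z) (z - w) := fun z => by simp
  constructor
  · simp only [e]; exact hi.comp_sub_right w
  · simp only [e]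
    rw [integral_sub_right_eq_self (fun z => ‖(fun z => H (z + w) / z) z‖) w]
    refine (integral_mono hi.norm hb hle).trans ?_
    rw [integral_add (hk.const_mul M) (hHi.comp_add_right w).norm, integral_const_mul,
      integral_add_right_eq_self (fun z => ‖H z‖) w]

/-- The circulation of a smooth field along simple loops is uniformly bounded. -/
theorem norm_integral_mul_deriv_le {g : ℂ → ℂ} (hg : ContDiff ℝ 1 g) (hs : HasCompactSupport g)
    {γ : ℝ → ℂ} {K : ℝ≥0} (hγ : LipschitzWith K γ) (h01 : γ 0 = γ 1) (hinj : InjOn γ (Ico 0 1)) :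
    ‖∫ t in (0:ℝ)..1, g (γ t) * deriv γ t‖ ≤ ∫ z, ‖dbar g z‖ := by
  have hH := continuous_dbar hg
  have hHs := hasCompactSupport_dbar hs
  have hHi : Integrable (dbar g) := hH.integrable_of_hasCompactSupport hHs
  obtain ⟨C, hC⟩ := exists_bound_div hH hHs
  have hC0 : 0 ≤ C := (integral_nonneg fun z => norm_nonneg _).trans (hC 0).2
  have hdm : Measurable (deriv γ) := measurable_deriv γ
  have hγm : Measurable γ := hγ.continuous.measurable
  let F : ℝ × ℂ → ℂ := fun p => dbar g p.2 / (p.2 - γ p.1) * deriv γ p.1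
  have hFm : Measurable F := by
    refine Measurable.mul (Measurable.div ?_ ?_) ?_
    · exact hH.measurable.comp measurable_snd
    · exact measurable_snd.sub (hγm.comp measurable_fst)
    · exact hdm.comp measurable_fst
  have hFi : Integrable F ((volume.restrict (Ioc 0 1)).prod volume) := by
    refine (integrable_prod_iff hFm.aestronglyMeasurable).2 ⟨ae_of_all _ fun t => ?_, ?_⟩
    · exact (hC (γ t)).1.mul_const (deriv γ t)
    · refine Integrable.mono' (integrable_const (C * K))
        hFm.norm.stronglyMeasurable.integral_prod_right'.aestronglyMeasurable (ae_of_all _ fun t => ?_)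
      rw [Real.norm_of_nonneg (integral_nonneg fun z => norm_nonneg _)]
      simp only [F, norm_mul]
      rw [integral_mul_const]
      exact mul_le_mul (hC (γ t)).2 (norm_deriv_le_of_lipschitz hγ) (norm_nonneg _) hC0
  have hcp : ∀ w, ∫ z, dbar g z / (z - w) = -(2 * Real.pi * g w) := fun w => by
    rw [← integral_dbar_div hg hs w, ← integral_sub_right_eq_self (fun z => dbar g (w + z) / z) w]
    simp
  have h1 : ∫ t in (0:ℝ)..1, g (γ t) * deriv γ t =
      (-(2 * Real.pi) : ℂ)⁻¹ * ∫ t in Ioc (0:ℝ) 1, ∫ z, F (t, z) := by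
    have hpi : (-(2 * Real.pi) : ℂ) ≠ 0 := by simp [Real.pi_ne_zero]
    rw [intervalIntegral.integral_of_le zero_le_one, ← integral_const_mul]
    refine integral_congr_ae (ae_of_all _ fun t => ?_)
    simp only [F]
    rw [integral_mul_const, hcp]
    field_simp
  have hnull : ∀ᵐ z : ℂ, z ∉ range γ := by
    rw [ae_iff]; simp only [not_not]; exact volume_range_eq_zero hγ
  have h2 : ‖∫ z, ∫ t in Ioc (0:ℝ) 1, F (t, z)‖ ≤ ∫ z, 2 * Real.pi * ‖dbar g z‖ := by
    refine norm_integral_le_of_norm_le (hHi.norm.const_mul _) ?_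
    filter_upwards [hnull] with z hz
    have e : ∫ t in Ioc (0:ℝ) 1, F (t, z) =
        -dbar g z * ∫ t in (0:ℝ)..1, deriv γ t / (γ t - z) := by
      rw [intervalIntegral.integral_of_le zero_le_one, ← integral_const_mul]
      refine integral_congr_ae (ae_of_all _ fun t => ?_)
      have n1 : γ t - z ≠ 0 := sub_ne_zero.2 fun h => hz ⟨t, h⟩
      have n2 : z - γ t ≠ 0 := sub_ne_zero.2 fun h => hz ⟨t, h.symm⟩
      simp only [F]
      field_simp
      ring
    rw [e, norm_mul, norm_neg, mul_comm]
    exact mul_le_mul_of_nonneg_right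
      (norm_winding_integral_le hγ h01 hinj fun t _ h => hz ⟨t, h⟩) (norm_nonneg _)
  rw [h1, ← integral_prod _ hFi, integral_prod_symm _ hFi, norm_mul]
  rw [integral_const_mul] at h2
  have hp : 0 < 2 * Real.pi := by positivity
  have e3 : ‖(-(2 * Real.pi) : ℂ)⁻¹‖ = (2 * Real.pi)⁻¹ := by
    simp [abs_of_pos Real.pi_pos]
  rw [e3, inv_mul_le_iff₀ hp]
  exact h2

/-- The circulation of `x ↦ g x • v` along simple loops is uniformly bounded. -/
theorem exists_bound_circ_of_simple {g : Ed 2 → ℝ} (hg : ContDiff ℝ 1 g) (hs : HasCompactSupport g)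
    (v : Ed 2) : ∃ C, ∀ ξ : PathSpace, ξ.cur 0 = ξ.cur 1 → InjOn ξ.cur (Ico 0 1) →
      |circ (fun x => g x • v) ξ| ≤ C := by
  let e : Ed 2 ≃ₗᵢ[ℝ] ℂ := Complex.orthonormalBasisOneI.repr.symm
  let G : ℂ → ℂ := fun z => (g (e.symm z) : ℂ)
  have hG : ContDiff ℝ 1 G :=
    Complex.ofRealCLM.contDiff.comp (hg.comp e.symm.toContinuousLinearEquiv.contDiff)
  have hGs : HasCompactSupport G :=
    (hs.comp_homeomorph e.symm.toHomeomorph).comp_left (g := ((↑) : ℝ → ℂ)) Complex.ofReal_zero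
  refine ⟨‖v‖ * ∫ z, ‖dbar G z‖, fun ξ h01 hinj => ?_⟩
  have hL : LipschitzWith (1 * ξ.time.toNNReal) (e ∘ ξ.cur) := e.lipschitz.comp ξ.lipschitz_cur'
  have hb := norm_integral_mul_deriv_le hG hGs hL (by simp [h01])
    (e.injective.comp_injOn hinj)
  have h_int : IntervalIntegrable (fun t => G ((e ∘ ξ.cur) t) * deriv (e ∘ ξ.cur) t) volume 0 1 :=
    (hL.intervalIntegrable_deriv 0 1).continuousOn_mul
      (hG.continuous.comp hL.continuous).continuousOn
  have hcirc : circ (fun x => g x • v) ξ =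
      innerSL ℝ (e v) (∫ t in (0:ℝ)..1, G ((e ∘ ξ.cur) t) * deriv (e ∘ ξ.cur) t) := by
    rw [← ContinuousLinearMap.intervalIntegral_comp_comm _ h_int, circ, lineInt]
    refine intervalIntegral.integral_congr_ae ?_
    filter_upwards [ξ.lipschitz_cur'.ae_differentiableAt] with t hd _
    have : deriv (e ∘ ξ.cur) t = e (deriv ξ.cur t) :=
      (e.toContinuousLinearEquiv.hasFDerivAt.comp_hasDerivAt t hd.hasDerivAt).deriv
    rw [this]
    simp only [G, Function.comp, e.symm_apply_apply, innerSL_apply_apply]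
    rw [← Complex.real_smul, inner_smul_right, e.inner_map_map, real_inner_smul_left]
  rw [hcirc, ← Real.norm_eq_abs]
  refine ((innerSL ℝ (e v)).le_opNorm _).trans ?_
  rw [innerSL_apply_norm, e.norm_map]
  exact mul_le_mul_of_nonneg_left hb (norm_nonneg _)

namespace PathSpace

theorem circ_add_mean_mk {γ : ℝ → Ed 2} (h : LipschitzWith 1 γ) (a : ℝ) {T : ℝ} (hT : 0 ≤ T)
    {Φ : Ed 2 → Ed 2} {f : Ed 2 → ℝ} (hΦ : Continuous Φ) (hf : Continuous f) :
    circ Φ (PathSpace.mk γ h a hT) + T * mean f (PathSpace.mk γ h a hT) =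
      pathCost Φ f γ a (a + T) := by
  rw [circ_mk, time_mul_mean_mk, pathCost_eq hΦ hf h]

/-- Cutting a path at a self-intersection splits it into a loop and a shorter path with the same
endpoints. -/
theorem exists_cut (ξ : PathSpace) (hT : 0 < ξ.time) {s t : ℝ} (hs : 0 ≤ s) (hst : s < t)
    (ht : t ≤ 1) (he : ξ.cur s = ξ.cur t) : ∃ ξ₁ ξ₂ : PathSpace, ξ₁.cur 0 = ξ₁.cur 1 ∧
      ξ₂.cur 0 = ξ.cur 0 ∧ ξ₂.cur 1 = ξ.cur 1 ∧ ξ₁.time = (t - s) * ξ.time ∧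
      ξ₂.time = ξ.time - (t - s) * ξ.time ∧
      ∀ {Φ : Ed 2 → Ed 2} {f : Ed 2 → ℝ}, Continuous Φ → Continuous f →
        (circ Φ ξ₁ + ξ₁.time * mean f ξ₁) + (circ Φ ξ₂ + ξ₂.time * mean f ξ₂) =
          circ Φ ξ + ξ.time * mean f ξ := by
  obtain ⟨γ, h, hξ, hγ⟩ := ξ.exists_eq_mk hT
  set T := ξ.time with hTdef
  have h1 : 0 ≤ (t - s) * T := mul_nonneg (by linarith) hT.le
  have h2 : 0 ≤ T - (t - s) * T := by nlinarith
  have es : γ (s * T) = ξ.cur s := by rw [hγ, mul_div_cancel_right₀ _ hT.ne']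
  have et : γ (t * T) = ξ.cur t := by rw [hγ, mul_div_cancel_right₀ _ hT.ne']
  have e0 : γ 0 = ξ.cur 0 := by rw [hγ, zero_div]
  have e1 : γ T = ξ.cur 1 := by rw [hγ, div_self hT.ne']
  have hg : γ (s * T) = γ (t * T) := by rw [es, et, he]
  have hg' := lipschitz_glue h h hg
  have hsT : 0 ≤ s * T := mul_nonneg hs hT.le
  refine ⟨PathSpace.mk γ h (s * T) h1, PathSpace.mk _ hg' 0 h2, ?_, ?_, ?_, time_mk _ _ _,
    time_mk _ _ _, fun {Φ f} hΦ hf => ?_⟩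
  · rw [cur_mk_zero, cur_mk_one, hg]; congr 1; ring
  · rw [cur_mk_zero, glue_of_le hsT, e0]
  · rw [cur_mk_one, glue_of_ge hg (by nlinarith), ← e1]; congr 1; ring
  · have e2 : circ Φ ξ + T * mean f ξ = pathCost Φ f γ 0 T := by
      have := circ_add_mean_mk h 0 hT.le hΦ hf
      rw [← hξ, zero_add] at this
      exact this
    rw [e2, time_mk, time_mk, circ_add_mean_mk h _ h1 hΦ hf, circ_add_mean_mk hg' 0 h2 hΦ hf,
      pathCost_glue hΦ hf h h hg hsT (by nlinarith),
      ← pathCost_add_adjacent hΦ hf h 0 (s * T) T,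
      ← pathCost_add_adjacent hΦ hf h (s * T) (t * T) T]
    rw [show s * T + (t - s) * T = t * T by ring,
      show 0 + (T - (t - s) * T) - s * T + t * T = T by ring]
    ring

theorem circ_eq_zero_of_time {Φ : Ed 2 → Ed 2} (hΦ : Continuous Φ) {ξ : PathSpace} (hT : ξ.time = 0) : circ Φ ξ = 0 := by
  have := abs_circ_le_mean hΦ.norm (fun x => le_rfl) ξ
  rw [hT, zero_mul] at this
  exact abs_nonpos_iff.mp this

theorem time_mul_loopCost {Φ : Ed 2 → Ed 2} (hΦ : Continuous Φ) (f : Ed 2 → ℝ) {ξ : PathSpace}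
    (hl : ξ.cur 0 = ξ.cur 1) : ξ.time * loopCost Φ f ξ = circ Φ ξ + ξ.time * mean f ξ := by
  rw [loopCost, ← hl, sub_self, inner_zero_right, sub_zero, mul_add]
  rcases eq_or_ne ξ.time 0 with h | h
  · rw [h, circ_eq_zero_of_time hΦ h]; simp
  · rw [mul_div_cancel₀ _ h]

theorem time_mul_loopReward (ξ : PathSpace) :
    ξ.time * loopReward ξ = (ξ.time * mean wt ξ) / (1 + ξ.time * mean wt ξ) := by
  rw [loopReward, mul_div_assoc]


theorem exists_lt_cur_eq_of_not_injOn {ξ : PathSpace} (h : ¬ InjOn ξ.cur (Ico 0 1)) :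
    ∃ s t, 0 ≤ s ∧ s < t ∧ t < 1 ∧ ξ.cur s = ξ.cur t := by
  simp only [InjOn, not_forall] at h
  obtain ⟨s, hs, t, ht, he, hne⟩ := h
  rcases lt_or_gt_of_ne hne with h | h
  · exact ⟨s, t, hs.1, h, ht.2, he⟩
  · exact ⟨t, s, ht.1, h, hs.2, he.symm⟩

/-- A loop functional which is nonnegative on constant loops, on loops avoiding a compact set and
on simple loops is nonnegative on all loops. -/
theorem loop_nonneg_of_simple {Φ : Ed 2 → Ed 2} {f : Ed 2 → ℝ} (hΦ : UCB Φ) (hf : UCB f) {R : ℝ}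
    (h0 : ∀ ξ : PathSpace, ξ.cur 0 = ξ.cur 1 → ξ.time = 0 → 0 ≤ loopCost Φ f ξ)
    (hR : ∀ ξ : PathSpace, ξ.cur 0 = ξ.cur 1 → (∀ s, R ≤ ‖ξ.cur s‖) → 0 ≤ loopCost Φ f ξ)
    (hI : ∀ ξ : PathSpace, ξ.cur 0 = ξ.cur 1 → 0 < ξ.time → InjOn ξ.cur (Ico 0 1) →
      0 ≤ loopCost Φ f ξ) (ξ : PathSpace) (hξ : ξ.cur 0 = ξ.cur 1) : 0 ≤ loopCost Φ f ξ := by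
  by_contra! hneg
  set ε := -loopCost Φ f ξ with hε
  set K : Set PathSpace := {ζ | ζ.cur 0 = ζ.cur 1 ∧ loopCost Φ f ζ ≤ -ε ∧ ζ.time ≤ ξ.time} with hK
  have hKc : IsCompact K := by
    refine (isCompact_bounded (max ξ.time (|R| + ξ.time))).of_isClosed_subset ?_ ?_
    · exact (isClosed_eq (continuous_cur_apply 0) (continuous_cur_apply 1)).inter
        ((isClosed_le (continuous_loopCost hΦ hf) continuous_const).inter
          (isClosed_le continuous_time continuous_const))
    · rintro ζ ⟨h1, h2, h3⟩
      refine ⟨h3.trans (le_max_left _ _), fun s => le_max_of_le_right ?_⟩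
      have : ¬ ∀ s, R ≤ ‖ζ.cur s‖ := fun h => by
        have := hR ζ h1 h
        linarith
      push Not at this
      obtain ⟨u, hu⟩ := this
      obtain ⟨v, hv, hvu⟩ : ∃ v ∈ Icc (0:ℝ) 1, ζ.cur v = ζ.cur u :=
        ⟨_, (projIcc (0:ℝ) 1 zero_le_one u).2, ζ.cur_coe _⟩
      have h4 := ζ.dist_cur_le_time s.2 hv
      rw [hvu, dist_eq_norm] at h4
      have h5 := norm_le_norm_add_norm_sub (ζ.cur u) (ζ.cur s)
      rw [norm_sub_rev] at h5
      linarith [le_abs_self R]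
  obtain ⟨ζ, ⟨hl, hN, hle⟩, hmin⟩ := hKc.exists_isMinOn ⟨ξ, hξ, by simp [hε], le_rfl⟩
    continuous_time.continuousOn
  have hpos : 0 < ζ.time := by
    refine lt_of_le_of_ne ζ.time_nonneg fun h => ?_
    have := h0 ζ hl h.symm
    linarith
  by_cases hinj : InjOn ζ.cur (Ico 0 1)
  · have := hI ζ hl hpos hinj
    linarith
  obtain ⟨s, t, hs, hst, ht, he⟩ := exists_lt_cur_eq_of_not_injOn hinj
  obtain ⟨ζ₁, ζ₂, l1, l20, l21, t1, t2, hc⟩ := ζ.exists_cut hpos hs hst ht.le he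
  have l2 : ζ₂.cur 0 = ζ₂.cur 1 := by rw [l20, l21, hl]
  have hc' := hc hΦ.continuous hf.continuous
  rw [← time_mul_loopCost hΦ.continuous f l1, ← time_mul_loopCost hΦ.continuous f l2,
    ← time_mul_loopCost hΦ.continuous f hl] at hc'
  have key : ∀ ζ' : PathSpace, ζ'.cur 0 = ζ'.cur 1 → 0 < ζ'.time → ζ'.time < ζ.time →
      -ε * ζ'.time < ζ'.time * loopCost Φ f ζ' := fun ζ' h1 h2 h3 => by
    by_contra! h4
    have : ζ' ∈ K := ⟨h1, by nlinarith, (h3.le.trans hle)⟩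
    exact absurd (hmin this) (not_le.mpr h3)
  have a1 : ζ₁.time < ζ.time := by rw [t1]; nlinarith
  have a2 : 0 < ζ₁.time := by rw [t1]; exact mul_pos (by linarith) hpos
  have k1 := key ζ₁ l1 a2 a1
  have k2 := key ζ₂ l2 (by linarith) (by linarith)
  have : ζ.time * loopCost Φ f ζ ≤ ζ.time * -ε := mul_le_mul_of_nonneg_left hN hpos.le
  nlinarith

end PathSpace

theorem DivFlow.integrable_τ (D : DivFlow) : Integrable D.τ D.σ :=
  Integrable.of_bound D.measurable_τ.aestronglyMeasurable 1 (D.norm_τ.mono fun _ h => h.le)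

theorem DivFlow.exists_smooth_integral_ne_zero (D : DivFlow) (hσ : D.σ ≠ 0) :
    ∃ g : Ed 2 → ℝ, ContDiff ℝ (⊤ : ℕ∞) g ∧ HasCompactSupport g ∧ ∫ x, g x • D.τ x ∂D.σ ≠ 0 := by
  by_contra! h
  have h0 := ae_eq_zero_of_integral_contDiff_smul_eq_zero D.integrable_τ.locallyIntegrable h
  refine hσ (ae_eq_bot.mp (Filter.eventually_false_iff_eq_bot.mp ?_))
  filter_upwards [h0, D.norm_τ] with x hx h1
  rw [hx, norm_zero] at h1
  exact zero_ne_one h1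

theorem min_le_div_one_add {M : ℝ} (hM : 0 ≤ M) : min 1 M / 2 ≤ M / (1 + M) := by
  rw [div_le_div_iff₀ two_pos (by linarith)]
  rcases le_total M 1 with h | h
  · rw [min_eq_right h]; nlinarith
  · rw [min_eq_left h]; nlinarith

/-- A loop functional whose circulations are nonnegative on loops through the origin admits a
potential when there are no sources. -/
theorem DivFlow.integral_nonneg_of_loops (D : DivFlow) (hp : D.ρp = 0) (hm : D.ρm = 0)
    {Ψ : Ed 2 → Ed 2} {f : Ed 2 → ℝ} (hΨ : UCB Ψ) (hf : UCB f)
    (h : ∀ ξ : PathSpace, ξ.cur 0 = ξ.cur 1 → 0 ≤ loopCost Ψ f ξ) :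
    0 ≤ ∫ x, (⟪Ψ x, D.τ x⟫ + f x) ∂D.σ := by
  obtain ⟨C₁, h1⟩ := hΨ.bdd
  obtain ⟨C₂, h2⟩ := hf.bdd
  obtain ⟨φ, hφ, -, -⟩ := exists_potential (Ψ := Ψ) (g := f) (b := fun _ => 0)
    (m := fun y => -(C₁ + C₂) * ‖y‖) hΨ.continuous hf.continuous (singleton_nonempty (0 : Ed 2)) (by
      intro γ T hγ hT h0
      rw [mem_singleton_iff] at h0
      obtain ⟨γ', hγ', h3, h4⟩ := exists_line (γ T) 0
      rw [zero_sub, norm_neg] at h4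
      have h5 := abs_pathCost_le h1 h2 hγ' (norm_nonneg (γ T))
      rw [sub_zero] at h5
      have h6 := lipschitz_glue hγ hγ' h3.symm
      have h7 : 0 ≤ pathCost Ψ f (glue γ γ' T 0) 0 (T + ‖γ T‖) := by
        rcases (add_nonneg hT (norm_nonneg (γ T))).eq_or_lt with h8 | h8
        · rw [← h8, pathCost_self]
        · have h9 : glue γ γ' T 0 0 = glue γ γ' T 0 (0 + (T + ‖γ T‖)) := by
            rw [glue_of_le hT, glue_of_ge h3.symm (by linarith [norm_nonneg (γ T)]), h0, ← h4]
            congr 1; ring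
          have h10 := time_mul_loopCost_mk h6 0 h8 h9 hΨ.continuous hf.continuous
          rw [zero_add] at h10
          rw [← h10]
          refine mul_nonneg h8.le (h _ ?_)
          rw [cur_mk_zero, cur_mk_one, h9]
      rw [pathCost_glue hΨ.continuous hf.continuous hγ hγ' h3.symm hT
        (by linarith [norm_nonneg (γ T)]), show T + ‖γ T‖ - T + 0 = ‖γ T‖ by ring] at h7
      have := (abs_le.mp h5).2
      linarith)
  have := D.potential_le hΨ hf hφ (by rw [hp]; exact integrable_zero_measure)
    (by rw [hm]; exact integrable_zero_measure)
  rwa [hp, hm, integral_zero_measure, sub_zero] at this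

theorem PathSpace.loopCost_add_smul {Φ Φ₀ : Ed 2 → Ed 2} {f : Ed 2 → ℝ} (hΦ : Continuous Φ)
    (hΦ₀ : Continuous Φ₀) (c : ℝ) {ξ : PathSpace} (hl : ξ.cur 0 = ξ.cur 1) :
    loopCost (Φ + c • Φ₀) f ξ = loopCost Φ f ξ + c * circ Φ₀ ξ / ξ.time := by
  rw [loopCost, loopCost, circ_add hΦ (hΦ₀.const_smul c), circ_smul, ← hl]
  simp only [sub_self, inner_zero_right, sub_zero]
  ring

/-- A nonzero flow without sources has a uniformly positive price. -/
theorem DivFlow.exists_le_total_of_loops (D : DivFlow) (hp : D.ρp = 0) (hm : D.ρm = 0)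
    (hσ : D.σ ≠ 0) : ∃ c, 0 < c ∧ ∀ θ : Price, θ.Feasible → c ≤ θ.total D := by
  obtain ⟨g, hg, hgs, hne⟩ := D.exists_smooth_integral_ne_zero hσ
  set v := ∫ x, g x • D.τ x ∂D.σ with hv
  set Φ₀ : Ed 2 → Ed 2 := fun x => g x • v with hΦ₀
  have hc : Continuous Φ₀ := hg.continuous.smul continuous_const
  have hsupp : HasCompactSupport Φ₀ := hgs.smul_right
  have hu : UCB Φ₀ := UCB.of_hasCompactSupport hc hsupp
  have h_int : ∫ x, ⟪Φ₀ x, D.τ x⟫ ∂D.σ = ‖v‖ ^ 2 := by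
    have h1 : Integrable (fun x => g x • D.τ x) D.σ := by
      obtain ⟨B, hB⟩ := hgs.exists_bound_of_continuous hg.continuous
      exact D.integrable_τ.bdd_smul B hg.continuous.aestronglyMeasurable
        (Eventually.of_forall hB)
    rw [← real_inner_self_eq_norm_sq]
    nth_rewrite 2 [hv]
    rw [← integral_inner h1 v]
    refine integral_congr_ae (Eventually.of_forall fun x => ?_)
    simp only [hΦ₀]
    rw [real_inner_smul_left, real_inner_smul_right]
  obtain ⟨C, hC⟩ := exists_bound_circ_of_simple (hg.of_le (by exact_mod_cast le_top)) hgs v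
  obtain ⟨C', hC'⟩ := (hsupp.smul_left (f := fun x : Ed 2 => 1 + ‖x‖)).exists_bound_of_continuous
    ((by fun_prop : Continuous fun x : Ed 2 => 1 + ‖x‖).smul hc)
  have hC'0 : 0 ≤ C' := (norm_nonneg _).trans (hC' 0)
  have hwt : ∀ x, ‖Φ₀ x‖ ≤ (C' • wt) x := fun x => by
    have h1 := hC' x
    have h2 : 0 < 1 + ‖x‖ := by positivity
    rw [Pi.smul_apply', norm_smul, Real.norm_of_nonneg h2.le, mul_comm] at h1
    rw [Pi.smul_apply, smul_eq_mul, wt, ← div_eq_mul_inv, le_div_iff₀ h2]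
    exact h1
  obtain ⟨R, hR⟩ := hsupp.isCompact.isBounded.subset_ball (0 : Ed 2)
  have hR0 : ∀ x, R ≤ ‖x‖ → Φ₀ x = 0 := fun x hx => by
    by_contra h
    have := hR (subset_tsupport _ h)
    rw [mem_ball_zero_iff] at this
    linarith
  set κ : ℝ := (2 * (|C| + C' + 1))⁻¹ with hκ
  have hκ0 : 0 < κ := by have := abs_nonneg C; positivity
  refine ⟨κ * ‖v‖ ^ 2, by have := norm_pos_iff.mpr hne; positivity, fun θ hθ => ?_⟩
  have hΨ : UCB (θ.Φ + (-κ) • Φ₀) := θ.hΦ.add (hu.smul _)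
  have hloop : ∀ ξ : PathSpace, ξ.cur 0 = ξ.cur 1 → loopCost (θ.Φ + (-κ) • Φ₀) θ.f ξ =
      θ.loop ξ + (-κ) * circ Φ₀ ξ / ξ.time := fun ξ hl =>
    loopCost_add_smul θ.hΦ.continuous hc _ hl
  have hfeas : ∀ ξ : PathSpace, ξ.cur 0 = ξ.cur 1 → 0 ≤ θ.loop ξ := fun ξ hl =>
    ξ.loopReward_pos.le.trans (hθ.loop ξ hl)
  have hnn := D.integral_nonneg_of_loops hp hm hΨ θ.hf fun ξ hξ => by
    refine loop_nonneg_of_simple (R := R) hΨ θ.hf (fun ξ hl h0 => ?_) (fun ξ hl hout => ?_)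
      (fun ξ hl hpos hinj => ?_) ξ hξ
    · rw [hloop ξ hl, h0, div_zero, add_zero]
      exact hfeas ξ hl
    · rw [hloop ξ hl]
      have : circ Φ₀ ξ = 0 := by simp [circ, lineInt, fun t => hR0 _ (hout t)]
      rw [this, mul_zero, zero_div, add_zero]
      exact hfeas ξ hl
    · rw [hloop ξ hl]
      have h1 := hC ξ hl hinj
      have h2 := abs_circ_le_mean (continuous_wt.const_smul C') hwt ξ
      rw [mean_smul] at h2
      set M := ξ.time * mean wt ξ with hM
      have hM0 : 0 ≤ M := mul_nonneg ξ.time_nonneg ξ.mean_wt_pos.le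
      have h3 : κ * circ Φ₀ ξ ≤ min 1 M / 2 := by
        have h4 : (|C| + C' + 1) * min 1 M ≥ |circ Φ₀ ξ| := by
          rcases le_total M 1 with h | h
          · rw [min_eq_right h]
            have := abs_nonneg C
            nlinarith
          · rw [min_eq_left h]
            have : |circ Φ₀ ξ| ≤ C := h1
            linarith [le_abs_self C]
        have h5 : 0 < |C| + C' + 1 := by have := abs_nonneg C; positivity
        rw [hκ, mul_inv, mul_assoc, inv_mul_eq_div, div_le_div_iff_of_pos_right two_pos,
          inv_mul_le_iff₀ h5]
        exact (le_abs_self _).trans h4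
      have h6 := min_le_div_one_add hM0
      have h7 := hθ.loop ξ hl
      have h8 := ξ.time_mul_loopReward
      rw [← hM] at h8
      have h9 : κ * circ Φ₀ ξ / ξ.time ≤ θ.loop ξ := by
        rw [div_le_iff₀ hpos, mul_comm (θ.loop ξ)]
        have := mul_le_mul_of_nonneg_left h7 hpos.le
        linarith
      rw [neg_mul, neg_div]
      linarith
  have e : ∀ x, ⟪(θ.Φ + (-κ) • Φ₀) x, D.τ x⟫ + θ.f x =
      (⟪θ.Φ x, D.τ x⟫ + θ.f x) + (-κ) * ⟪Φ₀ x, D.τ x⟫ := fun x => by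
    rw [Pi.add_apply, Pi.smul_apply, inner_add_left, real_inner_smul_left]; ring
  simp only [e] at hnn
  rw [integral_add (θ.integrable_density D)
    ((hu.integrable_inner D.measurable_τ D.norm_τ).const_mul _), integral_const_mul, h_int] at hnn
  have h10 : ∫ x, (⟪θ.Φ x, D.τ x⟫ + θ.f x) ∂D.σ ≤ ∫ x, max (⟪θ.Φ x, D.τ x⟫ + θ.f x) 0 ∂D.σ :=
    integral_mono (θ.integrable_density D) (θ.integrable_density D).pos_part fun x => le_max_left _ _
  have h11 : θ.total D = ∫ x, max (⟪θ.Φ x, D.τ x⟫ + θ.f x) 0 ∂D.σ := by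
    simp [Price.total, hp, hm]
  rw [h11]
  linarith

/-- A flow whose price can be made arbitrarily small vanishes. -/
theorem DivFlow.eq_zero_of_total_small (D : DivFlow)
    (h : ∀ ε > 0, ∃ θ : Price, θ.Feasible ∧ θ.total D < ε) : D.σ = 0 ∧ D.ρp = 0 ∧ D.ρm = 0 := by
  have key : ¬ ∃ c, 0 < c ∧ ∀ θ : Price, θ.Feasible → c ≤ θ.total D := by
    rintro ⟨c, hc, hle⟩
    obtain ⟨θ, h1, h2⟩ := h c hc
    exact absurd (hle θ h1) (not_le.mpr h2)
  have hp : D.ρp = 0 := by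
    by_contra hne
    exact key (D.exists_le_total_of_endpoints hne)
  have hm : D.ρm = 0 := by
    have := D.real_univ_eq
    rw [hp, measureReal_zero, Pi.zero_apply] at this
    exact Measure.measure_univ_eq_zero.mp ((measureReal_eq_zero_iff).mp this.symm)
  refine ⟨?_, hp, hm⟩
  by_contra hne
  exact key (D.exists_le_total_of_loops hp hm hne)

/-- A packing which is optimal for the rewards. -/
structure TightPacking (D : DivFlow) extends Packing D where
  tight : ∀ ε > 0, ∃ θ : Price, θ.Feasible ∧
    θ.total D < ∫ ξ, ξ.loopReward ∂lam₁ + ∫ ξ, ξ.arcReward ∂lam₂ + ε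

theorem nonempty_tightPacking (D : DivFlow) : Nonempty (TightPacking D) := by
  obtain ⟨lam₁, lam₂, h₁, h₂, hl, hle, ht⟩ := exists_dual_measures D
  exact ⟨⟨⟨lam₁, lam₂, h₁, h₂, hl, hle⟩, ht⟩⟩

namespace TightPacking

variable {D : DivFlow} (P : TightPacking D)

instance : IsFiniteMeasure P.lam₁ := P.finite₁

instance : IsFiniteMeasure P.lam₂ := P.finite₂

theorem integrable_loopReward : Integrable loopReward P.lam₁ :=
  Integrable.of_bound continuous_loopReward.aestronglyMeasurable 1 (Eventually.of_forall fun ξ => by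
    rw [Real.norm_of_nonneg ξ.loopReward_pos.le]; exact ξ.loopReward_le_one)

theorem integrable_arcReward : Integrable arcReward P.lam₂ :=
  Integrable.of_bound continuous_arcReward.aestronglyMeasurable 1 (Eventually.of_forall fun ξ => by
    rw [Real.norm_of_nonneg ξ.arcReward_pos.le]; exact ξ.arcReward_le_one)

theorem integral_loopReward_le {θ : Price} (hθ : θ.Feasible) :
    ∫ ξ, ξ.loopReward ∂P.lam₁ ≤ ∫ ξ, θ.loop ξ ∂P.lam₁ :=
  integral_mono_ae P.integrable_loopReward θ.integrable_loop
    (P.isLoop.mono fun ξ hξ => hθ.loop ξ hξ)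

theorem integral_arcReward_le {θ : Price} (hθ : θ.Feasible) :
    ∫ ξ, ξ.arcReward ∂P.lam₂ ≤ ∫ ξ, θ.arc ξ ∂P.lam₂ :=
  integral_mono P.integrable_arcReward θ.integrable_arc hθ.arc

theorem remainder_eq_zero :
    P.remainder.σ = 0 ∧ P.remainder.ρp = 0 ∧ P.remainder.ρm = 0 := by
  refine P.remainder.eq_zero_of_total_small fun ε hε => ?_
  obtain ⟨θ, hθ, ht⟩ := P.tight ε hε
  have h1 := P.integral_loopReward_le hθ
  have h2 := P.integral_arcReward_le hθ
  have h3 := P.total_remainder_le (θ := θ)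
  exact ⟨θ, hθ, by linarith⟩

theorem _root_.MeasureTheory.Measure.eq_of_sub_eq_zero {α : Type*} [MeasurableSpace α]
    {μ ν : Measure α} [IsFiniteMeasure ν] (hle : ν ≤ μ) (h : μ - ν = 0) : ν = μ := by
  have := Measure.sub_add_cancel_of_le hle
  rwa [h, zero_add] at this

theorem occ_eq : P.occ = D.σ := Measure.eq_of_sub_eq_zero P.occ_le P.remainder_eq_zero.1

theorem start_eq : P.start = D.ρp := Measure.eq_of_sub_eq_zero P.start_le P.remainder_eq_zero.2.1

theorem sink_eq : P.sink = D.ρm := Measure.eq_of_sub_eq_zero P.sink_le P.remainder_eq_zero.2.2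

theorem ae_loop_tight : ∀ᵐ ξ ∂P.lam₁, ∀ ε > 0, ∃ θ : Price, θ.Feasible ∧
    θ.loop ξ < loopReward ξ + ε := by
  choose θ hθ ht using fun n : ℕ => P.tight (1 / (n + 1 : ℝ)) (by positivity)
  have := ae_forall_exists_lt_of_integral (μ := P.lam₁) (u := fun n ξ => (θ n).loop ξ - loopReward ξ)
    (fun n => ((θ n).continuous_loop.sub continuous_loopReward).measurable)
    (fun n => (θ n).integrable_loop.sub P.integrable_loopReward)
    (fun n => P.isLoop.mono fun ξ hξ => sub_nonneg.mpr ((hθ n).loop ξ hξ)) fun ε hε => by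
      obtain ⟨n, hn⟩ := exists_nat_one_div_lt hε
      refine ⟨n, ?_⟩
      rw [integral_sub (θ n).integrable_loop P.integrable_loopReward]
      have h2 := P.integral_arcReward_le (hθ n)
      have h3 := P.total_remainder_le (θ := θ n)
      have h4 := (θ n).total_nonneg P.remainder
      have h5 := ht n
      linarith
  filter_upwards [this] with ξ hξ ε hε
  obtain ⟨n, hn⟩ := hξ ε hε
  exact ⟨θ n, hθ n, by linarith⟩

theorem ae_arc_tight : ∀ᵐ ξ ∂P.lam₂, ∀ ε > 0, ∃ θ : Price, θ.Feasible ∧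
    θ.arc ξ < arcReward ξ + ε := by
  choose θ hθ ht using fun n : ℕ => P.tight (1 / (n + 1 : ℝ)) (by positivity)
  have := ae_forall_exists_lt_of_integral (μ := P.lam₂) (u := fun n ξ => (θ n).arc ξ - arcReward ξ)
    (fun n => ((θ n).continuous_arc.sub continuous_arcReward).measurable)
    (fun n => (θ n).integrable_arc.sub P.integrable_arcReward)
    (fun n => Eventually.of_forall fun ξ => sub_nonneg.mpr ((hθ n).arc ξ)) fun ε hε => by
      obtain ⟨n, hn⟩ := exists_nat_one_div_lt hε
      refine ⟨n, ?_⟩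
      rw [integral_sub (θ n).integrable_arc P.integrable_arcReward]
      have h2 := P.integral_loopReward_le (hθ n)
      have h3 := P.total_remainder_le (θ := θ n)
      have h4 := (θ n).total_nonneg P.remainder
      have h5 := ht n
      linarith
  filter_upwards [this] with ξ hξ ε hε
  obtain ⟨n, hn⟩ := hξ ε hε
  exact ⟨θ n, hθ n, by linarith⟩

end TightPacking

theorem div_one_add_add_lt {a b : ℝ} (ha : 0 < a) (hb : 0 < b) :
    (a + b) / (1 + (a + b)) < a / (1 + a) + b / (1 + b) := by
  rw [add_div]
  exact add_lt_add (div_lt_div_of_pos_left ha (by linarith) (by linarith))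
    (div_lt_div_of_pos_left hb (by linarith) (by linarith))

namespace PathSpace

theorem time_mul_mean_cut {ξ ξ₁ ξ₂ : PathSpace} {f : Ed 2 → ℝ}
    (hc : ∀ {Φ : Ed 2 → Ed 2} {f : Ed 2 → ℝ}, Continuous Φ → Continuous f →
      (circ Φ ξ₁ + ξ₁.time * mean f ξ₁) + (circ Φ ξ₂ + ξ₂.time * mean f ξ₂) =
        circ Φ ξ + ξ.time * mean f ξ) (hf : Continuous f) :
    ξ₁.time * mean f ξ₁ + ξ₂.time * mean f ξ₂ = ξ.time * mean f ξ := by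
  have h0 : ∀ ζ : PathSpace, circ (fun _ => 0) ζ = 0 := fun ζ => by simp [circ, lineInt]
  have := hc (Φ := fun _ => 0) continuous_const hf
  simpa only [h0, zero_add] using this

theorem injOn_of_loop_tight {ξ : PathSpace} (hl : ξ.cur 0 = ξ.cur 1) (hT : 0 < ξ.time)
    (h : ∀ ε > 0, ∃ θ : Price, θ.Feasible ∧ θ.loop ξ < loopReward ξ + ε) :
    InjOn ξ.cur (Ico 0 1) := by
  by_contra hinj
  obtain ⟨s, t, hs, hst, ht, he⟩ := exists_lt_cur_eq_of_not_injOn hinj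
  obtain ⟨ζ₁, ζ₂, l1, l20, l21, t1, t2, hc⟩ := ξ.exists_cut hT hs hst ht.le he
  have l2 : ζ₂.cur 0 = ζ₂.cur 1 := by rw [l20, l21, hl]
  have p1 : 0 < ζ₁.time := by rw [t1]; exact mul_pos (by linarith) hT
  have p2 : 0 < ζ₂.time := by rw [t2]; nlinarith
  have hM := time_mul_mean_cut hc continuous_wt
  have hlt := div_one_add_add_lt (mul_pos p1 ζ₁.mean_wt_pos) (mul_pos p2 ζ₂.mean_wt_pos)
  rw [hM, ← time_mul_loopReward, ← time_mul_loopReward, ← time_mul_loopReward] at hlt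
  set δ := ζ₁.time * ζ₁.loopReward + ζ₂.time * ζ₂.loopReward - ξ.time * ξ.loopReward with hδ
  have hδ0 : 0 < δ := by linarith
  obtain ⟨θ, hθ, hlt'⟩ := h (δ / ξ.time) (by positivity)
  have hc' := hc θ.hΦ.continuous θ.hf.continuous
  rw [← time_mul_loopCost θ.hΦ.continuous _ l1, ← time_mul_loopCost θ.hΦ.continuous _ l2,
    ← time_mul_loopCost θ.hΦ.continuous _ hl] at hc'
  have h1 := mul_le_mul_of_nonneg_left (hθ.loop ζ₁ l1) p1.le
  have h2 := mul_le_mul_of_nonneg_left (hθ.loop ζ₂ l2) p2.le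
  have h3 := mul_lt_mul_of_pos_left hlt' hT
  rw [mul_add, mul_div_cancel₀ _ hT.ne'] at h3
  simp only [Price.loop] at h1 h2 h3
  linarith

theorem injOn_of_arc_tight {ξ : PathSpace} (hT : 0 < ξ.time)
    (h : ∀ ε > 0, ∃ θ : Price, θ.Feasible ∧ θ.arc ξ < arcReward ξ + ε) :
    InjOn ξ.cur (Ico 0 1) := by
  by_contra hinj
  obtain ⟨s, t, hs, hst, ht, he⟩ := exists_lt_cur_eq_of_not_injOn hinj
  obtain ⟨ζ₁, ζ₂, l1, l20, l21, t1, t2, hc⟩ := ξ.exists_cut hT hs hst ht.le he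
  have p1 : 0 < ζ₁.time := by rw [t1]; exact mul_pos (by linarith) hT
  have hr : ∀ ζ : PathSpace, (1 + ζ.time) * arcReward ζ = wt (ζ.cur 0) / (1 + ζ.time) := fun ζ => by
    have := ζ.one_add_time_pos
    rw [arcReward]; field_simp
  have hlt : (1 + ξ.time) * arcReward ξ < (1 + ζ₂.time) * arcReward ζ₂ := by
    rw [hr, hr, l20]
    exact div_lt_div_of_pos_left (wt_pos _) ζ₂.one_add_time_pos (by linarith)
  set δ := (1 + ζ₂.time) * arcReward ζ₂ - (1 + ξ.time) * arcReward ξ with hδ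
  have hδ0 : 0 < δ := by linarith
  have hpos := ξ.one_add_time_pos
  obtain ⟨θ, hθ, hlt'⟩ := h (δ / (1 + ξ.time)) (by positivity)
  have hc' := hc θ.hΦ.continuous θ.hf.continuous
  rw [← time_mul_loopCost θ.hΦ.continuous _ l1] at hc'
  have ha : ∀ ζ : PathSpace, (1 + ζ.time) * θ.arc ζ =
      circ θ.Φ ζ + ζ.time * mean θ.f ζ + θ.p (ζ.cur 0) + θ.q (ζ.cur 1) := fun ζ => by
    have := ζ.one_add_time_pos
    rw [Price.arc, arcCost]; field_simp
  have h1 := mul_nonneg p1.le (ζ₁.loopReward_pos.le.trans (hθ.loop ζ₁ l1))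
  have h2 := mul_le_mul_of_nonneg_left (hθ.arc ζ₂) ζ₂.one_add_time_pos.le
  have h3 := mul_lt_mul_of_pos_left hlt' hpos
  rw [mul_add, mul_div_cancel₀ _ hpos.ne', ha] at h3
  rw [ha, l20, l21] at h2
  simp only [Price.loop] at h1
  linarith

end PathSpace

namespace TightPacking

variable {D : DivFlow} (P : TightPacking D)

theorem ae_injOn_loop : ∀ᵐ ξ ∂P.lam₁, InjOn ξ.cur (Ico 0 1) := by
  have h0 : ∀ᵐ ξ ∂P.lam₁, 0 < ξ.time := (ae_add_measure_iff.mp P.ae_time_pos).1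
  filter_upwards [P.isLoop, h0, P.ae_loop_tight] with ξ h1 h2 h3
  exact injOn_of_loop_tight h1 h2 h3

theorem ae_ne (hsing : D.ρp.MutuallySingular D.ρm) : ∀ᵐ ξ ∂P.lam₂, ξ.cur 0 ≠ ξ.cur 1 := by
  obtain ⟨A, hA, h1, h2⟩ := hsing
  rw [← P.start_eq, Packing.start, Measure.map_apply (continuous_cur_apply 0).measurable hA] at h1
  rw [← P.sink_eq, Packing.sink, Measure.map_apply (continuous_cur_apply 1).measurable hA.compl] at h2
  have h3 : ∀ᵐ ξ ∂P.lamE, ξ.cur 0 ≠ ξ.cur 1 := by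
    filter_upwards [measure_eq_zero_iff_ae_notMem.mp h1, measure_eq_zero_iff_ae_notMem.mp h2]
      with ξ h3 h4 he
    exact h4 fun h => h3 (by rw [mem_preimage, he]; exact h)
  rw [Packing.lamE, ae_withDensity_iff measurable_endWeight.ennreal_ofReal] at h3
  filter_upwards [h3] with ξ h
  refine h (ENNReal.ofReal_pos.mpr ?_).ne'
  have := ξ.one_add_time_pos
  positivity

theorem ae_injOn_arc (hsing : D.ρp.MutuallySingular D.ρm) :
    ∀ᵐ ξ ∂P.lam₂, InjOn ξ.cur (Ico 0 1) := by
  filter_upwards [P.ae_ne hsing, P.ae_arc_tight] with ξ h1 h2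
  refine injOn_of_arc_tight (lt_of_le_of_ne ξ.time_nonneg fun h => h1 ?_) h2
  have := ξ.dist_cur_le_time (left_mem_Icc.mpr zero_le_one) (right_mem_Icc.mpr zero_le_one)
  rw [← h] at this
  exact dist_le_zero.mp this

theorem lamT_absolutelyContinuous : P.lamT ≪ P.lam₂ := withDensity_absolutelyContinuous _ _

theorem ae_injOn (hsing : D.ρp.MutuallySingular D.ρm) : ∀ᵐ ξ ∂P.kap, InjOn ξ.cur (Ico 0 1) :=
  ae_add_measure_iff.mpr ⟨P.ae_injOn_loop, P.lamT_absolutelyContinuous.ae_le (P.ae_injOn_arc hsing)⟩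

end TightPacking

namespace Curve

instance : BorelSpace (Curve 2) := ⟨rfl⟩

/-- The position of a curve, extended constantly outside the unit interval. -/
def pos (γ : Curve 2) (t : ℝ) : Ed 2 := curveRestrict γ (projIcc 0 1 zero_le_one t)

theorem pos_of_mem (γ : Curve 2) {t : ℝ} (ht : t ∈ Icc (0:ℝ) 1) : γ.pos t = γ.1 t := by
  rw [pos, projIcc_of_mem _ ht]; rfl

theorem continuous_curveRestrict : Continuous (curveRestrict : Curve 2 → _) := continuous_induced_dom

theorem continuous_pos : Continuous fun z : Curve 2 × ℝ => z.1.pos z.2 :=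
  Continuous.eval (continuous_curveRestrict.comp continuous_fst)
    ((continuous_projIcc (h := zero_le_one)).comp continuous_snd)

theorem continuous_pos_apply (t : ℝ) : Continuous fun γ : Curve 2 => γ.pos t :=
  continuous_pos.comp (continuous_id.prodMk continuous_const)

/-- Difference quotient of the position. -/
def quot (n : ℕ) (γ : Curve 2) (t : ℝ) : Ed 2 := ((1 / (n + 1 : ℝ))⁻¹) • (γ.pos (t + 1 / (n + 1)) - γ.pos t)

theorem continuous_quot (n : ℕ) : Continuous fun z : Curve 2 × ℝ => quot n z.1 z.2 := by
  have h : Continuous fun z : Curve 2 × ℝ => z.1.pos (z.2 + 1 / (n + 1)) :=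
    continuous_pos.comp (continuous_fst.prodMk (continuous_snd.add continuous_const))
  exact (h.sub continuous_pos).const_smul ((1 / (n + 1 : ℝ))⁻¹)

theorem norm_quot_le {γ : Curve 2} {K : ℝ≥0} (hK : LipschitzWith K γ.1) (n : ℕ) (t : ℝ) :
    ‖quot n γ t‖ ≤ K := by
  have h0 : (0:ℝ) < 1 / (n + 1 : ℝ) := by positivity
  have h1 : dist (γ.pos (t + 1 / (n + 1))) (γ.pos t) ≤ K * (1 / (n + 1 : ℝ)) := by
    refine (hK.dist_le_mul _ _).trans (mul_le_mul_of_nonneg_left ?_ K.2)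
    refine ((LipschitzWith.projIcc (zero_le_one (α := ℝ))).dist_le_mul (t + 1 / (n + 1)) t).trans_eq ?_
    rw [Real.dist_eq, add_sub_cancel_left, abs_of_pos h0]; simp
  rw [quot, norm_smul, norm_inv, Real.norm_of_nonneg h0.le, ← dist_eq_norm, inv_mul_le_iff₀ h0,
    mul_comm]
  exact h1

theorem tendsto_quot (γ : Curve 2) {t : ℝ} (ht : t ∈ Ioo (0:ℝ) 1) (hd : DifferentiableAt ℝ γ.1 t) :
    Tendsto (fun n => quot n γ t) atTop (𝓝 (deriv γ.1 t)) := by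
  have h0 : Tendsto (fun n : ℕ => 1 / (n + 1 : ℝ)) atTop (𝓝[>] 0) :=
    tendsto_nhdsWithin_iff.mpr ⟨tendsto_one_div_add_atTop_nhds_zero_nat,
      Eventually.of_forall fun n => by show (0:ℝ) < _; positivity⟩
  have h1 := hd.hasDerivAt.tendsto_slope_zero_right.comp h0
  refine h1.congr' ?_
  filter_upwards [(tendsto_one_div_add_atTop_nhds_zero_nat (𝕜 := ℝ)).eventually_lt_const
    (sub_pos.mpr ht.2)] with n hn
  have h2 : (0:ℝ) < 1 / (n + 1 : ℝ) := by positivity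
  rw [quot, γ.pos_of_mem ⟨ht.1.le, ht.2.le⟩, γ.pos_of_mem ⟨by linarith [ht.1], by linarith⟩]
  rfl

/-- First order integrals along curves depend measurably on the curve. -/
theorem measurable_integral {G : Ed 2 × Ed 2 → ℝ} (hG : Continuous G) :
    Measurable fun γ : Curve 2 => ∫ t in (0:ℝ)..1, G (γ.1 t, deriv γ.1 t) := by
  refine measurable_of_tendsto_metrizable
    (f := fun (n : ℕ) γ => ∫ t in (0:ℝ)..1, G (γ.pos t, quot n γ t)) (fun n => ?_) ?_
  · exact (intervalIntegral.continuous_parametric_intervalIntegral_of_continuous' (μ := volume)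
      (f := fun γ t => G (γ.pos t, quot n γ t))
      (hG.comp (continuous_pos.prodMk (continuous_quot n))) 0 1).measurable
  · refine tendsto_pi_nhds.mpr fun γ => ?_
    obtain ⟨K, hK⟩ := γ.2
    have hpc : Continuous γ.pos := continuous_pos.comp (continuous_const.prodMk continuous_id)
    have hqc : ∀ n, Continuous (quot n γ) := fun n =>
      (continuous_quot n).comp (continuous_const.prodMk continuous_id)
    have hcomp : IsCompact ((γ.pos '' Icc 0 1) ×ˢ Metric.closedBall (0 : Ed 2) K) :=
      (isCompact_Icc.image hpc).prod (isCompact_closedBall _ _)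
    obtain ⟨C, hC⟩ := hcomp.exists_bound_of_continuousOn hG.continuousOn
    refine intervalIntegral.tendsto_integral_filter_of_dominated_convergence (μ := volume) (fun _ => C)
      (Eventually.of_forall fun n => (hG.comp (hpc.prodMk (hqc n))).aestronglyMeasurable)
      (Eventually.of_forall fun n => Eventually.of_forall fun t ht => ?_)
      (intervalIntegrable_const (μ := volume)) ?_
    · rw [uIoc_of_le zero_le_one] at ht
      refine hC _ ⟨⟨t, Ioc_subset_Icc_self ht, rfl⟩, ?_⟩
      exact mem_closedBall_zero_iff.mpr (norm_quot_le hK n t)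
    · have hne : ∀ᵐ t : ℝ, t ≠ 1 := (measure_eq_zero_iff_ae_notMem.mp (measure_singleton (1:ℝ)))
      filter_upwards [hK.ae_differentiableAt, hne] with t hd ht1 ht
      rw [uIoc_of_le zero_le_one] at ht
      have hIoo : t ∈ Ioo (0:ℝ) 1 := ⟨ht.1, lt_of_le_of_ne ht.2 ht1⟩
      have := (continuous_const.prodMk continuous_id : Continuous fun v : Ed 2 => (γ.pos t, v))
      have h2 := ((hG.comp this).tendsto (deriv γ.1 t)).comp (γ.tendsto_quot hIoo hd)
      rw [← γ.pos_of_mem (Ioc_subset_Icc_self ht)]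
      exact h2

theorem measurable_curvePair {Φ : Ed 2 → Ed 2} (hΦ : Continuous Φ) :
    Measurable fun γ : Curve 2 => curvePair γ.1 Φ :=
  measurable_integral (G := fun z => ⟪Φ z.1, z.2⟫) (by fun_prop)

theorem measurable_curveMass {f : Ed 2 → ℝ} (hf : Continuous f) :
    Measurable fun γ : Curve 2 => curveMass γ.1 f :=
  measurable_integral (G := fun z => f z.1 * ‖z.2‖) (by fun_prop)

theorem measurable_apply {t : ℝ} (ht : t ∈ Icc (0:ℝ) 1) : Measurable fun γ : Curve 2 => γ.1 t := by
  simp only [← pos_of_mem _ ht]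
  exact (continuous_pos_apply t).measurable

theorem measurable_endpoints {f : Ed 2 → ℝ} (hf : Continuous f) :
    Measurable fun γ : Curve 2 => if γ.1 0 = γ.1 1 then (0:ℝ) else f (γ.1 0) + f (γ.1 1) := by
  have h0 := measurable_apply (left_mem_Icc.mpr (zero_le_one (α := ℝ)))
  have h1 := measurable_apply (right_mem_Icc.mpr (zero_le_one (α := ℝ)))
  exact Measurable.ite (measurableSet_eq_fun h0 h1) measurable_const
    ((hf.measurable.comp h0).add (hf.measurable.comp h1))

/-- Pairs of well separated parameters staying away from the end. -/
def sepPairs (n : ℕ) : Set (ℝ × ℝ) :=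
  {z | 0 ≤ z.1 ∧ z.1 + 1 / (n + 1) ≤ z.2 ∧ z.2 ≤ 1 - 1 / (n + 1)}

theorem isCompact_sepPairs (n : ℕ) : IsCompact (sepPairs n) := by
  refine (isCompact_Icc (a := ((0:ℝ), (0:ℝ))) (b := (1, 1))).of_isClosed_subset ?_ ?_
  · exact (isClosed_le continuous_const continuous_fst).inter
      ((isClosed_le (continuous_fst.add continuous_const) continuous_snd).inter
        (isClosed_le continuous_snd continuous_const))
  · rintro ⟨s, t⟩ ⟨h1, h2, h3⟩
    have : (0:ℝ) < 1 / (n + 1 : ℝ) := by positivity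
    simp only at h1 h2 h3
    exact ⟨⟨h1, by linarith⟩, ⟨by linarith, by linarith⟩⟩

theorem not_injOn_iff (γ : Curve 2) : ¬ InjOn γ.1 (Ico 0 1) ↔
    ∃ n, ∃ z : sepPairs n, γ.pos z.1.1 = γ.pos z.1.2 := by
  constructor
  · intro h
    obtain ⟨s, t, hs, hst, ht, he⟩ : ∃ s t, 0 ≤ s ∧ s < t ∧ t < 1 ∧ γ.1 s = γ.1 t := by
      simp only [InjOn, not_forall] at h
      obtain ⟨s, hs, t, ht, he, hne⟩ := h
      rcases lt_or_gt_of_ne hne with h | h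
      · exact ⟨s, t, hs.1, h, ht.2, he⟩
      · exact ⟨t, s, ht.1, h, hs.2, he.symm⟩
    obtain ⟨n, hn⟩ := exists_nat_one_div_lt (lt_min (sub_pos.mpr hst) (sub_pos.mpr ht))
    have h1 := hn.trans_le (min_le_left _ _)
    have h2 := hn.trans_le (min_le_right _ _)
    refine ⟨n, ⟨(s, t), hs, by simp only; linarith, by simp only; linarith⟩, ?_⟩
    rw [γ.pos_of_mem ⟨hs, by linarith⟩, γ.pos_of_mem ⟨by linarith, ht.le⟩, he]
  · rintro ⟨n, ⟨⟨s, t⟩, h1, h2, h3⟩, he⟩ hinj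
    have : (0:ℝ) < 1 / (n + 1 : ℝ) := by positivity
    simp only at h1 h2 h3 he
    rw [γ.pos_of_mem ⟨h1, by linarith⟩, γ.pos_of_mem ⟨by linarith, by linarith⟩] at he
    have := hinj ⟨h1, by linarith⟩ ⟨by linarith, by linarith⟩ he
    linarith

theorem measurableSet_injOn : MeasurableSet {γ : Curve 2 | InjOn γ.1 (Ico 0 1)} := by
  rw [← MeasurableSet.compl_iff]
  have : {γ : Curve 2 | InjOn γ.1 (Ico 0 1)}ᶜ =
      ⋃ n, Prod.fst '' {w : Curve 2 × sepPairs n | w.1.pos w.2.1.1 = w.1.pos w.2.1.2} := by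
    ext γ
    simp only [mem_compl_iff, mem_ofPred_eq, not_injOn_iff, mem_iUnion, mem_image, Prod.exists]
    exact exists_congr fun n => ⟨fun ⟨z, hz⟩ => ⟨γ, z, hz, rfl⟩, fun ⟨_, z, hz, e⟩ => ⟨z, e ▸ hz⟩⟩
  rw [this]
  refine MeasurableSet.iUnion fun n => IsClosed.measurableSet ?_
  have := isCompact_iff_compactSpace.mp (isCompact_sepPairs n)
  refine isClosedMap_fst_of_compactSpace _ (isClosed_eq ?_ ?_)
  · exact continuous_pos.comp (continuous_fst.prodMk
      (continuous_fst.comp (continuous_subtype_val.comp continuous_snd)))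
  · exact continuous_pos.comp (continuous_fst.prodMk
      (continuous_snd.comp (continuous_subtype_val.comp continuous_snd)))

end Curve

namespace PathSpace

/-- The Lipschitz curve underlying a path. -/
def toCurve (ξ : PathSpace) : Curve 2 := ⟨ξ.cur, _, ξ.lipschitz_cur'⟩

theorem continuous_toCurve : Continuous toCurve := by
  refine continuous_induced_rng.mpr (continuous_coeMap.congr fun ξ => ?_)
  ext1 t
  exact (ξ.cur_coe t).symm

end PathSpace

namespace TightPacking

variable {D : DivFlow} (P : TightPacking D)

/-- The measure on curves decomposing a flow. -/
def curves : Measure (Curve 2) :=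
  (P.kap.withDensity fun ξ => ENNReal.ofReal (1 / ξ.time)).map toCurve

theorem measurable_inv_time : Measurable fun ξ : PathSpace => 1 / ξ.time :=
  measurable_const.div continuous_time.measurable

theorem integral_curves {g : Curve 2 → ℝ} (hg : Measurable g) :
    ∫ γ, g γ ∂P.curves = ∫ ξ, 1 / ξ.time * g ξ.toCurve ∂P.kap := by
  rw [curves, integral_map continuous_toCurve.aemeasurable hg.aestronglyMeasurable,
    integral_withDensity_ofReal measurable_inv_time fun ξ => one_div_nonneg.mpr ξ.time_nonneg]

theorem integral_curvePair {Φ : Ed 2 → Ed 2} (hΦ : UCB Φ) :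
    ∫ γ, curvePair γ.1 Φ ∂P.curves = ∫ x, ⟪Φ x, D.τ x⟫ ∂D.σ := by
  rw [P.integral_curves (Curve.measurable_curvePair hΦ.continuous), ← P.occ_eq,
    ← P.integral_speed hΦ]
  exact integral_congr_ae (Eventually.of_forall fun ξ => one_div_mul_eq_div _ _)

theorem integral_curveMass {f : Ed 2 → ℝ} (hf : UCB f) :
    ∫ γ, curveMass γ.1 f ∂P.curves = ∫ x, f x ∂D.σ := by
  rw [P.integral_curves (Curve.measurable_curveMass hf.continuous), ← P.occ_eq, P.integral_occ hf]
  refine integral_congr_ae ?_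
  filter_upwards [P.ae_time_pos, P.ae_norm_deriv] with ξ h1 h2
  have : curveMass ξ.cur f = ∫ t in (0:ℝ)..1, f (ξ.cur t) * ξ.time := by
    rw [curveMass, intervalIntegral.integral_of_le zero_le_one,
      intervalIntegral.integral_of_le zero_le_one]
    refine integral_congr_ae (h2.mono fun t ht => ?_)
    simp only [ht]
  change 1 / ξ.time * curveMass ξ.cur f = mean f ξ
  rw [this, intervalIntegral.integral_mul_const, mean]
  field_simp

theorem integral_endpoints (hsing : D.ρp.MutuallySingular D.ρm) {f : Ed 2 → ℝ} (hf : UCB f) :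
    ∫ γ, (if γ.1 0 = γ.1 1 then (0:ℝ) else f (γ.1 0) + f (γ.1 1)) ∂P.curves =
      (∫ x, f x ∂D.ρp) + ∫ x, f x ∂D.ρm := by
  obtain ⟨C, hC⟩ := hf.bdd
  have hb : ∀ s, Integrable (fun ξ : PathSpace => f (ξ.cur s)) P.lam₂ := fun s =>
    Integrable.of_bound (hf.continuous.comp (continuous_cur_apply s)).aestronglyMeasurable C
      (Eventually.of_forall fun ξ => hC _)
  have hi : ∀ s, Integrable (fun ξ => 1 / (1 + ξ.time) * f (ξ.cur s)) P.lam₂ := fun s =>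
    P.integrable_weight_mul measurable_endWeight endWeight_nonneg endWeight_le_one (hb s)
  have hm := Curve.measurable_endpoints hf.continuous
  set g : PathSpace → ℝ := fun ξ =>
    1 / ξ.time * if ξ.cur 0 = ξ.cur 1 then (0:ℝ) else f (ξ.cur 0) + f (ξ.cur 1) with hg
  have hgm : Measurable g := measurable_inv_time.mul (hm.comp continuous_toCurve.measurable)
  have e₁ : g =ᵐ[P.lam₁] fun _ => 0 := P.isLoop.mono fun ξ hξ => by simp [hg, hξ]
  have e₂ : (fun ξ => ξ.time / (1 + ξ.time) * g ξ) =ᵐ[P.lam₂]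
      fun ξ => 1 / (1 + ξ.time) * f (ξ.cur 0) + 1 / (1 + ξ.time) * f (ξ.cur 1) := by
    filter_upwards [P.ae_ne hsing] with ξ hne
    have h1 : 0 < ξ.time := lt_of_le_of_ne ξ.time_nonneg fun h => hne (by
      have := ξ.dist_cur_le_time (left_mem_Icc.mpr zero_le_one) (right_mem_Icc.mpr zero_le_one)
      rw [← h] at this
      exact dist_le_zero.mp this)
    simp only [hg, if_neg hne]
    field_simp
  have i₁ : Integrable g P.lam₁ := (integrable_congr e₁).mpr (integrable_zero _ _ _)
  have i₂ : Integrable g P.lamT := by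
    rw [Packing.lamT, integrable_withDensity_iff_integrable_smul' measurable_pathWeight.ennreal_ofReal
      (Eventually.of_forall fun _ => ENNReal.ofReal_lt_top)]
    refine (integrable_congr ?_).mpr ((hi 0).add (hi 1))
    filter_upwards [e₂] with ξ h
    rw [ENNReal.toReal_ofReal (pathWeight_nonneg ξ), smul_eq_mul]
    exact h
  rw [P.integral_curves hm, ← P.start_eq, ← P.sink_eq, P.integral_start hf.continuous,
    P.integral_sink hf.continuous]
  change ∫ ξ, g ξ ∂P.kap = _
  rw [Packing.kap, integral_add_measure i₁ i₂, integral_congr_ae e₁, integral_zero, zero_add,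
    Packing.lamT, integral_withDensity_ofReal measurable_pathWeight pathWeight_nonneg,
    integral_congr_ae e₂, integral_add (hi 0) (hi 1)]

theorem ae_injOn_curves (hsing : D.ρp.MutuallySingular D.ρm) :
    ∀ᵐ γ ∂P.curves, InjOn γ.1 (Ico 0 1) := by
  rw [curves, ae_map_iff continuous_toCurve.aemeasurable Curve.measurableSet_injOn]
  exact (withDensity_absolutelyContinuous _ _).ae_le (P.ae_injOn hsing)

end TightPacking

end

/-- **Main Theorem.** A finite vector measure `μ = τ|μ|` on `ℝ²` whose distributional
divergence is a (signed) measure `ρ = ρ⁺ - ρ⁻` can be decomposed into measures induced by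
Lipschitz curves, with `|μ| = ∫|μ_γ| dη` and `|div μ| = ∫|div μ_γ| dη`; moreover `η`-a.e.
curve induces the same measure as a curve which is injective on `[0,1)`. -/
theorem main_theorem
    (σμ : Measure (Ed 2)) [IsFiniteMeasure σμ]
    (τ : Ed 2 → Ed 2) (hτm : Measurable τ) (hτ1 : ∀ᵐ x ∂σμ, ‖τ x‖ = 1)
    (ρp ρm : Measure (Ed 2)) [IsFiniteMeasure ρp] [IsFiniteMeasure ρm]
    (hsing : ρp.MutuallySingular ρm)
    -- `div μ = ρ` in the sense of distributions
    (hdiv : ∀ φ : Ed 2 → ℝ, ContDiff ℝ (⊤ : ℕ∞) φ → HasCompactSupport φ →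
      -∫ x, fderiv ℝ φ x (τ x) ∂σμ = (∫ x, φ x ∂ρp) - ∫ x, φ x ∂ρm) :
    ∃ η : Measure (Curve 2),
      -- μ = ∫ μ_γ dη
      (∀ Φ : Ed 2 → Ed 2, Continuous Φ → HasCompactSupport Φ →
        ∫ x, ⟪Φ x, τ x⟫ ∂σμ = ∫ γ, curvePair γ.1 Φ ∂η) ∧
      -- |μ| = ∫ |μ_γ| dη
      (∀ f : Ed 2 → ℝ, Continuous f → HasCompactSupport f → (∀ x, 0 ≤ f x) →
        ∫ x, f x ∂σμ = ∫ γ, curveMass γ.1 f ∂η) ∧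
      -- |div μ| = ∫ |div μ_γ| dη  (note `div μ_γ = δ_{γ(0)} - δ_{γ(1)}`)
      (∀ f : Ed 2 → ℝ, Continuous f → HasCompactSupport f → (∀ x, 0 ≤ f x) →
        (∫ x, f x ∂ρp) + (∫ x, f x ∂ρm) =
          ∫ γ, (if γ.1 0 = γ.1 1 then (0:ℝ) else f (γ.1 0) + f (γ.1 1)) ∂η) ∧
      -- η-a.e. curve can be replaced by a simple one inducing the same measure
      (∀ᵐ γ ∂η, ∃ γt : Curve 2, Set.InjOn γt.1 (Set.Ico (0:ℝ) 1) ∧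
        ∀ Φ : Ed 2 → Ed 2, Continuous Φ → HasCompactSupport Φ →
          curvePair γ.1 Φ = curvePair γt.1 Φ) := by
  let D : DivFlow := ⟨σμ, ρp, ρm, τ, inferInstance, inferInstance, inferInstance, hτm, hτ1, hdiv⟩
  obtain ⟨P⟩ := nonempty_tightPacking D
  refine ⟨P.curves, fun Φ hΦ hs => ?_, fun f hf hs _ => ?_, fun f hf hs _ => ?_, ?_⟩
  · exact (P.integral_curvePair (UCB.of_hasCompactSupport hΦ hs)).symm
  · exact (P.integral_curveMass (UCB.of_hasCompactSupport hf hs)).symm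
  · exact (P.integral_endpoints (D := D) hsing (UCB.of_hasCompactSupport hf hs)).symm
  · exact (P.ae_injOn_curves (D := D) hsing).mono fun γ hγ => ⟨γ, hγ, fun _ _ _ => rfl⟩
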